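/- Theorem 1 (Outer bound). Let 0 < r₁ ≤ 1, 0 ≤ r₂ ≤ 1 and s := r₂/r₁. Suppose the rate pair (R₁,R₂) lies in 𝒞_{r₁,r₂}, i.e., for every ε > 0 there exists an (M₁,M₂,N₁,N₂) variable length code with decoders g₁, g₂ (measurable functions of Y^{N₁} and Y^{N₂} respectively, with values in {1,…,M₁} and {1,…,M₂}) such that log M₁/E[N₁] ≥ R₁, log M₂/E[N₂] ≥ R₂, the average error probability Pr(g₁(Y^{N₁}) ≠ W₁ or g₂(Y^{N₂}) ≠ W₂) is less than ε, E[N]/E[N₁] ≥ r₁, E[N]/E[N₂] ≥ r₂ and E[N₁]/E[N₂] = s; assume moreover that these codes can be chosen so that E[N₁] and E[N₂] tend to infinity as ε → 0. Then there exist a set 𝒬 with |𝒬| ≤ 2 and a joint distribution of (Q,X₁,X₂,Y) of the form p(q)p(x₁|q)p(x₂|q)p(y|x₁,x₂) such that: R₁ ≤ r₁·I(X₁;Y|X₂,Q) + (1−r₁)·C₁; R₂ ≤ r₂·I(X₂;Y|X₁,Q) + (1−r₂)·C₂; and s·R₁ + R₂ ≤ r₂·I(X₁,X₂;Y|Q)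 + s(1−r₁)·C₁ + (1−r₂)·C₂. -/

import Mathlib

open MeasureTheory

noncomputable section

/-- `f` is a probability mass function on the finite type `α`. -/
def IsPMF {α : Type*} [Fintype α] (f : α → ℝ) : Prop :=
  (∀ a, 0 ≤ f a) ∧ ∑ a, f a = 1

/-- The received prefix `Y^N` of random length `N` (encoded with indicators:
`some (Y i ω)` while `i < N ω`, `none` afterwards). -/
def Yprefix {Ω 𝒴 : Type*} (Y : ℕ → Ω → 𝒴) (N : Ω → ℕ) (ω : Ω) : ℕ → Option 𝒴 :=
  fun i => if i < N ω then some (Y i ω) else none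

/-- `I(X₁;Y|X₂,Q)` for a two-user memoryless channel `ch`, time-sharing
distribution `σq` on `Q` and conditionally independent inputs. -/
def mi1 {X1 X2 Y Q : Type*} [Fintype X1] [Fintype X2] [Fintype Y] [Fintype Q]
    (ch : X1 → X2 → Y → ℝ) (σq : Q → ℝ) (π₁ : Q → X1 → ℝ) (π₂ : Q → X2 → ℝ) : ℝ :=
  ∑ q, ∑ x1, ∑ x2, ∑ y, σq q * π₁ q x1 * π₂ q x2 * ch x1 x2 y *
    Real.log (ch x1 x2 y / (∑ x1', π₁ q x1' * ch x1' x2 y))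

/-- `I(X₂;Y|X₁,Q)`. -/
def mi2 {X1 X2 Y Q : Type*} [Fintype X1] [Fintype X2] [Fintype Y] [Fintype Q]
    (ch : X1 → X2 → Y → ℝ) (σq : Q → ℝ) (π₁ : Q → X1 → ℝ) (π₂ : Q → X2 → ℝ) : ℝ :=
  ∑ q, ∑ x1, ∑ x2, ∑ y, σq q * π₁ q x1 * π₂ q x2 * ch x1 x2 y *
    Real.log (ch x1 x2 y / (∑ x2', π₂ q x2' * ch x1 x2' y))

/-- `I(X₁,X₂;Y|Q)`. -/
def mi12 {X1 X2 Y Q : Type*} [Fintype X1] [Fintype X2] [Fintype Y] [Fintype Q]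
    (ch : X1 → X2 → Y → ℝ) (σq : Q → ℝ) (π₁ : Q → X1 → ℝ) (π₂ : Q → X2 → ℝ) : ℝ :=
  ∑ q, ∑ x1, ∑ x2, ∑ y, σq q * π₁ q x1 * π₂ q x2 * ch x1 x2 y *
    Real.log (ch x1 x2 y / (∑ x1', ∑ x2', π₁ q x1' * π₂ q x2' * ch x1' x2' y))

/-- `I(X₁;Y|X₂)` for product inputs `q₁ × q₂` (no time sharing). -/
def miNoQ1 {X1 X2 Y : Type*} [Fintype X1] [Fintype X2] [Fintype Y]
    (ch : X1 → X2 → Y → ℝ) (q1 : X1 → ℝ) (q2 : X2 → ℝ) : ℝ :=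
  ∑ x1, ∑ x2, ∑ y, q1 x1 * q2 x2 * ch x1 x2 y *
    Real.log (ch x1 x2 y / (∑ x1', q1 x1' * ch x1' x2 y))

/-- `I(X₂;Y|X₁)` for product inputs. -/
def miNoQ2 {X1 X2 Y : Type*} [Fintype X1] [Fintype X2] [Fintype Y]
    (ch : X1 → X2 → Y → ℝ) (q1 : X1 → ℝ) (q2 : X2 → ℝ) : ℝ :=
  ∑ x1, ∑ x2, ∑ y, q1 x1 * q2 x2 * ch x1 x2 y *
    Real.log (ch x1 x2 y / (∑ x2', q2 x2' * ch x1 x2' y))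

/-- `C₁ = max_{p(x₁)p(x₂)} I(X₁;Y|X₂)`. -/
def Cap1 {X1 X2 Y : Type*} [Fintype X1] [Fintype X2] [Fintype Y]
    (ch : X1 → X2 → Y → ℝ) : ℝ :=
  sSup {c : ℝ | ∃ q1 : X1 → ℝ, ∃ q2 : X2 → ℝ,
    IsPMF q1 ∧ IsPMF q2 ∧ c = miNoQ1 ch q1 q2}

/-- `C₂ = max_{p(x₁)p(x₂)} I(X₂;Y|X₁)`. -/
def Cap2 {X1 X2 Y : Type*} [Fintype X1] [Fintype X2] [Fintype Y]
    (ch : X1 → X2 → Y → ℝ) : ℝ :=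
  sSup {c : ℝ | ∃ q1 : X1 → ℝ, ∃ q2 : X2 → ℝ,
    IsPMF q1 ∧ IsPMF q2 ∧ c = miNoQ2 ch q1 q2}

namespace OB

def kl {Y : Type*} [Fintype Y] (p q : Y → ℝ) : ℝ := ∑ y, p y * Real.log (p y / q y)

def mix {X Y : Type*} [Fintype X] (π : X → ℝ) (c : X → Y → ℝ) (y : Y) : ℝ :=
  ∑ x, π x * c x y

def info {X Y : Type*} [Fintype X] [Fintype Y] (π : X → ℝ) (c : X → Y → ℝ) : ℝ :=
  ∑ x, π x * kl (c x) (mix π c)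

lemma mul_log_div_ge {p q : ℝ} (hp : 0 ≤ p) (hq : 0 ≤ q) (h : 0 < p → 0 < q) :
    p - q ≤ p * Real.log (p / q) := by
  rcases hp.eq_or_lt with h0 | h0
  · rw [← h0]; simp [hq]
  · have hq' := h h0
    have h1 : Real.log (q / p) ≤ q / p - 1 := Real.log_le_sub_one_of_pos (by positivity)
    have h2 : Real.log (p / q) = - Real.log (q / p) := by
      rw [← Real.log_inv, inv_div]
    rw [h2]
    have h3 : p * Real.log (q / p) ≤ p * (q / p - 1) := mul_le_mul_of_nonneg_left h1 hp
    have h4 : p * (q / p - 1) = q - p := by field_simp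
    linarith

lemma kl_nonneg {Y : Type*} [Fintype Y] {p q : Y → ℝ} (hp : IsPMF p) (hq : ∀ y, 0 ≤ q y)
    (hq1 : ∑ y, q y ≤ 1) (h : ∀ y, 0 < p y → 0 < q y) : 0 ≤ kl p q := by
  have : ∑ y, (p y - q y) ≤ kl p q :=
    Finset.sum_le_sum fun y _ => mul_log_div_ge (hp.1 y) (hq y) (h y)
  rw [Finset.sum_sub_distrib, hp.2] at this
  linarith

lemma mix_nonneg {X Y : Type*} [Fintype X] {π : X → ℝ} {c : X → Y → ℝ}
    (hπ : ∀ x, 0 ≤ π x) (hc : ∀ x y, 0 ≤ c x y) (y : Y) : 0 ≤ mix π c y :=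
  Finset.sum_nonneg fun x _ => mul_nonneg (hπ x) (hc x y)

lemma mix_pos {X Y : Type*} [Fintype X] {π : X → ℝ} {c : X → Y → ℝ}
    (hπ : ∀ x, 0 ≤ π x) (hc : ∀ x y, 0 ≤ c x y) (x : X) (y : Y) (h : 0 < π x) (h' : 0 < c x y) :
    0 < mix π c y :=
  Finset.sum_pos' (fun x _ => mul_nonneg (hπ x) (hc x y)) ⟨x, Finset.mem_univ _, mul_pos h h'⟩

lemma mix_pmf {X Y : Type*} [Fintype X] [Fintype Y] {π : X → ℝ} {c : X → Y → ℝ}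
    (hπ : IsPMF π) (hc : ∀ x, IsPMF (c x)) : IsPMF (mix π c) := by
  refine ⟨mix_nonneg hπ.1 fun x => (hc x).1, ?_⟩
  unfold mix
  rw [Finset.sum_comm]
  simp_rw [← Finset.mul_sum, (hc _).2, mul_one, hπ.2]

lemma golden {X Y : Type*} [Fintype X] [Fintype Y] {π : X → ℝ} {c : X → Y → ℝ} {q : Y → ℝ}
    (hπ : IsPMF π) (hc : ∀ x, IsPMF (c x)) (hq : ∀ y, 0 ≤ q y) (hq1 : ∑ y, q y ≤ 1)
    (h : ∀ y, 0 < mix π c y → 0 < q y) : info π c ≤ ∑ x, π x * kl (c x) q := by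
  have key : ∀ x y, π x * (c x y * Real.log (c x y / mix π c y)) + (π x * c x y - π x * c x y * (q y / mix π c y))
      ≤ π x * (c x y * Real.log (c x y / q y)) := by
    intro x y
    rcases (mul_nonneg (hπ.1 x) ((hc x).1 y)).eq_or_lt with h0 | h0
    · rw [← mul_assoc, ← mul_assoc, ← h0]; simp
    · have hcx : 0 < c x y := by
        rcases ((hc x).1 y).eq_or_lt with h1 | h1
        · rw [← h1] at h0; simp at h0
        · exact h1
      have hπx : 0 < π x := by
        rcases (hπ.1 x).eq_or_lt with h1 | h1
        · rw [← h1] at h0; simp at h0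
        · exact h1
      have hm := mix_pos hπ.1 (fun x => (hc x).1) x y hπx hcx
      have hqy := h y hm
      have h1 : Real.log (q y / mix π c y) ≤ q y / mix π c y - 1 :=
        Real.log_le_sub_one_of_pos (by positivity)
      rw [Real.log_div hqy.ne' hm.ne'] at h1
      rw [Real.log_div hcx.ne' hm.ne', Real.log_div hcx.ne' hqy.ne']
      nlinarith
  have h1 : ∑ x, ∑ y, (π x * (c x y * Real.log (c x y / mix π c y)) + (π x * c x y - π x * c x y * (q y / mix π c y)))
      ≤ ∑ x, ∑ y, π x * (c x y * Real.log (c x y / q y)) :=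
    Finset.sum_le_sum fun x _ => Finset.sum_le_sum fun y _ => key x y
  simp only [Finset.sum_add_distrib, Finset.sum_sub_distrib] at h1
  have h2 : ∑ x, ∑ y, π x * c x y = 1 := by
    simp_rw [← Finset.mul_sum, (hc _).2, mul_one, hπ.2]
  have h3 : ∑ x, ∑ y, π x * c x y * (q y / mix π c y) ≤ 1 := by
    rw [Finset.sum_comm]
    refine le_trans (Finset.sum_le_sum fun y _ => ?_) hq1
    rw [← Finset.sum_mul]
    change mix π c y * (q y / mix π c y) ≤ q y
    by_cases h0 : mix π c y = 0
    · rw [h0]; simpa using hq y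
    · rw [mul_div_cancel₀ _ h0]
  unfold info kl
  simp_rw [Finset.mul_sum]
  linarith

lemma info_nonneg {X Y : Type*} [Fintype X] [Fintype Y] {π : X → ℝ} {c : X → Y → ℝ}
    (hπ : IsPMF π) (hc : ∀ x, IsPMF (c x)) : 0 ≤ info π c := by
  refine Finset.sum_nonneg fun x _ => ?_
  rcases (hπ.1 x).eq_or_lt with h | h
  · rw [← h]; simp
  · exact mul_nonneg h.le (kl_nonneg (hc x) (mix_pmf hπ hc).1 (mix_pmf hπ hc).2.le
      fun y hy => mix_pos hπ.1 (fun x => (hc x).1) x y h hy)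

lemma info_eq {X Y : Type*} [Fintype X] [Fintype Y] {π : X → ℝ} {c : X → Y → ℝ}
    (hπ : ∀ x, 0 ≤ π x) (hc : ∀ x y, 0 ≤ c x y) : info π c =
      ∑ x, π x * ∑ y, c x y * Real.log (c x y) - ∑ y, mix π c y * Real.log (mix π c y) := by
  have : ∀ x y, π x * (c x y * Real.log (c x y / mix π c y)) =
      π x * (c x y * Real.log (c x y)) - π x * c x y * Real.log (mix π c y) := by
    intro x y
    rcases (hπ x).eq_or_lt with h | h
    · rw [← h]; simp
    rcases (hc x y).eq_or_lt with h' | h'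
    · rw [← h']; simp
    rw [Real.log_div h'.ne' (mix_pos hπ hc x y h h').ne']; ring
  unfold info kl
  simp_rw [Finset.mul_sum, this, Finset.sum_sub_distrib]
  congr 1
  rw [Finset.sum_comm]
  refine Finset.sum_congr rfl fun y _ => ?_
  rw [← Finset.sum_mul]; rfl

/-! smoothing -/
def sm {Y : Type*} [Fintype Y] (t : ℝ) (q : Y → ℝ) (y : Y) : ℝ :=
  (1 - t) * q y + t / Fintype.card Y

lemma sm_pos {Y : Type*} [Fintype Y] {t : ℝ} {q : Y → ℝ} (ht : 0 < t) (ht1 : t < 1)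
    (hq : ∀ y, 0 ≤ q y) (y : Y) : 0 < sm t q y := by
  have : 0 < (Fintype.card Y : ℝ) := by
    have := Fintype.card_pos_iff.2 ⟨y⟩; exact_mod_cast this
  have h2 := hq y
  have h3 : 0 < 1 - t := by linarith
  unfold sm; positivity

lemma sm_pmf {Y : Type*} [Fintype Y] {t : ℝ} {q : Y → ℝ} (ht : 0 < t) (ht1 : t < 1)
    (hq : IsPMF q) : IsPMF (sm t q) := by
  refine ⟨fun y => (sm_pos ht ht1 hq.1 y).le, ?_⟩
  unfold sm
  have : (Fintype.card Y : ℝ) ≠ 0 := by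
    intro h
    have h' : Fintype.card Y = 0 := by exact_mod_cast h
    have := Fintype.card_eq_zero_iff.1 h'
    have := hq.2
    simp at this
  rw [Finset.sum_add_distrib, ← Finset.mul_sum, hq.2]
  simp
  field_simp
  ring

lemma kl_sm_le {Y : Type*} [Fintype Y] {t : ℝ} {p q : Y → ℝ} (ht : 0 < t) (ht1 : t < 1)
    (hp : IsPMF p) (hq : ∀ y, 0 ≤ q y) : kl p (sm t q) ≤ Real.log (Fintype.card Y / t) := by
  have : ∀ y, p y * Real.log (p y / sm t q y) ≤ p y * Real.log (Fintype.card Y / t) := by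
    intro y
    rcases (hp.1 y).eq_or_lt with h | h
    · rw [← h]; simp
    have hN : 0 < (Fintype.card Y : ℝ) := by
      have := Fintype.card_pos_iff.2 ⟨y⟩; exact_mod_cast this
    have hs := sm_pos ht ht1 hq y
    refine mul_le_mul_of_nonneg_left (Real.log_le_log (by positivity) ?_) h.le
    have hp1 : p y ≤ 1 := by
      rw [← hp.2]; exact Finset.single_le_sum (fun y _ => hp.1 y) (Finset.mem_univ y)
    have hs2 : t / Fintype.card Y ≤ sm t q y := by
      have := mul_nonneg (by linarith : 0 ≤ 1 - t) (hq y)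
      unfold sm; linarith
    calc p y / sm t q y ≤ 1 / (t / Fintype.card Y) := div_le_div₀ (by norm_num) hp1 (by positivity) hs2
      _ = _ := by rw [one_div_div]
  calc kl p (sm t q) ≤ ∑ y, p y * Real.log (Fintype.card Y / t) := Finset.sum_le_sum fun y _ => this y
    _ = _ := by rw [← Finset.sum_mul, hp.2, one_mul]

lemma kl_mono {Y : Type*} [Fintype Y] {t : ℝ} {p q q' : Y → ℝ} (ht1 : t < 1)
    (hp : IsPMF p) (hq : ∀ y, 0 < p y → 0 < q y) (h : ∀ y, (1 - t) * q y ≤ q' y) :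
    kl p q' ≤ kl p q - Real.log (1 - t) := by
  have h1t : 0 < 1 - t := by linarith
  have : ∀ y, p y * Real.log (p y / q' y) ≤ p y * Real.log (p y / q y) - p y * Real.log (1 - t) := by
    intro y
    rcases (hp.1 y).eq_or_lt with h0 | h0
    · rw [← h0]; simp
    have hqy := hq y h0
    have hq' : 0 < q' y := lt_of_lt_of_le (by positivity) (h y)
    rw [Real.log_div h0.ne' hq'.ne', Real.log_div h0.ne' hqy.ne']
    have h2 := Real.log_le_log (by positivity) (h y)
    rw [Real.log_mul h1t.ne' hqy.ne'] at h2
    nlinarith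
  calc kl p q' ≤ ∑ y, (p y * Real.log (p y / q y) - p y * Real.log (1 - t)) :=
        Finset.sum_le_sum fun y _ => this y
    _ = _ := by rw [Finset.sum_sub_distrib, ← Finset.sum_mul, hp.2, one_mul]; rfl

lemma sm_ge {Y : Type*} [Fintype Y] {t : ℝ} {q : Y → ℝ} (ht : 0 < t) (y : Y) :
    (1 - t) * q y ≤ sm t q y := by
  unfold sm
  have : 0 ≤ t / Fintype.card Y := by positivity
  linarith

/-- averaged kl to smoothed mixture -/
lemma avg_sm_le {X Y : Type*} [Fintype X] [Fintype Y] {t : ℝ} {π : X → ℝ} {c : X → Y → ℝ}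
    (ht : 0 < t) (ht1 : t < 1)
    (hπ : IsPMF π) (hc : ∀ x, IsPMF (c x)) :
    ∑ x, π x * kl (c x) (sm t (mix π c)) ≤ info π c - Real.log (1 - t) := by
  have : ∀ x, π x * kl (c x) (sm t (mix π c)) ≤ π x * kl (c x) (mix π c) - π x * Real.log (1 - t) := by
    intro x
    rcases (hπ.1 x).eq_or_lt with h | h
    · rw [← h]; simp
    have := kl_mono (q' := sm t (mix π c)) ht1 (hc x) (fun y hy => mix_pos hπ.1 (fun x => (hc x).1) x y h hy) (sm_ge ht)
    nlinarith
  calc _ ≤ ∑ x, (π x * kl (c x) (mix π c) - π x * Real.log (1 - t)) := Finset.sum_le_sum fun x _ => this x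
    _ = _ := by rw [Finset.sum_sub_distrib, ← Finset.sum_mul, hπ.2, one_mul]; rfl

lemma isCompact_pmf (X : Type*) [Fintype X] : IsCompact {π : X → ℝ | IsPMF π} :=
  isCompact_stdSimplex ℝ X

lemma continuousOn_info {X Y : Type*} [Fintype X] [Fintype Y] {c : X → Y → ℝ}
    (hc : ∀ x y, 0 ≤ c x y) : ContinuousOn (fun π => info π c) {π : X → ℝ | IsPMF π} := by
  have : ContinuousOn (fun π : X → ℝ => ∑ x, π x * ∑ y, c x y * Real.log (c x y) -
      ∑ y, mix π c y * Real.log (mix π c y)) {π : X → ℝ | IsPMF π} := by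
    apply Continuous.continuousOn
    refine Continuous.sub (by fun_prop) (continuous_finsetSum _ fun y _ => ?_)
    refine Real.continuous_mul_log.comp (f := fun π : X → ℝ => mix π c y) ?_
    unfold mix; fun_prop
  exact this.congr fun π hπ => info_eq hπ.1 hc

/-- capacity-achieving output distribution -/
lemma exists_q {X Y : Type*} [Fintype X] [Nonempty X] [Fintype Y] {c : X → Y → ℝ}
    (hc : ∀ x, IsPMF (c x)) {C : ℝ} (hC : ∀ π, IsPMF π → info π c ≤ C) {t : ℝ} (ht : 0 < t)
    (ht1 : t < 1) : ∃ q : Y → ℝ, IsPMF q ∧ (∀ y, 0 < q y) ∧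
      ∀ x, kl (c x) q ≤ C - Real.log (1 - t) := by
  classical
  have hsingle : ∀ x : X, IsPMF (Pi.single x (1:ℝ) : X → ℝ) := by
    intro x
    refine ⟨fun a => ?_, by simp⟩
    by_cases h : a = x
    · subst h; simp
    · simp [h]
  obtain ⟨x₀⟩ := ‹Nonempty X›
  obtain ⟨π, hπ, hmax⟩ := (isCompact_pmf X).exists_isMaxOn ⟨_, hsingle x₀⟩
    (continuousOn_info fun x => (hc x).1)
  have hπ : IsPMF π := hπ
  refine ⟨sm t (mix π c), sm_pmf ht ht1 (mix_pmf hπ hc), sm_pos ht ht1 (mix_pmf hπ hc).1, fun x => ?_⟩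
  have hYne : Nonempty Y := by
    by_contra h
    rw [not_nonempty_iff] at h
    have := (hc x).2
    simp at this
  have hN : 0 < (Fintype.card Y : ℝ) := by exact_mod_cast Fintype.card_pos
  set u : ℝ := min (1/2) (t / Fintype.card Y) with hu
  have hu0 : 0 < u := by positivity
  have hu1 : u < 1 := lt_of_le_of_lt (min_le_left _ _) (by norm_num)
  have hu2 : u ≤ t / Fintype.card Y := min_le_right _ _
  set πu : X → ℝ := fun a => (1 - u) * π a + u * (Pi.single x (1:ℝ) : X → ℝ) a with hπu
  have hπu_pmf : IsPMF πu := by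
    refine ⟨fun a => add_nonneg (mul_nonneg (by linarith) (hπ.1 a)) (mul_nonneg hu0.le ((hsingle x).1 a)), ?_⟩
    simp only [hπu]
    rw [Finset.sum_add_distrib, ← Finset.mul_sum, ← Finset.mul_sum, hπ.2, (hsingle x).2]; ring
  have hmixu : ∀ y, mix πu c y = (1 - u) * mix π c y + u * c x y := by
    intro y
    simp only [mix, hπu, add_mul, Finset.sum_add_distrib, mul_assoc, ← Finset.mul_sum]
    congr 2
    simp [Pi.single_apply]
  have hmu := mix_pmf hπu_pmf hc
  have h1 : info πu c ≤ info π c := hmax hπu_pmf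
  have h2 : info π c ≤ ∑ a, π a * kl (c a) (mix πu c) := by
    refine golden hπ hc hmu.1 hmu.2.le fun y hy => ?_
    rw [hmixu]
    have := (hc x).1 y
    have : 0 < 1 - u := by linarith
    positivity
  have h3 : info πu c = (1 - u) * ∑ a, π a * kl (c a) (mix πu c) + u * kl (c x) (mix πu c) := by
    conv_lhs => unfold info
    simp only [hπu, add_mul, Finset.sum_add_distrib, mul_assoc, ← Finset.mul_sum]
    congr 2
    simp [Pi.single_apply]
  have h4 : kl (c x) (mix πu c) ≤ info π c := by
    have : u * kl (c x) (mix πu c) ≤ u * info π c := by nlinarith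
    exact le_of_mul_le_mul_left this hu0
  have h5 := kl_mono (q := mix πu c) (q' := sm t (mix π c)) ht1 (hc x) (fun y hy => by
    rw [hmixu]
    have := (mix_pmf hπ hc).1 y
    have : 0 < 1 - u := by linarith
    positivity) (fun y => by
      rw [hmixu]; unfold sm
      have h6 := (mix_pmf hπ hc).1 y
      have h7 : c x y ≤ 1 := by
        rw [← (hc x).2]; exact Finset.single_le_sum (fun y _ => (hc x).1 y) (Finset.mem_univ y)
      have h8 := (hc x).1 y
      have h9 : 0 < 1 - t := by linarith
      have a1 : u * c x y ≤ t / Fintype.card Y := by nlinarith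
      have a2 : (1 - t) * (u * c x y) ≤ u * c x y := by
        have : 0 ≤ u * c x y := by positivity
        nlinarith
      have a3 : (1 - t) * ((1 - u) * mix π c y) ≤ (1 - t) * mix π c y := by
        apply mul_le_mul_of_nonneg_left _ h9.le
        nlinarith
      linarith)
  have := hC π hπ
  linarith

end OB

namespace OB

section mac
variable {X1 X2 Y : Type*} [Fintype X1] [Fintype X2] [Fintype Y]

def sw (ch : X1 → X2 → Y → ℝ) : X2 → X1 → Y → ℝ := fun b a => ch a b

def prodP (p1 : X1 → ℝ) (p2 : X2 → ℝ) : X1 × X2 → ℝ := fun z => p1 z.1 * p2 z.2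
def unc (ch : X1 → X2 → Y → ℝ) : X1 × X2 → Y → ℝ := fun z => ch z.1 z.2

def miNoQ12 (ch : X1 → X2 → Y → ℝ) (p1 : X1 → ℝ) (p2 : X2 → ℝ) : ℝ :=
  info (prodP p1 p2) (unc ch)

lemma prodP_pmf {p1 : X1 → ℝ} {p2 : X2 → ℝ} (h1 : IsPMF p1) (h2 : IsPMF p2) :
    IsPMF (prodP p1 p2) := by
  refine ⟨fun z => mul_nonneg (h1.1 _) (h2.1 _), ?_⟩
  unfold prodP
  rw [Fintype.sum_prod_type]
  simp_rw [← Finset.mul_sum, h2.2, mul_one, h1.2]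

lemma miNoQ1_eq' (ch : X1 → X2 → Y → ℝ) (p1 : X1 → ℝ) (p2 : X2 → ℝ) :
    miNoQ1 ch p1 p2 = ∑ x1, ∑ x2, p1 x1 * p2 x2 * kl (ch x1 x2) (mix p1 fun a => ch a x2) := by
  unfold miNoQ1 kl mix
  simp_rw [Finset.mul_sum, mul_assoc]

lemma miNoQ1_eq (ch : X1 → X2 → Y → ℝ) (p1 : X1 → ℝ) (p2 : X2 → ℝ) :
    miNoQ1 ch p1 p2 = ∑ x2, p2 x2 * info p1 (fun x1 => ch x1 x2) := by
  rw [miNoQ1_eq', Finset.sum_comm]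
  unfold info
  simp_rw [Finset.mul_sum]
  refine Finset.sum_congr rfl fun _ _ => Finset.sum_congr rfl fun _ _ => ?_
  ring

lemma miNoQ2_eq (ch : X1 → X2 → Y → ℝ) (p1 : X1 → ℝ) (p2 : X2 → ℝ) :
    miNoQ2 ch p1 p2 = miNoQ1 (sw ch) p2 p1 := by
  unfold miNoQ1 miNoQ2 sw
  rw [Finset.sum_comm]
  refine Finset.sum_congr rfl fun _ _ => Finset.sum_congr rfl fun _ _ =>
    Finset.sum_congr rfl fun _ _ => ?_
  ring

lemma Cap2_eq (ch : X1 → X2 → Y → ℝ) : Cap2 ch = Cap1 (sw ch) := by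
  unfold Cap1 Cap2
  congr 1
  ext c
  constructor
  · rintro ⟨a, b, ha, hb, h⟩; exact ⟨b, a, hb, ha, by rw [h, miNoQ2_eq]⟩
  · rintro ⟨a, b, ha, hb, h⟩; exact ⟨b, a, hb, ha, by rw [h, miNoQ2_eq]⟩

lemma miNoQ12_eq' (ch : X1 → X2 → Y → ℝ) (p1 : X1 → ℝ) (p2 : X2 → ℝ) :
    miNoQ12 ch p1 p2 = ∑ x1, ∑ x2, p1 x1 * p2 x2 * kl (ch x1 x2) (mix (prodP p1 p2) (unc ch)) := by
  unfold miNoQ12 info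
  rw [Fintype.sum_prod_type]; rfl

lemma mi1_eq {Q : Type*} [Fintype Q] (ch : X1 → X2 → Y → ℝ) (σ : Q → ℝ) (π₁ : Q → X1 → ℝ)
    (π₂ : Q → X2 → ℝ) : mi1 ch σ π₁ π₂ = ∑ q, σ q * miNoQ1 ch (π₁ q) (π₂ q) := by
  unfold mi1 miNoQ1
  simp_rw [Finset.mul_sum, mul_assoc]

lemma mi2_eq {Q : Type*} [Fintype Q] (ch : X1 → X2 → Y → ℝ) (σ : Q → ℝ) (π₁ : Q → X1 → ℝ)
    (π₂ : Q → X2 → ℝ) : mi2 ch σ π₁ π₂ = ∑ q, σ q * miNoQ2 ch (π₁ q) (π₂ q) := by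
  unfold mi2 miNoQ2
  simp_rw [Finset.mul_sum, mul_assoc]

lemma mi12_eq {Q : Type*} [Fintype Q] (ch : X1 → X2 → Y → ℝ) (σ : Q → ℝ) (π₁ : Q → X1 → ℝ)
    (π₂ : Q → X2 → ℝ) : mi12 ch σ π₁ π₂ = ∑ q, σ q * miNoQ12 ch (π₁ q) (π₂ q) := by
  unfold mi12
  simp_rw [miNoQ12_eq', kl, mix, prodP, unc, Fintype.sum_prod_type, Finset.mul_sum, mul_assoc]

variable {ch : X1 → X2 → Y → ℝ} (hch : ∀ a b, IsPMF (ch a b))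

include hch

lemma miNoQ1_nonneg {p1 : X1 → ℝ} {p2 : X2 → ℝ} (h1 : IsPMF p1) (h2 : IsPMF p2) :
    0 ≤ miNoQ1 ch p1 p2 := by
  rw [miNoQ1_eq]
  exact Finset.sum_nonneg fun x _ => mul_nonneg (h2.1 x) (info_nonneg h1 fun a => hch a x)

lemma miNoQ2_nonneg {p1 : X1 → ℝ} {p2 : X2 → ℝ} (h1 : IsPMF p1) (h2 : IsPMF p2) :
    0 ≤ miNoQ2 ch p1 p2 := by
  rw [miNoQ2_eq]
  exact miNoQ1_nonneg (ch := sw ch) (fun a b => hch b a) h2 h1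

lemma miNoQ12_nonneg {p1 : X1 → ℝ} {p2 : X2 → ℝ} (h1 : IsPMF p1) (h2 : IsPMF p2) :
    0 ≤ miNoQ12 ch p1 p2 := info_nonneg (prodP_pmf h1 h2) fun z => hch z.1 z.2

omit hch in
lemma info_le_log {X : Type*} [Fintype X] {c : X → Y → ℝ} (hc : ∀ x, IsPMF (c x))
    {π : X → ℝ} (hπ : IsPMF π) : info π c ≤ Real.log (Fintype.card Y / (1/2)) := by
  have hs := sm_pmf (t := 1/2) (by norm_num) (by norm_num) (mix_pmf hπ hc)
  have h := golden hπ hc hs.1 hs.2.le fun y _ =>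
    sm_pos (by norm_num) (by norm_num) (mix_pmf hπ hc).1 y
  refine h.trans ?_
  calc _ ≤ ∑ x, π x * Real.log (Fintype.card Y / (1/2)) :=
        Finset.sum_le_sum fun x _ => mul_le_mul_of_nonneg_left
          (kl_sm_le (by norm_num) (by norm_num) (hc x) (mix_pmf hπ hc).1) (hπ.1 x)
    _ = _ := by rw [← Finset.sum_mul, hπ.2, one_mul]

lemma miNoQ1_le_Cap1 {p1 : X1 → ℝ} {p2 : X2 → ℝ} (h1 : IsPMF p1) (h2 : IsPMF p2) :
    miNoQ1 ch p1 p2 ≤ Cap1 ch := by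
  refine le_csSup ⟨Real.log (Fintype.card Y / (1/2)), ?_⟩ ⟨p1, p2, h1, h2, rfl⟩
  rintro c ⟨q1, q2, hq1, hq2, rfl⟩
  rw [miNoQ1_eq]
  calc _ ≤ ∑ x, q2 x * Real.log (Fintype.card Y / (1/2)) :=
        Finset.sum_le_sum fun x _ => mul_le_mul_of_nonneg_left
          (info_le_log (fun a => hch a x) hq1) (hq2.1 x)
    _ = _ := by rw [← Finset.sum_mul, hq2.2, one_mul]

lemma miNoQ2_le_Cap2 {p1 : X1 → ℝ} {p2 : X2 → ℝ} (h1 : IsPMF p1) (h2 : IsPMF p2) :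
    miNoQ2 ch p1 p2 ≤ Cap2 ch := by
  rw [miNoQ2_eq, Cap2_eq]
  exact miNoQ1_le_Cap1 (ch := sw ch) (fun a b => hch b a) h2 h1

omit hch in
lemma single_pmf {X : Type*} [Fintype X] [DecidableEq X] (x : X) :
    IsPMF (Pi.single x (1:ℝ) : X → ℝ) := by
  refine ⟨fun a => ?_, by simp⟩
  by_cases h : a = x
  · subst h; simp
  · simp [h]

lemma info_le_Cap1 {p1 : X1 → ℝ} (h1 : IsPMF p1) (x2 : X2) :
    info p1 (fun a => ch a x2) ≤ Cap1 ch := by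
  classical
  have := miNoQ1_le_Cap1 hch h1 (single_pmf x2)
  rw [miNoQ1_eq] at this
  simpa [Pi.single_apply] using this

lemma Cap1_nonneg [Nonempty X1] [Nonempty X2] : 0 ≤ Cap1 ch := by
  classical
  obtain ⟨a⟩ := ‹Nonempty X1›
  obtain ⟨b⟩ := ‹Nonempty X2›
  exact (miNoQ1_nonneg hch (single_pmf a) (single_pmf b)).trans
    (miNoQ1_le_Cap1 hch (single_pmf a) (single_pmf b))

lemma exists_q1 [Nonempty X1] {t : ℝ} (ht : 0 < t) (ht1 : t < 1) :
    ∃ q : X2 → Y → ℝ, (∀ b, IsPMF (q b)) ∧ (∀ b y, 0 < q b y) ∧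
      ∀ a b, kl (ch a b) (q b) ≤ Cap1 ch - Real.log (1 - t) := by
  have := fun b : X2 => exists_q (c := fun a => ch a b) (fun a => hch a b)
    (fun π hπ => info_le_Cap1 hch hπ b) ht ht1
  choose q hq1 hq2 hq3 using this
  exact ⟨q, hq1, hq2, fun a b => hq3 b a⟩

lemma exists_q2 [Nonempty X2] {t : ℝ} (ht : 0 < t) (ht1 : t < 1) :
    ∃ q : X1 → Y → ℝ, (∀ b, IsPMF (q b)) ∧ (∀ b y, 0 < q b y) ∧
      ∀ a b, kl (ch a b) (q a) ≤ Cap2 ch - Real.log (1 - t) := by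
  obtain ⟨q, h1, h2, h3⟩ := exists_q1 (ch := sw ch) (fun a b => hch b a) ht ht1
  exact ⟨q, h1, h2, fun a b => by rw [Cap2_eq]; exact h3 b a⟩

lemma avg1 {t : ℝ} (ht : 0 < t) (ht1 : t < 1) {p1 : X1 → ℝ} {p2 : X2 → ℝ} (h1 : IsPMF p1)
    (h2 : IsPMF p2) : ∑ a, ∑ b, p1 a * p2 b * kl (ch a b) (sm t (mix p1 fun a => ch a b)) ≤
      miNoQ1 ch p1 p2 - Real.log (1 - t) := by
  rw [miNoQ1_eq, Finset.sum_comm]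
  have : ∀ b, ∑ a, p1 a * p2 b * kl (ch a b) (sm t (mix p1 fun a => ch a b)) ≤
      p2 b * info p1 (fun a => ch a b) - p2 b * Real.log (1 - t) := by
    intro b
    have := mul_le_mul_of_nonneg_left (avg_sm_le ht ht1 h1 fun a => hch a b) (h2.1 b)
    rw [mul_sub, Finset.mul_sum] at this
    refine le_trans (le_of_eq ?_) this
    refine Finset.sum_congr rfl fun _ _ => by ring
  refine (Finset.sum_le_sum fun b _ => this b).trans (le_of_eq ?_)
  rw [Finset.sum_sub_distrib, ← Finset.sum_mul, h2.2, one_mul]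

lemma avg2 {t : ℝ} (ht : 0 < t) (ht1 : t < 1) {p1 : X1 → ℝ} {p2 : X2 → ℝ} (h1 : IsPMF p1)
    (h2 : IsPMF p2) : ∑ a, ∑ b, p1 a * p2 b * kl (ch a b) (sm t (mix p2 (ch a))) ≤
      miNoQ2 ch p1 p2 - Real.log (1 - t) := by
  rw [miNoQ2_eq]
  refine le_trans (le_of_eq ?_) (avg1 (ch := sw ch) (fun a b => hch b a) ht ht1 h2 h1)
  rw [Finset.sum_comm]
  refine Finset.sum_congr rfl fun _ _ => Finset.sum_congr rfl fun _ _ => ?_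
  rw [mul_comm (p1 _)]; rfl

lemma avg12 {t : ℝ} (ht : 0 < t) (ht1 : t < 1) {p1 : X1 → ℝ} {p2 : X2 → ℝ} (h1 : IsPMF p1)
    (h2 : IsPMF p2) : ∑ a, ∑ b, p1 a * p2 b * kl (ch a b) (sm t (mix (prodP p1 p2) (unc ch))) ≤
      miNoQ12 ch p1 p2 - Real.log (1 - t) := by
  have := avg_sm_le ht ht1 (prodP_pmf h1 h2) (c := unc ch) fun z => hch z.1 z.2
  rw [Fintype.sum_prod_type] at this
  exact this

lemma submod {p1 : X1 → ℝ} {p2 : X2 → ℝ} (h1 : IsPMF p1) (h2 : IsPMF p2) :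
    miNoQ12 ch p1 p2 ≤ miNoQ1 ch p1 p2 + miNoQ2 ch p1 p2 := by
  have e2 : miNoQ2 ch p1 p2 = ∑ a, ∑ b, p1 a * p2 b * kl (ch a b) (mix p2 (ch a)) := by
    rw [miNoQ2_eq, miNoQ1_eq', Finset.sum_comm]
    refine Finset.sum_congr rfl fun _ _ => Finset.sum_congr rfl fun _ _ => ?_
    rw [mul_comm (p1 _)]; rfl
  rw [e2, miNoQ1_eq', miNoQ12_eq']
  set m : Y → ℝ := mix (prodP p1 p2) (unc ch) with hm
  have hmp : IsPMF m := mix_pmf (prodP_pmf h1 h2) fun z => hch z.1 z.2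
  have m1 : ∀ b, IsPMF (mix p1 fun a => ch a b) := fun b => mix_pmf h1 fun a => hch a b
  have m2 : ∀ a, IsPMF (mix p2 (ch a)) := fun a => mix_pmf h2 fun b => hch a b
  have hm1 : ∀ y, m y = ∑ b, p2 b * mix p1 (fun a => ch a b) y := by
    intro y
    simp only [hm, mix, prodP, unc, Fintype.sum_prod_type, Finset.mul_sum]
    rw [Finset.sum_comm]
    refine Finset.sum_congr rfl fun _ _ => Finset.sum_congr rfl fun _ _ => ?_
    ring
  have hm2 : ∀ y, m y = ∑ a, p1 a * mix p2 (ch a) y := by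
    intro y
    simp only [hm, mix, prodP, unc, Fintype.sum_prod_type, Finset.mul_sum]
    refine Finset.sum_congr rfl fun _ _ => Finset.sum_congr rfl fun _ _ => ?_
    ring
  have key : ∀ a b y, p1 a * p2 b * (ch a b y * Real.log (ch a b y / m y)) +
      (p1 a * p2 b * ch a b y - (p1 a * mix p2 (ch a) y) * (p2 b * mix p1 (fun a => ch a b) y) / m y) ≤
      p1 a * p2 b * (ch a b y * Real.log (ch a b y / mix p1 (fun a => ch a b) y)) +
      p1 a * p2 b * (ch a b y * Real.log (ch a b y / mix p2 (ch a) y)) := by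
    intro a b y
    have n1 := (m1 b).1 y
    have n2 := (m2 a).1 y
    have n0 := hmp.1 y
    have na := h1.1 a
    have nb := h2.1 b
    have nc := (hch a b).1 y
    have hterm : 0 ≤ (p1 a * mix p2 (ch a) y) * (p2 b * mix p1 (fun a => ch a b) y) / m y := by
      positivity
    rcases na.eq_or_lt with h | ha
    · rw [← h]; simp
    rcases nb.eq_or_lt with h | hb
    · rw [← h]; simp
    rcases nc.eq_or_lt with h | hc
    · rw [← h]; simp only [zero_mul, mul_zero]; linarith
    have q1 := mix_pos h1.1 (c := fun a => ch a b) (fun x => (hch x b).1) a y ha hc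
    have q2 := mix_pos h2.1 (c := ch a) (fun x => (hch a x).1) b y hb hc
    have q0 : 0 < m y := mix_pos (prodP_pmf h1 h2).1 (c := unc ch) (fun z => (hch z.1 z.2).1) (a, b) y
      (mul_pos ha hb) hc
    rw [Real.log_div hc.ne' q1.ne', Real.log_div hc.ne' q2.ne', Real.log_div hc.ne' q0.ne']
    set u := mix p1 (fun a => ch a b) y
    set v := mix p2 (ch a) y
    have hl : Real.log (u * v / (m y * ch a b y)) ≤ u * v / (m y * ch a b y) - 1 :=
      Real.log_le_sub_one_of_pos (by positivity)
    rw [Real.log_div (by positivity) (by positivity), Real.log_mul q1.ne' q2.ne',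
      Real.log_mul q0.ne' hc.ne'] at hl
    have hpos : 0 < p1 a * p2 b * ch a b y := by positivity
    have := mul_le_mul_of_nonneg_left hl hpos.le
    have e : p1 a * p2 b * ch a b y * (u * v / (m y * ch a b y) - 1) =
      (p1 a * v) * (p2 b * u) / m y - p1 a * p2 b * ch a b y := by field_simp
    rw [e] at this
    nlinarith
  have hs := Finset.sum_le_sum fun a (_ : a ∈ Finset.univ) => Finset.sum_le_sum fun b (_ : b ∈ Finset.univ) =>
    Finset.sum_le_sum fun y (_ : y ∈ Finset.univ) => key a b y
  simp only [Finset.sum_add_distrib, Finset.sum_sub_distrib] at hs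
  have t1 : ∑ a, ∑ b, ∑ y, p1 a * p2 b * ch a b y = 1 := by
    simp_rw [← Finset.mul_sum, (hch _ _).2, mul_one, ← Finset.mul_sum, h2.2, mul_one, h1.2]
  have t2 : ∑ a, ∑ b, ∑ y, (p1 a * mix p2 (ch a) y) * (p2 b * mix p1 (fun a => ch a b) y) / m y = 1 := by
    have : ∀ a, ∑ b, ∑ y, (p1 a * mix p2 (ch a) y) * (p2 b * mix p1 (fun a => ch a b) y) / m y =
        ∑ y, (p1 a * mix p2 (ch a) y) * m y / m y := by
      intro a
      rw [Finset.sum_comm]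
      refine Finset.sum_congr rfl fun y _ => ?_
      rw [← Finset.sum_div, ← Finset.mul_sum, ← hm1]
    simp_rw [this]
    rw [Finset.sum_comm, ← hmp.2]
    refine Finset.sum_congr rfl fun y _ => ?_
    rw [← Finset.sum_div, ← Finset.sum_mul, ← hm2, mul_self_div_self]
  simp only [kl, Finset.mul_sum]
  linarith

lemma continuousOn_miNoQ1 : ContinuousOn (fun p : (X1 → ℝ) × (X2 → ℝ) => miNoQ1 ch p.1 p.2)
    {p | IsPMF p.1 ∧ IsPMF p.2} := by
  simp_rw [miNoQ1_eq]
  refine continuousOn_finsetSum _ fun b _ => ContinuousOn.mul (by fun_prop) ?_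
  exact (continuousOn_info (c := fun a => ch a b) fun a => (hch a b).1).comp
    (f := fun p : (X1 → ℝ) × (X2 → ℝ) => p.1) (by fun_prop) fun p hp => hp.1

lemma continuousOn_miNoQ2 : ContinuousOn (fun p : (X1 → ℝ) × (X2 → ℝ) => miNoQ2 ch p.1 p.2)
    {p | IsPMF p.1 ∧ IsPMF p.2} := by
  simp_rw [miNoQ2_eq]
  exact (continuousOn_miNoQ1 (ch := sw ch) fun a b => hch b a).comp
    (f := fun p : (X1 → ℝ) × (X2 → ℝ) => (p.2, p.1)) (by fun_prop) fun p hp => ⟨hp.2, hp.1⟩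

lemma continuousOn_miNoQ12 : ContinuousOn (fun p : (X1 → ℝ) × (X2 → ℝ) => miNoQ12 ch p.1 p.2)
    {p | IsPMF p.1 ∧ IsPMF p.2} := by
  unfold miNoQ12
  exact (continuousOn_info (c := unc ch) fun z => (hch z.1 z.2).1).comp
    (f := fun p : (X1 → ℝ) × (X2 → ℝ) => prodP p.1 p.2) (by unfold prodP; fun_prop)
    fun p hp => prodP_pmf hp.1 hp.2

end mac
end OB

namespace OB

lemma three_pt (w x y : Fin 3 → ℝ) (hw : ∀ j, 0 ≤ w j) (hw1 : ∑ j, w j = 1) :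
    ∃ (i j : Fin 3) (s : ℝ), 0 ≤ s ∧ s ≤ 1 ∧
      ∑ k, w k * x k ≤ (1 - s) * x i + s * x j ∧ ∑ k, w k * y k ≤ (1 - s) * y i + s * y j := by
  have hd : ∃ d : Fin 3 → ℝ, (∑ k, d k = 0) ∧ (∑ k, d k * (x k - y k) = 0) ∧ ∃ k, d k ≠ 0 := by
    by_cases h : x 0 - y 0 = x 1 - y 1
    · refine ⟨![1, -1, 0], by simp [Fin.sum_univ_three], ?_, 0, by simp⟩
      simp [Fin.sum_univ_three]; linarith
    · refine ⟨![(x 1 - y 1) - (x 2 - y 2), (x 2 - y 2) - (x 0 - y 0), (x 0 - y 0) - (x 1 - y 1)],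
        by simp [Fin.sum_univ_three], ?_, 2, ?_⟩
      · simp [Fin.sum_univ_three]; ring
      · simpa [sub_eq_zero] using h
  have hd' : ∃ d : Fin 3 → ℝ, (∑ k, d k = 0) ∧ (0 ≤ ∑ k, d k * x k) ∧ (0 ≤ ∑ k, d k * y k) ∧ ∃ k, d k ≠ 0 := by
    obtain ⟨d, h0, h1, h2⟩ := hd
    simp only [mul_sub, Finset.sum_sub_distrib] at h1
    rcases le_total 0 (∑ k, d k * x k) with h | h
    · exact ⟨d, h0, h, by linarith, h2⟩
    · refine ⟨fun k => - d k, by simp [h0], ?_, ?_, by simpa using h2⟩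
      · simp; linarith
      · simp; linarith
  obtain ⟨d, h0, hx, hy, hk⟩ := hd'
  have hneg : ∃ k, d k < 0 := by
    by_contra h
    push Not at h
    obtain ⟨k, hk⟩ := hk
    exact hk ((Finset.sum_eq_zero_iff_of_nonneg fun k _ => h k).1 h0 k (Finset.mem_univ _))
  obtain ⟨k0, hk0⟩ := hneg
  obtain ⟨j0, hj0, hmin⟩ := Finset.exists_min_image (Finset.univ.filter fun k => d k < 0)
    (fun k => w k / (- d k)) ⟨k0, by simp [hk0]⟩
  simp only [Finset.mem_filter, Finset.mem_univ, true_and] at hj0 hmin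
  set t := w j0 / (- d j0) with ht
  have ht0 : 0 ≤ t := div_nonneg (hw j0) (by linarith)
  set v : Fin 3 → ℝ := fun k => w k + t * d k with hv
  have hv0 : ∀ k, 0 ≤ v k := by
    intro k
    rcases le_or_gt 0 (d k) with h | h
    · exact add_nonneg (hw k) (mul_nonneg ht0 h)
    · have := hmin k h
      rw [le_div_iff₀ (by linarith)] at this
      simp only [hv]; linarith
  have hvj : v j0 = 0 := by
    simp only [hv, ht]; field_simp [hj0.ne]; ring
  have hv1 : ∑ k, v k = 1 := by
    simp only [hv, Finset.sum_add_distrib, ← Finset.mul_sum, h0, hw1]; ring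
  have hvx : ∑ k, w k * x k ≤ ∑ k, v k * x k := by
    have : ∑ k, v k * x k = ∑ k, w k * x k + t * ∑ k, d k * x k := by
      simp only [hv, add_mul, Finset.sum_add_distrib, Finset.mul_sum, mul_assoc]
    have := mul_nonneg ht0 hx
    linarith
  have hvy : ∑ k, w k * y k ≤ ∑ k, v k * y k := by
    have : ∑ k, v k * y k = ∑ k, w k * y k + t * ∑ k, d k * y k := by
      simp only [hv, add_mul, Finset.sum_add_distrib, Finset.mul_sum, mul_assoc]
    have := mul_nonneg ht0 hy
    linarith
  have a0 := hv0 0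
  have a1 := hv0 1
  have a2 := hv0 2
  rw [Fin.sum_univ_three v] at hv1
  rw [Fin.sum_univ_three (fun k => v k * x k)] at hvx
  rw [Fin.sum_univ_three (fun k => v k * y k)] at hvy
  have hc : j0 = 0 ∨ j0 = 1 ∨ j0 = 2 := by fin_cases j0 <;> simp
  rcases hc with rfl | rfl | rfl
  · have e : v 1 = 1 - v 2 := by linarith
    rw [hvj, e] at hvx hvy
    exact ⟨1, 2, v 2, a2, by linarith, by linarith, by linarith⟩
  · have e : v 0 = 1 - v 2 := by linarith
    rw [hvj, e] at hvx hvy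
    exact ⟨0, 2, v 2, a2, by linarith, by linarith, by linarith⟩
  · have e : v 0 = 1 - v 1 := by linarith
    rw [hvj, e] at hvx hvy
    exact ⟨0, 1, v 1, a1, by linarith, by linarith, by linarith⟩

lemma two_pt_finset {K : Type*} (x y : K → ℝ) (S : Finset K) (hS : S.Nonempty) :
    ∀ w : K → ℝ, (∀ k, 0 ≤ w k) → ∑ k ∈ S, w k = 1 → ∃ (i j : K) (s : ℝ), 0 ≤ s ∧ s ≤ 1 ∧
      ∑ k ∈ S, w k * x k ≤ (1 - s) * x i + s * x j ∧
      ∑ k ∈ S, w k * y k ≤ (1 - s) * y i + s * y j := by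
  induction hS using Finset.Nonempty.cons_induction with
  | singleton a =>
    intro w hw h1
    simp only [Finset.sum_singleton] at h1 ⊢
    exact ⟨a, a, 0, le_rfl, zero_le_one, by simp [h1], by simp [h1]⟩
  | cons a S ha hS ih =>
    intro w hw h1
    simp only [Finset.sum_cons] at h1 ⊢
    set V := ∑ k ∈ S, w k with hV
    have hV0 : 0 ≤ V := Finset.sum_nonneg fun k _ => hw k
    rcases hV0.eq_or_lt with h | h
    · have hz : ∀ k ∈ S, w k = 0 :=
        (Finset.sum_eq_zero_iff_of_nonneg fun k _ => hw k).1 (hV.symm.trans h.symm)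
      have e : ∀ z : K → ℝ, ∑ k ∈ S, w k * z k = 0 := fun z =>
        Finset.sum_eq_zero fun k hk => by rw [hz k hk, zero_mul]
      have hwa : w a = 1 := by linarith
      exact ⟨a, a, 0, le_rfl, zero_le_one, by simp [e, hwa], by simp [e, hwa]⟩
    · obtain ⟨i, j, s, hs0, hs1, hx, hy⟩ := ih (fun k => w k / V) (fun k => div_nonneg (hw k) hV0)
        (by rw [← Finset.sum_div]; exact div_self h.ne')
      have e : ∀ z : K → ℝ, ∑ k ∈ S, w k / V * z k = (∑ k ∈ S, w k * z k) / V := by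
        intro z; rw [Finset.sum_div]; exact Finset.sum_congr rfl fun k _ => by ring
      rw [e, div_le_iff₀ h] at hx hy
      have hs1' : 0 ≤ 1 - s := by linarith
      obtain ⟨p, q, u, hu0, hu1, h3, h4⟩ := three_pt ![w a, V * (1 - s), V * s]
        (fun k => x (![a, i, j] k)) (fun k => y (![a, i, j] k))
        (by intro k; fin_cases k <;> simp [hw] <;> positivity)
        (by simp [Fin.sum_univ_three]; linarith)
      refine ⟨_, _, u, hu0, hu1, le_trans ?_ h3, le_trans ?_ h4⟩
      · simp [Fin.sum_univ_three]; linarith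
      · simp [Fin.sum_univ_three]; linarith

lemma two_point {K : Type*} [Fintype K] (w : K → ℝ) (hw : IsPMF w) (I1 I2 I12 : K → ℝ)
    (h : ∀ k, I12 k ≤ I1 k + I2 k) (a b : ℝ) (ha : a ≤ ∑ k, w k * I1 k)
    (hb : b ≤ ∑ k, w k * I2 k) (hab : a + b ≤ ∑ k, w k * I12 k) :
    ∃ (σ : Fin 2 → ℝ) (k : Fin 2 → K), IsPMF σ ∧ a ≤ ∑ q, σ q * I1 (k q) ∧
      b ≤ ∑ q, σ q * I2 (k q) ∧ a + b ≤ ∑ q, σ q * I12 (k q) := by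
  have hS : (Finset.univ : Finset K).Nonempty := by
    by_contra h
    rw [Finset.not_nonempty_iff_eq_empty] at h
    have := hw.2; rw [h] at this; simp at this
  have hθ : ∃ θ : ℝ, 0 ≤ θ ∧ θ ≤ 1 ∧
      a ≤ θ * (∑ k, w k * I1 k) + (1 - θ) * ((∑ k, w k * I12 k) - ∑ k, w k * I2 k) ∧
      b ≤ θ * ((∑ k, w k * I12 k) - ∑ k, w k * I1 k) + (1 - θ) * (∑ k, w k * I2 k) := by
    set S1 := ∑ k, w k * I1 k
    set S2 := ∑ k, w k * I2 k
    set S12 := ∑ k, w k * I12 k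
    by_cases hc : a ≤ S12 - S2
    · exact ⟨0, le_rfl, zero_le_one, by linarith, by linarith⟩
    · push Not at hc
      have hpos : 0 < S1 - (S12 - S2) := by linarith
      refine ⟨(a - (S12 - S2)) / (S1 - (S12 - S2)), div_nonneg (by linarith) hpos.le,
        (div_le_one hpos).2 (by linarith), ?_, ?_⟩
      · have e : (a - (S12 - S2)) / (S1 - (S12 - S2)) * (S1 - (S12 - S2)) = a - (S12 - S2) :=
          div_mul_cancel₀ _ hpos.ne'
        linarith
      · have e : (a - (S12 - S2)) / (S1 - (S12 - S2)) * (S1 - (S12 - S2)) = a - (S12 - S2) :=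
          div_mul_cancel₀ _ hpos.ne'
        linarith
  obtain ⟨θ, h0, h1, hA, hB⟩ := hθ
  obtain ⟨i, j, s, hs0, hs1, hx, hy⟩ := two_pt_finset
    (fun k => θ * I1 k + (1 - θ) * (I12 k - I2 k)) (fun k => θ * (I12 k - I1 k) + (1 - θ) * I2 k)
    Finset.univ hS w hw.1 hw.2
  have ex : ∑ k, w k * (θ * I1 k + (1 - θ) * (I12 k - I2 k)) =
      θ * (∑ k, w k * I1 k) + (1 - θ) * ((∑ k, w k * I12 k) - ∑ k, w k * I2 k) := by
    rw [← Finset.sum_sub_distrib, Finset.mul_sum, Finset.mul_sum, ← Finset.sum_add_distrib]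
    exact Finset.sum_congr rfl fun k _ => by ring
  have ey : ∑ k, w k * (θ * (I12 k - I1 k) + (1 - θ) * I2 k) =
      θ * ((∑ k, w k * I12 k) - ∑ k, w k * I1 k) + (1 - θ) * (∑ k, w k * I2 k) := by
    rw [← Finset.sum_sub_distrib, Finset.mul_sum, Finset.mul_sum, ← Finset.sum_add_distrib]
    exact Finset.sum_congr rfl fun k _ => by ring
  rw [ex] at hx
  rw [ey] at hy
  have c1 : ∀ k, θ * I1 k + (1 - θ) * (I12 k - I2 k) ≤ I1 k := fun k => by nlinarith [h k]
  have c2 : ∀ k, θ * (I12 k - I1 k) + (1 - θ) * I2 k ≤ I2 k := fun k => by nlinarith [h k]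
  have hs1' : 0 ≤ 1 - s := by linarith
  refine ⟨![1 - s, s], ![i, j], ⟨fun q => by fin_cases q <;> simp [hs0, hs1], by simp⟩, ?_, ?_, ?_⟩
  · have := mul_le_mul_of_nonneg_left (c1 i) hs1'
    have := mul_le_mul_of_nonneg_left (c1 j) hs0
    simp; linarith
  · have := mul_le_mul_of_nonneg_left (c2 i) hs1'
    have := mul_le_mul_of_nonneg_left (c2 j) hs0
    simp; linarith
  · simp; linarith

abbrev ZT (X1 X2 : Type) := (Fin 2 → ℝ) × (Fin 2 → X1 → ℝ) × (Fin 2 → X2 → ℝ)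

def SC (X1 X2 : Type) [Fintype X1] [Fintype X2] : Set (ZT X1 X2) :=
  {z | IsPMF z.1 ∧ (∀ q, IsPMF (z.2.1 q)) ∧ (∀ q, IsPMF (z.2.2 q))}

lemma isCompact_SC (X1 X2 : Type) [Fintype X1] [Fintype X2] : IsCompact (SC X1 X2) := by
  have h := (isCompact_pmf (Fin 2)).prod ((isCompact_univ_pi fun _ : Fin 2 => isCompact_pmf X1).prod
      (isCompact_univ_pi fun _ : Fin 2 => isCompact_pmf X2))
  have e : SC X1 X2 = ({π : Fin 2 → ℝ | IsPMF π} ×ˢ ((Set.univ.pi fun _ : Fin 2 => {π : X1 → ℝ | IsPMF π}) ×ˢ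
    (Set.univ.pi fun _ : Fin 2 => {π : X2 → ℝ | IsPMF π}))) := by
    ext z
    simp only [SC, Set.mem_prod, Set.mem_pi, Set.mem_setOf_eq, Set.mem_univ, true_imp_iff]
  rw [e]; exact h

lemma contJ {X1 X2 : Type} [Fintype X1] [Fintype X2] {J : (X1 → ℝ) → (X2 → ℝ) → ℝ}
    (hJ : ContinuousOn (fun p : (X1 → ℝ) × (X2 → ℝ) => J p.1 p.2) {p | IsPMF p.1 ∧ IsPMF p.2}) :
    ContinuousOn (fun z : ZT X1 X2 => ∑ q, z.1 q * J (z.2.1 q) (z.2.2 q)) (SC X1 X2) := by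
  refine continuousOn_finsetSum _ fun q _ => ContinuousOn.mul ?_ ?_
  · exact ((continuous_apply q).comp continuous_fst).continuousOn
  · refine hJ.comp (f := fun z : ZT X1 X2 => (z.2.1 q, z.2.2 q)) ?_ fun z hz => ⟨hz.2.1 q, hz.2.2 q⟩
    exact (((continuous_apply q).comp (continuous_fst.comp continuous_snd)).prodMk
      ((continuous_apply q).comp (continuous_snd.comp continuous_snd))).continuousOn

lemma final_reduction {X1 X2 Y : Type} [Fintype X1] [Fintype X2] [Fintype Y] [Nonempty X1]
    [Nonempty X2] {ch : X1 → X2 → Y → ℝ} (hch : ∀ a b, IsPMF (ch a b))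
    {r₁ r₂ s R₁ R₂ : ℝ} (hr₁ : 0 < r₁) (hr₂ : 0 < r₂) (hs : s = r₂ / r₁)
    (H : ∀ δ : ℝ, 0 < δ → ∃ (K : Type) (_ : Fintype K) (w : K → ℝ) (π₁ : K → X1 → ℝ)
      (π₂ : K → X2 → ℝ), IsPMF w ∧ (∀ k, IsPMF (π₁ k)) ∧ (∀ k, IsPMF (π₂ k)) ∧
      R₁ - δ ≤ r₁ * (∑ k, w k * miNoQ1 ch (π₁ k) (π₂ k)) + (1 - r₁) * Cap1 ch ∧
      R₂ - δ ≤ r₂ * (∑ k, w k * miNoQ2 ch (π₁ k) (π₂ k)) + (1 - r₂) * Cap2 ch ∧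
      s * R₁ + R₂ - δ ≤ r₂ * (∑ k, w k * miNoQ12 ch (π₁ k) (π₂ k)) +
        s * (1 - r₁) * Cap1 ch + (1 - r₂) * Cap2 ch) :
    ∃ (σq : Fin 2 → ℝ) (π₁ : Fin 2 → X1 → ℝ) (π₂ : Fin 2 → X2 → ℝ),
      IsPMF σq ∧ (∀ q, IsPMF (π₁ q)) ∧ (∀ q, IsPMF (π₂ q)) ∧
      R₁ ≤ r₁ * mi1 ch σq π₁ π₂ + (1 - r₁) * Cap1 ch ∧
      R₂ ≤ r₂ * mi2 ch σq π₁ π₂ + (1 - r₂) * Cap2 ch ∧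
      s * R₁ + R₂ ≤ r₂ * mi12 ch σq π₁ π₂ +
        s * (1 - r₁) * Cap1 ch + (1 - r₂) * Cap2 ch := by
  classical
  have hs0 : 0 < s := by rw [hs]; positivity
  have hsr : r₁ * s = r₂ := by rw [hs]; field_simp
  have hSc := isCompact_SC X1 X2
  let F1 : ZT X1 X2 → ℝ := fun z => r₁ * mi1 ch z.1 z.2.1 z.2.2 + (1 - r₁) * Cap1 ch - R₁
  let F2 : ZT X1 X2 → ℝ := fun z => r₂ * mi2 ch z.1 z.2.1 z.2.2 + (1 - r₂) * Cap2 ch - R₂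
  let F3 : ZT X1 X2 → ℝ := fun z => r₂ * mi12 ch z.1 z.2.1 z.2.2 +
        s * (1 - r₁) * Cap1 ch + (1 - r₂) * Cap2 ch - (s * R₁ + R₂)
  have hF1 : ContinuousOn F1 (SC X1 X2) := by
    simp only [F1, mi1_eq]
    exact ((continuousOn_const.mul (contJ (continuousOn_miNoQ1 hch))).add continuousOn_const).sub
      continuousOn_const
  have hF2 : ContinuousOn F2 (SC X1 X2) := by
    simp only [F2, mi2_eq]
    exact ((continuousOn_const.mul (contJ (continuousOn_miNoQ2 hch))).add continuousOn_const).sub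
      continuousOn_const
  have hF3 : ContinuousOn F3 (SC X1 X2) := by
    simp only [F3, mi12_eq]
    exact (((continuousOn_const.mul (contJ (continuousOn_miNoQ12 hch))).add
      continuousOn_const).add continuousOn_const).sub continuousOn_const
  have hne : (SC X1 X2).Nonempty := by
    obtain ⟨a⟩ := ‹Nonempty X1›
    obtain ⟨b⟩ := ‹Nonempty X2›
    exact ⟨(Pi.single 0 1, fun _ => Pi.single a 1, fun _ => Pi.single b 1),
      single_pmf _, fun _ => single_pmf _, fun _ => single_pmf _⟩
  obtain ⟨z, hz, hmax⟩ := hSc.exists_isMaxOn hne (hF1.inf (hF2.inf hF3))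
  have hpos : ∀ δ : ℝ, 0 < δ → -((1 + s) * δ) ≤ min (F1 z) (min (F2 z) (F3 z)) := by
    intro δ hδ
    obtain ⟨K, _, w, π₁, π₂, hw, hp1, hp2, e1, e2, e3⟩ := H δ hδ
    set S1 := ∑ k, w k * miNoQ1 ch (π₁ k) (π₂ k) with hS1
    set S2 := ∑ k, w k * miNoQ2 ch (π₁ k) (π₂ k) with hS2
    set S12 := ∑ k, w k * miNoQ12 ch (π₁ k) (π₂ k) with hS12
    obtain ⟨σ, k, hσ, f1, f2, f3⟩ := two_point w hw (fun k => miNoQ1 ch (π₁ k) (π₂ k))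
      (fun k => miNoQ2 ch (π₁ k) (π₂ k)) (fun k => miNoQ12 ch (π₁ k) (π₂ k))
      (fun k => submod hch (hp1 k) (hp2 k)) ((R₁ - δ - (1 - r₁) * Cap1 ch) / r₁)
      ((R₂ - δ - (1 - r₂) * Cap2 ch) / r₂)
      (by rw [div_le_iff₀ hr₁]; linarith) (by rw [div_le_iff₀ hr₂]; linarith)
      (by
        have : (R₁ - δ - (1 - r₁) * Cap1 ch) / r₁ + (R₂ - δ - (1 - r₂) * Cap2 ch) / r₂ =
          (s * (R₁ - δ - (1 - r₁) * Cap1 ch) + (R₂ - δ - (1 - r₂) * Cap2 ch)) / r₂ := by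
          rw [← hsr]; field_simp
        rw [this, div_le_iff₀ hr₂]
        nlinarith)
    have hzin : ((σ, fun q => π₁ (k q), fun q => π₂ (k q)) : ZT X1 X2) ∈ SC X1 X2 :=
      ⟨hσ, fun q => hp1 _, fun q => hp2 _⟩
    refine le_trans ?_ (hmax hzin)
    simp only [F1, F2, F3, mi1_eq, mi2_eq, mi12_eq]
    have hsd : 0 < s * δ := by positivity
    refine le_min ?_ (le_min ?_ ?_)
    · rw [div_le_iff₀ hr₁] at f1; linarith
    · rw [div_le_iff₀ hr₂] at f2; linarith
    · have : (R₁ - δ - (1 - r₁) * Cap1 ch) / r₁ + (R₂ - δ - (1 - r₂) * Cap2 ch) / r₂ =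
          (s * (R₁ - δ - (1 - r₁) * Cap1 ch) + (R₂ - δ - (1 - r₂) * Cap2 ch)) / r₂ := by
          rw [← hsr]; field_simp
      rw [this, div_le_iff₀ hr₂] at f3
      linarith
  have hfin : 0 ≤ min (F1 z) (min (F2 z) (F3 z)) := by
    by_contra h
    push Not at h
    set m := min (F1 z) (min (F2 z) (F3 z))
    have := hpos (-m / (2 * (1 + s))) (div_pos (by linarith) (by positivity))
    have e : (1 + s) * (-m / (2 * (1 + s))) = -m / 2 := by field_simp
    rw [e] at this
    linarith
  rw [le_min_iff, le_min_iff] at hfin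
  obtain ⟨g1, g2, g3⟩ := hfin
  simp only [F1, F2, F3] at g1 g2 g3
  exact ⟨z.1, z.2.1, z.2.2, hz.1, hz.2.1, hz.2.2, by linarith, by linarith, by linarith⟩

end OB

namespace OB

section paths
variable {Y : Type*} [Fintype Y]

def PS (y0 : ℕ → Y) : ℕ → ((ℕ → Y) → ℝ) → ℝ
  | 0, F => F y0
  | L + 1, F => PS y0 L (fun y => ∑ a, F (Function.update y L a))

lemma PS_add (y0 : ℕ → Y) (L : ℕ) (F G : (ℕ → Y) → ℝ) :
    PS y0 L (fun y => F y + G y) = PS y0 L F + PS y0 L G := by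
  induction L generalizing F G with
  | zero => rfl
  | succ L ih => simp only [PS, Finset.sum_add_distrib]; rw [ih]

lemma PS_mul (y0 : ℕ → Y) (L : ℕ) (r : ℝ) (F : (ℕ → Y) → ℝ) :
    PS y0 L (fun y => r * F y) = r * PS y0 L F := by
  induction L generalizing F with
  | zero => rfl
  | succ L ih => simp only [PS, ← Finset.mul_sum]; rw [ih]

lemma PS_mono (y0 : ℕ → Y) (L : ℕ) {F G : (ℕ → Y) → ℝ} (h : ∀ y, F y ≤ G y) :
    PS y0 L F ≤ PS y0 L G := by
  induction L generalizing F G with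
  | zero => exact h _
  | succ L ih => exact ih fun y => Finset.sum_le_sum fun a _ => h _

lemma PS_zero (y0 : ℕ → Y) (L : ℕ) : PS y0 L (fun _ => 0) = 0 := by
  simpa using PS_mul y0 L 0 (fun _ => 0)

lemma PS_nonneg (y0 : ℕ → Y) (L : ℕ) {F : (ℕ → Y) → ℝ} (h : ∀ y, 0 ≤ F y) :
    0 ≤ PS y0 L F := by
  rw [← PS_zero y0 L]; exact PS_mono y0 L h

lemma PS_sum {ι : Type*} (y0 : ℕ → Y) (L : ℕ) (S : Finset ι) (F : ι → (ℕ → Y) → ℝ) :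
    PS y0 L (fun y => ∑ i ∈ S, F i y) = ∑ i ∈ S, PS y0 L (F i) := by
  classical
  induction S using Finset.induction_on with
  | empty => simp [PS_zero]
  | insert i S hi ih => simp only [Finset.sum_insert hi]; rw [PS_add, ih]

def Adp {β : Type*} (n : ℕ) (F : (ℕ → Y) → β) : Prop :=
  ∀ y y' : ℕ → Y, (∀ j < n, y j = y' j) → F y = F y'

omit [Fintype Y] in
lemma Adp.upd {β : Type*} {n m : ℕ} {F : (ℕ → Y) → β} (h : Adp n F) (hm : n ≤ m) (y : ℕ → Y) (a : Y) :
    F (Function.update y m a) = F y :=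
  h _ _ fun j hj => Function.update_of_ne (by omega) _ _

omit [Fintype Y] in
lemma Adp.mono {β : Type*} {n m : ℕ} {F : (ℕ → Y) → β} (h : Adp n F) (hm : n ≤ m) : Adp m F :=
  fun y y' hy => h y y' fun j hj => hy j (by omega)

structure Ker (k : ℕ → (ℕ → Y) → Y → ℝ) : Prop where
  adp : ∀ i, Adp i (k i)
  pmf : ∀ i y, IsPMF (k i y)

def Pr (k : ℕ → (ℕ → Y) → Y → ℝ) (L : ℕ) (y : ℕ → Y) : ℝ := ∏ i ∈ Finset.range L, k i y (y i)

variable {k : ℕ → (ℕ → Y) → Y → ℝ}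

lemma Pr_nonneg (hk : Ker k) (L : ℕ) (y : ℕ → Y) : 0 ≤ Pr k L y :=
  Finset.prod_nonneg fun i _ => (hk.pmf i y).1 _

lemma Pr_adp (hk : Ker k) (L : ℕ) : Adp L (Pr k L) := by
  intro y y' h
  refine Finset.prod_congr rfl fun i hi => ?_
  have hi := Finset.mem_range.1 hi
  rw [hk.adp i y y' fun j hj => h j (by omega), h i hi]

lemma Pr_upd (hk : Ker k) (L : ℕ) (y : ℕ → Y) (a : Y) :
    Pr k (L + 1) (Function.update y L a) = Pr k L y * k L y a := by
  have := (Pr_adp hk L).upd le_rfl y a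
  unfold Pr at *
  rw [Finset.prod_range_succ, this, (hk.adp L).upd le_rfl, Function.update_self]

lemma PS_Pr_succ' (hk : Ker k) (y0 : ℕ → Y) (L : ℕ) (F : (ℕ → Y) → ℝ) :
    PS y0 (L + 1) (fun y => Pr k (L + 1) y * F y) =
      PS y0 L (fun y => Pr k L y * ∑ a, k L y a * F (Function.update y L a)) := by
  simp only [PS, Pr_upd hk, mul_assoc, Finset.mul_sum]

lemma PS_Pr_succ (hk : Ker k) (y0 : ℕ → Y) (L : ℕ) {F : (ℕ → Y) → ℝ} (hF : Adp L F) :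
    PS y0 (L + 1) (fun y => Pr k (L + 1) y * F y) = PS y0 L (fun y => Pr k L y * F y) := by
  rw [PS_Pr_succ' hk]
  simp only [hF.upd le_rfl, ← Finset.sum_mul, (hk.pmf _ _).2, one_mul]

lemma PS_Pr_of_le (hk : Ker k) (y0 : ℕ → Y) {n L : ℕ} (hn : n ≤ L) {F : (ℕ → Y) → ℝ} (hF : Adp n F) :
    PS y0 L (fun y => Pr k L y * F y) = PS y0 n (fun y => Pr k n y * F y) := by
  induction L, hn using Nat.le_induction with
  | base => rfl
  | succ L hL ih => rw [PS_Pr_succ hk y0 L (hF.mono hL), ih]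

lemma PS_Pr (hk : Ker k) (y0 : ℕ → Y) (L : ℕ) : PS y0 L (Pr k L) = 1 := by
  have := PS_Pr_of_le hk y0 (Nat.zero_le L) (F := fun _ => 1) (fun _ _ _ => rfl)
  simp only [mul_one] at this
  refine this.trans ?_
  simp [PS, Pr]

lemma drift {c q : ℕ → (ℕ → Y) → Y → ℝ} (hc : Ker c) (hq : Ker q) (y0 : ℕ → Y) (L : ℕ) :
    PS y0 L (fun y => Pr c L y * ∑ i ∈ Finset.range L, Real.log (c i y (y i) / q i y (y i))) =
    PS y0 L (fun y => Pr c L y * ∑ i ∈ Finset.range L, kl (c i y) (q i y)) := by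
  induction L with
  | zero => simp
  | succ L ih =>
    have e1 : Adp L (fun y => ∑ i ∈ Finset.range L, Real.log (c i y (y i) / q i y (y i))) := by
      intro y y' h
      refine Finset.sum_congr rfl fun i hi => ?_
      have hi := Finset.mem_range.1 hi
      rw [hc.adp i y y' fun j hj => h j (by omega), hq.adp i y y' fun j hj => h j (by omega), h i hi]
    have e2 : Adp L (fun y => ∑ i ∈ Finset.range (L+1), kl (c i y) (q i y)) := by
      intro y y' h
      refine Finset.sum_congr rfl fun i hi => ?_
      have hi := Finset.mem_range.1 hi
      rw [hc.adp i y y' fun j hj => h j (by omega), hq.adp i y y' fun j hj => h j (by omega)]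
    rw [PS_Pr_succ hc y0 L e2]
    simp only [Finset.sum_range_succ _ L, mul_add, PS_add]
    rw [PS_Pr_succ hc y0 L e1, ih, PS_Pr_succ' hc]
    simp only [(hc.adp _).upd le_rfl, (hq.adp _).upd le_rfl, Function.update_self]
    rfl

open Classical in
lemma core {W : Type*} [Fintype W] {c q : W → ℕ → (ℕ → Y) → Y → ℝ}
    (hc : ∀ w, Ker (c w)) (hq : ∀ w, Ker (q w))
    (hcq : ∀ w i y a, 0 < c w i y a → 0 < q w i y a) (y0 : ℕ → Y) (L : ℕ)
    (A : W → (ℕ → Y) → Prop) {B : ℝ} (hB : 0 < B) [Nonempty W]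
    (hA : ∑ w, PS y0 L (fun y => Pr (q w) L y * if A w y then 1 else 0) ≤ B) :
    (∑ w, PS y0 L (fun y => Pr (c w) L y * if A w y then 1 else 0)) * Real.log (Fintype.card W / B)
      ≤ ∑ w, PS y0 L (fun y => Pr (c w) L y * ∑ i ∈ Finset.range L, kl (c w i y) (q w i y))
        + Fintype.card W := by
  have hn : (0:ℝ) < Fintype.card W := by exact_mod_cast Fintype.card_pos
  set x : ℝ := Fintype.card W / B with hx
  have hx0 : 0 < x := by positivity
  have pt : ∀ w y, Real.log x * (Pr (c w) L y * if A w y then (1:ℝ) else 0) + Pr (c w) L y ≤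
      Pr (c w) L y * ∑ i ∈ Finset.range L, Real.log (c w i y (y i) / q w i y (y i)) +
      (x * (Pr (q w) L y * if A w y then 1 else 0) + Pr (q w) L y) := by
    intro w y
    rcases (Pr_nonneg (hc w) L y).eq_or_lt with h0 | h0
    · rw [← h0]
      have := Pr_nonneg (hq w) L y
      split_ifs <;> simp <;> positivity
    · have hpos : ∀ i ∈ Finset.range L, 0 < c w i y (y i) := by
        intro i hi
        refine lt_of_le_of_ne (((hc w).pmf i y).1 _) fun h => ?_
        exact h0.ne' (Finset.prod_eq_zero hi h.symm)
      have hqpos : 0 < Pr (q w) L y := Finset.prod_pos fun i hi => hcq _ _ _ _ (hpos i hi)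
      have hΛ : ∑ i ∈ Finset.range L, Real.log (c w i y (y i) / q w i y (y i))
          = Real.log (Pr (c w) L y / Pr (q w) L y) := by
        unfold Pr
        rw [← Finset.prod_div_distrib, Real.log_prod]
        intro i hi
        exact (div_pos (hpos i hi) (hcq _ _ _ _ (hpos i hi))).ne'
      rw [hΛ]
      set p := Pr (c w) L y
      set r := Pr (q w) L y
      have main : ∀ φ : ℝ, 0 < φ → p * Real.log φ + p ≤ p * Real.log (p / r) + φ * r := by
        intro φ hφ
        have h1 := Real.log_le_sub_one_of_pos (show 0 < φ * r / p by positivity)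
        have h2 : Real.log (φ * r / p) = Real.log φ - Real.log (p / r) := by
          rw [← Real.log_div hφ.ne' (by positivity)]; congr 1; field_simp
        rw [h2] at h1
        have h3 := mul_le_mul_of_nonneg_left h1 h0.le
        have h4 : p * (φ * r / p - 1) = φ * r - p := by field_simp
        linarith
      split_ifs with hAw
      · have := main (x + 1) (by positivity)
        have h5 : Real.log x ≤ Real.log (x + 1) := Real.log_le_log hx0 (by linarith)
        have h6 := mul_le_mul_of_nonneg_left h5 h0.le
        nlinarith
      · have := main 1 one_pos
        simp at this ⊢; linarith
  have s : ∑ w, PS y0 L (fun y => Real.log x * (Pr (c w) L y * if A w y then (1:ℝ) else 0) + Pr (c w) L y)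
     ≤ ∑ w, PS y0 L (fun y => Pr (c w) L y * ∑ i ∈ Finset.range L, Real.log (c w i y (y i) / q w i y (y i)) +
      (x * (Pr (q w) L y * if A w y then 1 else 0) + Pr (q w) L y)) :=
    Finset.sum_le_sum fun w _ => PS_mono y0 L (pt w)
  simp only [PS_add, PS_mul, drift (hc _) (hq _), PS_Pr (hc _), PS_Pr (hq _), Finset.sum_add_distrib,
    ← Finset.mul_sum] at s
  have h7 : x * ∑ w, PS y0 L (fun y => Pr (q w) L y * if A w y then 1 else 0) ≤ x * B :=
    mul_le_mul_of_nonneg_left hA hx0.le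
  have h8 : x * B = Fintype.card W := by rw [hx]; field_simp
  simp only [Finset.sum_const, Finset.card_univ, nsmul_eq_mul, mul_one] at s
  linarith

open Classical in
lemma coreB {W Γ : Type*} [Fintype W] [Fintype Γ] {q : W → ℕ → (ℕ → Y) → Y → ℝ}
    (γ : W → Γ) (qh : Γ → ℕ → (ℕ → Y) → Y → ℝ) (hq : ∀ g, Ker (qh g)) (y0 : ℕ → Y) (L : ℕ)
    (A : W → (ℕ → Y) → Prop) (heq : ∀ w y, A w y → ∀ i < L, q w i y = qh (γ w) i y)
    (huniq : ∀ w w' y, A w y → A w' y → γ w = γ w' → w = w') :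
    ∑ w, PS y0 L (fun y => Pr (q w) L y * if A w y then 1 else 0) ≤ Fintype.card Γ := by
  rw [← PS_sum]
  have : (Fintype.card Γ : ℝ) = PS y0 L (fun y => ∑ g, Pr (qh g) L y) := by
    rw [PS_sum]; simp [PS_Pr (hq _)]
  rw [this]
  refine PS_mono y0 L fun y => ?_
  have e : ∀ w, (Pr (q w) L y * if A w y then (1:ℝ) else 0) = if A w y then Pr (qh (γ w)) L y else 0 := by
    intro w
    split_ifs with h
    · rw [mul_one]; exact Finset.prod_congr rfl fun i hi => by rw [heq w y h i (Finset.mem_range.1 hi)]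
    · simp
  simp_rw [e]
  rw [← Finset.sum_filter, ← Finset.sum_image (g := γ) (f := fun g => Pr (qh g) L y)]
  · exact Finset.sum_le_sum_of_subset_of_nonneg (Finset.subset_univ _)
      fun g _ _ => Pr_nonneg (hq g) L y
  · intro w hw w' hw' h
    simp at hw hw'
    exact huniq w w' y hw hw' h

end paths
end OB

namespace OB

section reg

open Classical in
def avg {W J : Type*} [Fintype W] (κ : W → J) (f : W → ℝ) (w : W) : ℝ :=
  (∑ v, if κ v = κ w then f v else 0) / (∑ v, if κ v = κ w then (1:ℝ) else 0)

variable {W J J' : Type*} [Fintype W]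

open Classical in
lemma cnt_pos (κ : W → J) (w : W) : 0 < ∑ v, if κ v = κ w then (1:ℝ) else 0 := by
  refine Finset.sum_pos' (fun v _ => by split_ifs <;> simp) ⟨w, Finset.mem_univ _, by simp⟩

lemma avg_congr (κ : W → J) (f : W → ℝ) {w w' : W} (h : κ w = κ w') : avg κ f w = avg κ f w' := by
  unfold avg; rw [h]

lemma avg_mul (κ : W → J) (f h : W → ℝ) (hh : ∀ w w', κ w = κ w' → h w = h w') :
    ∑ w, avg κ f w * h w = ∑ w, f w * h w := by
  classical
  have e : ∀ w, avg κ f w * h w = ∑ v, if κ v = κ w then f v * h v / (∑ u, if κ u = κ v then (1:ℝ) else 0) else 0 := by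
    intro w
    unfold avg
    rw [Finset.sum_div, Finset.sum_mul]
    refine Finset.sum_congr rfl fun v _ => ?_
    split_ifs with hv
    · rw [hh v w hv, hv]; ring
    · simp
  simp_rw [e]
  rw [Finset.sum_comm]
  refine Finset.sum_congr rfl fun v _ => ?_
  have := cnt_pos κ v
  have e2 : ∀ w, (if κ v = κ w then f v * h v / (∑ u, if κ u = κ v then (1:ℝ) else 0) else 0) =
     (f v * h v / (∑ u, if κ u = κ v then (1:ℝ) else 0)) * (if κ w = κ v then 1 else 0) := by
    intro w
    by_cases hw : κ v = κ w
    · rw [if_pos hw, if_pos hw.symm, mul_one]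
    · rw [if_neg hw, if_neg (Ne.symm hw), mul_zero]
  simp_rw [e2]
  rw [← Finset.mul_sum]
  field_simp

lemma avg_nonneg (κ : W → J) {f : W → ℝ} (hf : ∀ w, 0 ≤ f w) (w : W) : 0 ≤ avg κ f w := by
  unfold avg
  refine div_nonneg (Finset.sum_nonneg fun v _ => ?_) (cnt_pos κ w).le
  split_ifs; exacts [hf v, le_rfl]

lemma avg_le_one (κ : W → J) {f : W → ℝ} (hf : ∀ w, f w ≤ 1) (w : W) : avg κ f w ≤ 1 := by
  unfold avg
  rw [div_le_one (cnt_pos κ w)]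
  refine Finset.sum_le_sum fun v _ => ?_
  split_ifs; exacts [hf v, le_rfl]

def energy {m : ℕ} (κ : W → J) (f : Fin m → W → ℝ) : ℝ := ∑ b, ∑ w, avg κ (f b) w ^ 2

lemma energy_le {m : ℕ} (κ : W → J) {f : Fin m → W → ℝ} (h0 : ∀ b w, 0 ≤ f b w) (h1 : ∀ b w, f b w ≤ 1) :
    energy κ f ≤ m * Fintype.card W := by
  have : energy κ f ≤ ∑ b : Fin m, ∑ w : W, (1:ℝ) := by
    refine Finset.sum_le_sum fun b _ => Finset.sum_le_sum fun w _ => ?_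
    have a := avg_nonneg κ (h0 b) w
    have b := avg_le_one κ (h1 b) w
    nlinarith
  simpa using this

lemma pyth (κ : W → J) (κ' : W → J') (href : ∀ w w', κ' w = κ' w' → κ w = κ w') (f : W → ℝ) :
    ∑ w, (avg κ' f w - avg κ f w) ^ 2 = ∑ w, avg κ' f w ^ 2 - ∑ w, avg κ f w ^ 2 := by
  have h1 := avg_mul κ' f (avg κ f) (fun w w' h => avg_congr κ f (href w w' h))
  have h2 := avg_mul κ f (avg κ f) (fun w w' h => avg_congr κ f h)
  have : ∀ w, (avg κ' f w - avg κ f w) ^ 2 =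
     avg κ' f w ^ 2 - 2 * (avg κ' f w * avg κ f w) + avg κ f w * avg κ f w := fun w => by ring
  simp_rw [this, Finset.sum_add_distrib, Finset.sum_sub_distrib, ← Finset.mul_sum, h1, ← h2]
  simp_rw [pow_two]; ring

lemma l1_sq (κ : W → J) (κ' : W → J') (href : ∀ w w', κ' w = κ' w' → κ w = κ w') (f : W → ℝ) :
    (∑ w, |avg κ' f w - avg κ f w|) ^ 2 ≤
      Fintype.card W * (∑ w, avg κ' f w ^ 2 - ∑ w, avg κ f w ^ 2) := by
  rw [← pyth κ κ' href]
  have := sq_sum_le_card_mul_sum_sq (s := (Finset.univ : Finset W)) (f := fun w => |avg κ' f w - avg κ f w|)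
  simpa [sq_abs] using this

lemma energy_incr {m : ℕ} (κ : W → J) (κ' : W → J') (href : ∀ w w', κ' w = κ' w' → κ w = κ w')
    (f : Fin m → W → ℝ) (b : Fin m) :
    (∑ w, |avg κ' (f b) w - avg κ (f b) w|) ^ 2 ≤ Fintype.card W * (energy κ' f - energy κ f) := by
  refine (l1_sq κ κ' href (f b)).trans (mul_le_mul_of_nonneg_left ?_ (by positivity))
  have e : energy κ' f - energy κ f = ∑ b, (∑ w, avg κ' (f b) w ^ 2 - ∑ w, avg κ (f b) w ^ 2) := by
    unfold energy; rw [Finset.sum_sub_distrib]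
  rw [e]
  refine Finset.single_le_sum (f := fun b => ∑ w, avg κ' (f b) w ^ 2 - ∑ w, avg κ (f b) w ^ 2)
    (fun b _ => ?_) (Finset.mem_univ b)
  rw [← pyth κ κ' href]; positivity

def pairL {W1 W2 A B : Type} (α : W1 → A) (β : W2 → B) : W1 × W2 → A × B := fun w => (α w.1, β w.2)

def ext1 {W1 A X : Type} (α : W1 → A) (x : W1 → X) : W1 → A × X := fun w => (α w, x w)

def Good {W1 W2 X1 X2 A B : Type} [Fintype W1] [Fintype W2] {m : ℕ} (x1 : ℕ → W1 → X1) (x2 : ℕ → W2 → X2)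
    (f : Fin m → W1 × W2 → ℝ) (η : ℝ) (α : W1 → A) (β : W2 → B) : Prop :=
  ∀ b i, ∑ w, |avg (pairL (ext1 α (x1 i)) (ext1 β (x2 i))) (f b) w - avg (pairL α β) (f b) w| ≤
    η * Fintype.card (W1 × W2)

lemma regularity_aux {W1 W2 X1 X2 : Type} [Fintype W1] [Fintype W2] [Nonempty W1] [Nonempty W2]
    [Fintype X1] [Fintype X2] [Nonempty X1] [Nonempty X2]
    {m : ℕ} (x1 : ℕ → W1 → X1) (x2 : ℕ → W2 → X2)
    {f : Fin m → W1 × W2 → ℝ} (h0 : ∀ b w, 0 ≤ f b w) (h1 : ∀ b w, f b w ≤ 1) {η : ℝ} (hη : 0 < η) (k : ℕ) :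
    ∀ (A B : Type) (_ : Fintype A) (_ : Fintype B) (α : W1 → A) (β : W2 → B),
      m * Fintype.card (W1 × W2) < energy (pairL α β) f + k * (η ^ 2 * Fintype.card (W1 × W2)) →
      ∃ (A' B' : Type) (_ : Fintype A') (_ : Fintype B') (α' : W1 → A') (β' : W2 → B'),
        Fintype.card A' * Fintype.card B' ≤ Fintype.card A * Fintype.card B *
          (Fintype.card X1 * Fintype.card X2) ^ k ∧ Good x1 x2 f η α' β' := by
  induction k with
  | zero =>
    intro A B _ _ α β h
    have := energy_le (pairL α β) h0 h1
    simp only [Nat.cast_zero, zero_mul, add_zero] at h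
    exact absurd h (not_lt.2 this)
  | succ k ih =>
    intro A B _ _ α β h
    have hM : (0:ℝ) < Fintype.card (W1 × W2) := by exact_mod_cast Fintype.card_pos
    have hX : 1 ≤ Fintype.card X1 * Fintype.card X2 := Nat.mul_pos Fintype.card_pos Fintype.card_pos
    by_cases hg : Good x1 x2 f η α β
    · refine ⟨A, B, inferInstance, inferInstance, α, β, ?_, hg⟩
      exact Nat.le_mul_of_pos_right _ (Nat.pos_of_ne_zero (pow_ne_zero _ (by omega)))
    · unfold Good at hg
      push Not at hg
      obtain ⟨b, i, hb⟩ := hg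
      have hi := energy_incr (pairL α β) (pairL (ext1 α (x1 i)) (ext1 β (x2 i)))
        (by intro w w' hw; simp [pairL, ext1] at hw ⊢; tauto) f b
      have hsq : (η * Fintype.card (W1 × W2)) ^ 2 <
        (∑ w, |avg (pairL (ext1 α (x1 i)) (ext1 β (x2 i))) (f b) w - avg (pairL α β) (f b) w|) ^ 2 :=
        pow_lt_pow_left₀ hb (by positivity) two_ne_zero
      have h3 := hsq.trans_le hi
      have h4 : η ^ 2 * Fintype.card (W1 × W2) < energy (pairL (ext1 α (x1 i)) (ext1 β (x2 i))) f - energy (pairL α β) f := by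
        refine lt_of_mul_lt_mul_left ?_ hM.le
        calc _ = (η * Fintype.card (W1 × W2)) ^ 2 := by ring
          _ < _ := h3
      obtain ⟨A', B', i1, i2, α', β', hc, hg'⟩ := ih (A × X1) (B × X2) inferInstance inferInstance
        (ext1 α (x1 i)) (ext1 β (x2 i)) (by push_cast at h ⊢; linarith)
      refine ⟨A', B', i1, i2, α', β', hc.trans (le_of_eq ?_), hg'⟩
      simp only [Fintype.card_prod]; ring

lemma regularity {W1 W2 X1 X2 : Type} [Fintype W1] [Fintype W2] [Nonempty W1] [Nonempty W2]
    [Fintype X1] [Fintype X2] [Nonempty X1] [Nonempty X2]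
    {m : ℕ} (x1 : ℕ → W1 → X1) (x2 : ℕ → W2 → X2)
    {f : Fin m → W1 × W2 → ℝ} (h0 : ∀ b w, 0 ≤ f b w) (h1 : ∀ b w, f b w ≤ 1) {η : ℝ} (hη : 0 < η)
    {k : ℕ} (hk : m < k * η ^ 2) :
      ∃ (A B : Type) (_ : Fintype A) (_ : Fintype B) (α : W1 → A) (β : W2 → B),
        Fintype.card A * Fintype.card B ≤ (Fintype.card X1 * Fintype.card X2) ^ k ∧
          Good x1 x2 f η α β := by
  have hM : (0:ℝ) < Fintype.card (W1 × W2) := by exact_mod_cast Fintype.card_pos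
  obtain ⟨A, B, i1, i2, α, β, h, hg⟩ := regularity_aux x1 x2 h0 h1 hη k Unit Unit inferInstance inferInstance
    (fun _ => ()) (fun _ => ()) (by
      have : 0 ≤ energy (pairL (fun _ : W1 => ()) (fun _ : W2 => ())) f :=
        Finset.sum_nonneg fun b _ => Finset.sum_nonneg fun w _ => sq_nonneg _
      nlinarith)
  exact ⟨A, B, i1, i2, α, β, by simpa using h, hg⟩

open Classical in
/-- conditional law of `x` given the label -/
def cl {W A X : Type} [Fintype W] [Nonempty X] (α : W → A) (x : W → X) (a : A) (z : X) : ℝ :=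
  if ∃ w, α w = a then
    (∑ w, if α w = a ∧ x w = z then (1:ℝ) else 0) / (∑ w, if α w = a then (1:ℝ) else 0)
  else if z = Classical.arbitrary X then 1 else 0

lemma cl_pmf {W A X : Type} [Fintype W] [Fintype X] [Nonempty X] (α : W → A) (x : W → X) (a : A) :
    IsPMF (cl α x a) := by
  classical
  unfold cl
  split_ifs with h
  · obtain ⟨w, rfl⟩ := h
    have hp := cnt_pos α w
    refine ⟨fun z => div_nonneg (Finset.sum_nonneg fun v _ => by split_ifs <;> simp) hp.le, ?_⟩
    rw [← Finset.sum_div, Finset.sum_comm, div_eq_one_iff_eq hp.ne']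
    refine Finset.sum_congr rfl fun v _ => ?_
    by_cases hv : α v = α w <;> simp [hv]
  · refine ⟨fun z => by dsimp only; split_ifs <;> simp, by simp⟩

lemma cl_sum {W A X : Type} [Fintype W] [Fintype X] [Nonempty X] (α : W → A) (x : W → X) (G : A → X → ℝ) :
    ∑ w, ∑ z, cl α x (α w) z * G (α w) z = ∑ w, G (α w) (x w) := by
  classical
  have h := avg_mul α (fun w => G (α w) (x w)) (fun _ => 1) (fun _ _ _ => rfl)
  simp only [mul_one] at h
  rw [← h]
  refine Finset.sum_congr rfl fun w _ => ?_
  unfold avg cl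
  simp_rw [if_pos (show ∃ v, α v = α w from ⟨w, rfl⟩)]
  simp_rw [div_mul_eq_mul_div]
  rw [← Finset.sum_div]
  congr 1
  simp_rw [Finset.sum_mul]
  rw [Finset.sum_comm]
  refine Finset.sum_congr rfl fun v _ => ?_
  by_cases hv : α v = α w <;> simp [hv]

lemma good_use {W1 W2 X1 X2 A B : Type} [Fintype W1] [Fintype W2]
    [Fintype X1] [Fintype X2] [Nonempty X1] [Nonempty X2]
    {m : ℕ} {x1 : ℕ → W1 → X1} {x2 : ℕ → W2 → X2}
    {f : Fin m → W1 × W2 → ℝ} {η : ℝ} {α : W1 → A} {β : W2 → B} (hg : Good x1 x2 f η α β)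
    (b : Fin m) (i : ℕ) (g : A → B → X1 → X2 → ℝ) {D : ℝ} (hD : ∀ a b x y, |g a b x y| ≤ D) :
    ∑ w : W1 × W2, f b w * g (α w.1) (β w.2) (x1 i w.1) (x2 i w.2) ≤
      ∑ w : W1 × W2, f b w * (∑ x, ∑ y, cl α (x1 i) (α w.1) x * cl β (x2 i) (β w.2) y * g (α w.1) (β w.2) x y)
      + η * D * Fintype.card (W1 × W2) := by
  set κ := pairL α β
  set κ' := pairL (ext1 α (x1 i)) (ext1 β (x2 i))
  have e1 := avg_mul κ' (f b) (fun w => g (α w.1) (β w.2) (x1 i w.1) (x2 i w.2))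
    (by intro w w' h; simp [κ', pairL, ext1] at h; simp [h])
  have e2 := avg_mul κ (f b) (fun w => (∑ x, ∑ y, cl α (x1 i) (α w.1) x * cl β (x2 i) (β w.2) y * g (α w.1) (β w.2) x y))
    (by intro w w' h; simp [κ, pairL] at h; simp [h])
  rw [← e1, ← e2]
  have e3 : ∑ w, avg κ (f b) w * g (α w.1) (β w.2) (x1 i w.1) (x2 i w.2) =
     ∑ w, avg κ (f b) w * (∑ x, ∑ y, cl α (x1 i) (α w.1) x * cl β (x2 i) (β w.2) y * g (α w.1) (β w.2) x y) := by
    have hf : ∃ F : A → B → ℝ, ∀ w, avg κ (f b) w = F (α w.1) (β w.2) := by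
      classical
      refine ⟨fun a b' => if h : ∃ w : W1 × W2, α w.1 = a ∧ β w.2 = b' then avg κ (f b) h.choose else 0, fun w => ?_⟩
      have h : ∃ v : W1 × W2, α v.1 = α w.1 ∧ β v.2 = β w.2 := ⟨w, rfl, rfl⟩
      beta_reduce
      rw [dif_pos h]
      have := h.choose_spec
      exact avg_congr _ _ (by simp [κ, pairL, this])
    obtain ⟨F, hF⟩ := hf
    simp_rw [hF]
    rw [Fintype.sum_prod_type, Fintype.sum_prod_type]
    have s1 : ∀ w1, ∑ w2, F (α w1) (β w2) * g (α w1) (β w2) (x1 i w1) (x2 i w2) =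
        ∑ w2, ∑ y, cl β (x2 i) (β w2) y * (F (α w1) (β w2) * g (α w1) (β w2) (x1 i w1) y) := fun w1 =>
      (cl_sum β (x2 i) (fun b' y => F (α w1) b' * g (α w1) b' (x1 i w1) y)).symm
    simp_rw [s1]
    have s2 := cl_sum α (x1 i) (fun a x => ∑ w2, ∑ y, cl β (x2 i) (β w2) y * (F a (β w2) * g a (β w2) x y))
    rw [← s2]
    refine Finset.sum_congr rfl fun w1 _ => ?_
    simp only [Finset.mul_sum]
    rw [Finset.sum_comm]
    refine Finset.sum_congr rfl fun w2 _ => Finset.sum_congr rfl fun x _ => Finset.sum_congr rfl fun y _ => ?_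
    ring
  rw [← e3]
  have h4 : ∑ w, avg κ' (f b) w * g (α w.1) (β w.2) (x1 i w.1) (x2 i w.2) -
      ∑ w, avg κ (f b) w * g (α w.1) (β w.2) (x1 i w.1) (x2 i w.2) ≤ D * ∑ w, |avg κ' (f b) w - avg κ (f b) w| := by
    rw [← Finset.sum_sub_distrib, Finset.mul_sum]
    refine Finset.sum_le_sum fun w _ => ?_
    rw [← sub_mul]
    refine (le_abs_self _).trans ?_
    rw [abs_mul, mul_comm]
    exact mul_le_mul_of_nonneg_right (hD _ _ _ _) (abs_nonneg _)
  rcases isEmpty_or_nonempty (W1 × W2) with he | ⟨⟨w⟩⟩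
  · simp
  · have hD0 : 0 ≤ D := (abs_nonneg _).trans (hD (α w.1) (β w.2) (x1 i w.1) (x2 i w.2))
    have := mul_le_mul_of_nonneg_left (hg b i) hD0
    linarith

end reg
end OB

namespace OB

section conv

open Classical in
def ph {Y : Type*} (s1 s2 : ℕ → (ℕ → Y) → Prop) (k11 k10 k01 k00 : ℕ → (ℕ → Y) → Y → ℝ)
    (i : ℕ) (y : ℕ → Y) : Y → ℝ :=
  if s1 i y then (if s2 i y then k11 i y else k10 i y) else (if s2 i y then k01 i y else k00 i y)

lemma ker_ph {Y : Type*} [Fintype Y] {s1 s2 : ℕ → (ℕ → Y) → Prop} {k11 k10 k01 k00 : ℕ → (ℕ → Y) → Y → ℝ}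
    (hs1 : ∀ i, Adp i (s1 i)) (hs2 : ∀ i, Adp i (s2 i))
    (p11 : ∀ i y, IsPMF (k11 i y)) (p10 : ∀ i y, IsPMF (k10 i y))
    (p01 : ∀ i y, IsPMF (k01 i y)) (p00 : ∀ i y, IsPMF (k00 i y))
    (a11 : ∀ i y y', (∀ j < i, y j = y' j) → s1 i y → s2 i y → k11 i y = k11 i y')
    (a10 : ∀ i y y', (∀ j < i, y j = y' j) → s1 i y → k10 i y = k10 i y')
    (a01 : ∀ i y y', (∀ j < i, y j = y' j) → s2 i y → k01 i y = k01 i y')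
    (a00 : ∀ i y y', (∀ j < i, y j = y' j) → k00 i y = k00 i y') :
    Ker (ph s1 s2 k11 k10 k01 k00) := by
  constructor
  · intro i y y' h
    unfold ph
    rw [← hs1 i y y' h, ← hs2 i y y' h]
    split_ifs with h1 h2 h2
    · exact a11 i y y' h h1 h2
    · exact a10 i y y' h h1
    · exact a01 i y y' h h2
    · exact a00 i y y' h
  · intro i y
    unfold ph
    split_ifs <;> solve_by_elim

variable {X1 X2 Y W1 W2 A B : Type} [Fintype X1] [Fintype X2] [Fintype Y] [Fintype W1] [Fintype W2]
  [Fintype A] [Fintype B] [Nonempty X1] [Nonempty X2] [Nonempty W1] [Nonempty W2]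

def cK (ch : X1 → X2 → Y → ℝ) (x1 : ℕ → W1 → X1) (x2 : ℕ → W2 → X2) (w : W1 × W2) (i : ℕ)
    (_ : ℕ → Y) : Y → ℝ := ch (x1 i w.1) (x2 i w.2)

omit [Fintype X1] [Fintype X2] [Fintype W1] [Fintype W2]
  [Nonempty X1] [Nonempty X2] [Nonempty W1] [Nonempty W2] in
lemma cK_ker {ch : X1 → X2 → Y → ℝ} (hch : ∀ a b, IsPMF (ch a b)) (x1 : ℕ → W1 → X1)
    (x2 : ℕ → W2 → X2) (w : W1 × W2) : Ker (cK ch x1 x2 w) :=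
  ⟨fun _ _ _ _ => rfl, fun _ _ => hch _ _⟩

/-- expectation of a functional of messages and outputs -/
def Ex (ch : X1 → X2 → Y → ℝ) (x1 : ℕ → W1 → X1) (x2 : ℕ → W2 → X2) (y0 : ℕ → Y) (L : ℕ)
    (F : W1 × W2 → (ℕ → Y) → ℝ) : ℝ :=
  (∑ w, PS y0 L (fun y => Pr (cK ch x1 x2 w) L y * F w y)) / Fintype.card (W1 × W2)

open Classical in
def ind (p : Prop) : ℝ := if p then 1 else 0

lemma ind_nonneg (p : Prop) : 0 ≤ ind p := by unfold ind; split_ifs <;> simp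
lemma ind_le_one (p : Prop) : ind p ≤ 1 := by unfold ind; split_ifs <;> simp

lemma kl_self_le {Y : Type*} [Fintype Y] (p : Y → ℝ) : kl p p ≤ 0 := by
  unfold kl
  refine Finset.sum_nonpos fun y _ => ?_
  by_cases h : p y = 0 <;> simp [h]

lemma conv0 {ch : X1 → X2 → Y → ℝ} (hch : ∀ a b, IsPMF (ch a b)) {x1 : ℕ → W1 → X1} {x2 : ℕ → W2 → X2}
    {s1 s2 : ℕ → (ℕ → Y) → Prop} (hs1 : ∀ i, Adp i (s1 i)) (hs2 : ∀ i, Adp i (s2 i))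
    (y0 : ℕ → Y) (L : ℕ) {m : ℕ} {f : Fin m → W1 × W2 → ℝ} {η : ℝ} {α : W1 → A} {β : W2 → B}
    (hg : Good x1 x2 f η α β) (bl : ℕ → Fin m)
    (hf : ∀ i < L, ∀ w, PS y0 L (fun y => Pr (cK ch x1 x2 w) L y * ind (¬ s1 i y ∧ ¬ s2 i y)) ≤ f (bl i) w)
    (hf0 : ∀ b w, 0 ≤ f b w)
    (u1 u2 : W1 × W2 → ℕ → Y → ℝ) (v : A → B → X1 → X2 → ℕ → Y → ℝ)
    (pu1 : ∀ w i, IsPMF (u1 w i)) (pu2 : ∀ w i, IsPMF (u2 w i)) (pv : ∀ a b x y i, IsPMF (v a b x y i))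
    (qu1 : ∀ w i y, 0 < ch (x1 i w.1) (x2 i w.2) y → 0 < u1 w i y)
    (qu2 : ∀ w i y, 0 < ch (x1 i w.1) (x2 i w.2) y → 0 < u2 w i y)
    (qv : ∀ a b x y i z, 0 < v a b x y i z)
    {κ1 κ2 Dm τ : ℝ} (hκ1 : ∀ w i, kl (ch (x1 i w.1) (x2 i w.2)) (u1 w i) ≤ κ1)
    (hκ2 : ∀ w i, kl (ch (x1 i w.1) (x2 i w.2)) (u2 w i) ≤ κ2)
    (hDm : ∀ a b x y i, kl (ch x y) (v a b x y i) ≤ Dm)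
    (J : ℕ → A → B → ℝ)
    (hJ : ∀ i a b, ∑ x, ∑ y, cl α (x1 i) a x * cl β (x2 i) b y * kl (ch x y) (v a b x y i) ≤ J i a b + τ)
    (AA : W1 × W2 → (ℕ → Y) → Prop) {Bd : ℝ} (hBd : 0 < Bd)
    (hA : ∑ w, PS y0 L (fun y => Pr (ph s1 s2 (cK ch x1 x2 w) (fun i _ => u2 w i) (fun i _ => u1 w i)
      (fun i _ => v (α w.1) (β w.2) (x1 i w.1) (x2 i w.2) i)) L y * ind (AA w y)) ≤ Bd) :
    Ex ch x1 x2 y0 L (fun w y => ind (AA w y)) * Real.log (Fintype.card (W1 × W2) / Bd) ≤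
      (∑ i ∈ Finset.range L, ∑ w, f (bl i) w * (J i (α w.1) (β w.2) + τ)) / Fintype.card (W1 × W2)
      + L * (η * Dm)
      + κ1 * Ex ch x1 x2 y0 L (fun _ y => ∑ i ∈ Finset.range L, ind (¬ s1 i y ∧ s2 i y))
      + κ2 * Ex ch x1 x2 y0 L (fun _ y => ∑ i ∈ Finset.range L, ind (s1 i y ∧ ¬ s2 i y)) + 1 := by
  classical
  have hM : (0:ℝ) < Fintype.card (W1 × W2) := by exact_mod_cast Fintype.card_pos
  set M : ℝ := ((Fintype.card (W1 × W2) : ℕ) : ℝ) with hMdef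
  set q : W1 × W2 → ℕ → (ℕ → Y) → Y → ℝ := fun w => ph s1 s2 (cK ch x1 x2 w) (fun i _ => u2 w i) (fun i _ => u1 w i)
      (fun i _ => v (α w.1) (β w.2) (x1 i w.1) (x2 i w.2) i) with hq
  set c := cK ch x1 x2 with hc
  have kc : ∀ w, Ker (c w) := cK_ker hch x1 x2
  have kq : ∀ w, Ker (q w) := fun w => ker_ph hs1 hs2 (fun _ _ => hch _ _) (fun _ _ => pu2 _ _)
    (fun _ _ => pu1 _ _) (fun _ _ => pv _ _ _ _ _) (fun _ _ _ _ _ _ => rfl) (fun _ _ _ _ _ => rfl)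
    (fun _ _ _ _ _ => rfl) (fun _ _ _ _ => rfl)
  have hcq : ∀ w i y a, 0 < c w i y a → 0 < q w i y a := by
    intro w i y a h
    simp only [hq, ph]
    split_ifs
    exacts [h, qu2 w i a h, qu1 w i a h, qv _ _ _ _ _ _]
  have main := core kc kq hcq y0 L AA hBd hA
  rw [← hMdef] at main
  -- pointwise bound on kl
  set g : W1 × W2 → ℕ → ℝ := fun w i => kl (ch (x1 i w.1) (x2 i w.2)) (v (α w.1) (β w.2) (x1 i w.1) (x2 i w.2) i) with hgdef
  have gnn : ∀ a b x y i, 0 ≤ kl (ch x y) (v a b x y i) := fun a b x y i =>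
    kl_nonneg (hch _ _) (pv _ _ _ _ _).1 (pv _ _ _ _ _).2.le fun z _ => qv _ _ _ _ _ _
  have hkl : ∀ w i y, kl (c w i y) (q w i y) ≤ g w i * ind (¬ s1 i y ∧ ¬ s2 i y)
      + κ1 * ind (¬ s1 i y ∧ s2 i y) + κ2 * ind (s1 i y ∧ ¬ s2 i y) := by
    intro w i y
    simp only [hq, ph, ind]
    by_cases h1 : s1 i y <;> by_cases h2 : s2 i y <;> simp [h1, h2]
    · exact kl_self_le _
    · exact hκ2 w i
    · exact hκ1 w i
    · exact le_rfl
  have step1 : ∀ w, PS y0 L (fun y => Pr (c w) L y * ∑ i ∈ Finset.range L, kl (c w i y) (q w i y)) ≤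
      ∑ i ∈ Finset.range L, f (bl i) w * g w i
      + κ1 * PS y0 L (fun y => Pr (c w) L y * ∑ i ∈ Finset.range L, ind (¬ s1 i y ∧ s2 i y))
      + κ2 * PS y0 L (fun y => Pr (c w) L y * ∑ i ∈ Finset.range L, ind (s1 i y ∧ ¬ s2 i y)) := by
    intro w
    have a1 : PS y0 L (fun y => Pr (c w) L y * ∑ i ∈ Finset.range L, kl (c w i y) (q w i y)) ≤
       PS y0 L (fun y => ∑ i ∈ Finset.range L, g w i * (Pr (c w) L y * ind (¬ s1 i y ∧ ¬ s2 i y))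
         + (κ1 * (Pr (c w) L y * ∑ i ∈ Finset.range L, ind (¬ s1 i y ∧ s2 i y)) +
         κ2 * (Pr (c w) L y * ∑ i ∈ Finset.range L, ind (s1 i y ∧ ¬ s2 i y)))) := by
      refine PS_mono y0 L fun y => ?_
      have := mul_le_mul_of_nonneg_left (Finset.sum_le_sum fun i (_ : i ∈ Finset.range L) => hkl w i y) (Pr_nonneg (kc w) L y)
      refine this.trans (le_of_eq ?_)
      simp only [Finset.sum_add_distrib, mul_add, Finset.mul_sum]
      rw [add_assoc]
      congr 1
      · exact Finset.sum_congr rfl fun i _ => by ring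
      · congr 1 <;> exact Finset.sum_congr rfl fun i _ => by ring
    rw [PS_add, PS_add, PS_sum] at a1
    simp only [PS_mul] at a1
    refine a1.trans ?_
    rw [add_assoc]
    refine add_le_add_left (Finset.sum_le_sum fun i hi => ?_) _
    rw [mul_comm]
    exact mul_le_mul_of_nonneg_right (hf i (Finset.mem_range.1 hi) w) (gnn _ _ _ _ _)
  have step2 := Finset.sum_le_sum fun w (_ : w ∈ (Finset.univ : Finset (W1 × W2))) => step1 w
  simp only [Finset.sum_add_distrib, ← Finset.mul_sum] at step2
  rw [Finset.sum_comm] at step2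
  have step3 : ∑ i ∈ Finset.range L, ∑ w, f (bl i) w * g w i ≤
      ∑ i ∈ Finset.range L, (∑ w, f (bl i) w * (J i (α w.1) (β w.2) + τ) + η * Dm * M) := by
    refine Finset.sum_le_sum fun i _ => ?_
    have := good_use hg (bl i) i (fun a b x y => kl (ch x y) (v a b x y i)) (D := Dm)
      (fun a b x y => by rw [abs_of_nonneg (gnn _ _ _ _ _)]; exact hDm _ _ _ _ _)
    refine this.trans ?_
    gcongr with w hw
    · exact hf0 _ _
    · exact hJ _ _ _
  rw [Finset.sum_add_distrib] at step3
  simp only [Finset.sum_const, Finset.card_range, nsmul_eq_mul] at step3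
  have fin := main.trans (add_le_add_left (step2.trans (add_le_add_left (add_le_add_left step3 _) _)) _)
  unfold Ex
  rw [← mul_le_mul_iff_left₀ hM]
  refine le_trans (le_of_eq ?_) (fin.trans (le_of_eq ?_))
  · unfold ind; rw [mul_right_comm, ← hMdef, div_mul_cancel₀ _ hM.ne']
  · field_simp
    ring

end conv
end OB

namespace OB

section conv3

variable {X1 X2 Y W1 W2 A B : Type} [Fintype X1] [Fintype X2] [Fintype Y] [Fintype W1] [Fintype W2]
  [Fintype A] [Fintype B] [Nonempty X1] [Nonempty X2] [Nonempty W1] [Nonempty W2]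

lemma sm_pos' {Y : Type*} [Fintype Y] {t : ℝ} {q : Y → ℝ} (ht : 0 < t) (ht1 : t < 1) (hq : IsPMF q) (y : Y) :
    0 < sm t q y := sm_pos ht ht1 hq.1 y

lemma conv1 {ch : X1 → X2 → Y → ℝ} (hch : ∀ a b, IsPMF (ch a b)) {x1 : ℕ → W1 → X1} {x2 : ℕ → W2 → X2}
    {s1 s2 : ℕ → (ℕ → Y) → Prop} (hs1 : ∀ i, Adp i (s1 i)) (hs2 : ∀ i, Adp i (s2 i))
    (y0 : ℕ → Y) (L : ℕ) {m : ℕ} {f : Fin m → W1 × W2 → ℝ} {η : ℝ} {α : W1 → A} {β : W2 → B}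
    (hg : Good x1 x2 f η α β) (bl : ℕ → Fin m)
    (hf : ∀ i < L, ∀ w, PS y0 L (fun y => Pr (cK ch x1 x2 w) L y * ind (¬ s1 i y ∧ ¬ s2 i y)) ≤ f (bl i) w)
    (hf0 : ∀ b w, 0 ≤ f b w) {t : ℝ} (ht : 0 < t) (ht1 : t < 1)
    (dec1 : (ℕ → Y) → W1) (hd1 : ∀ i y y', (∀ j < i, y j = y' j) → s1 i y → dec1 y = dec1 y') :
    Ex ch x1 x2 y0 L (fun w y => ind (dec1 y = w.1)) *
        Real.log (Fintype.card W1 / (Fintype.card A * Fintype.card B)) ≤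
      (∑ i ∈ Finset.range L, ∑ w, f (bl i) w *
        (miNoQ1 ch (cl α (x1 i) (α w.1)) (cl β (x2 i) (β w.2)) + -Real.log (1 - t))) / Fintype.card (W1 × W2)
      + L * (η * Real.log (Fintype.card Y / t))
      + (Cap1 ch + -Real.log (1 - t)) * Ex ch x1 x2 y0 L (fun _ y => ∑ i ∈ Finset.range L, ind (¬ s1 i y ∧ s2 i y))
      + 0 * Ex ch x1 x2 y0 L (fun _ y => ∑ i ∈ Finset.range L, ind (s1 i y ∧ ¬ s2 i y)) + 1 := by
  classical
  obtain ⟨q1, hq1, hq1p, hq1k⟩ := exists_q1 hch ht ht1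
  have hA0 : 0 < Fintype.card A := Fintype.card_pos_iff.2 ⟨α (Classical.arbitrary W1)⟩
  have hB0 : 0 < Fintype.card B := Fintype.card_pos_iff.2 ⟨β (Classical.arbitrary W2)⟩
  have hW2 : 0 < Fintype.card W2 := Fintype.card_pos
  have hA0' : (0:ℝ) < Fintype.card A := by exact_mod_cast hA0
  have hB0' : (0:ℝ) < Fintype.card B := by exact_mod_cast hB0
  have hW2' : (0:ℝ) < Fintype.card W2 := by exact_mod_cast hW2
  have pm : ∀ i a y, IsPMF (mix (cl α (x1 i) a) fun x => ch x y) := fun i a y =>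
    mix_pmf (cl_pmf _ _ _) fun _ => hch _ _
  have H := conv0 hch hs1 hs2 y0 L hg bl hf hf0 (fun w i => q1 (x2 i w.2))
    (fun w i => ch (x1 i w.1) (x2 i w.2))
    (fun a _ _ y i => sm t (mix (cl α (x1 i) a) fun x => ch x y))
    (fun _ _ => hq1 _) (fun _ _ => hch _ _) (fun _ _ _ _ _ => sm_pmf ht ht1 (pm _ _ _))
    (fun _ _ _ _ => hq1p _ _) (fun _ _ _ h => h) (fun _ _ _ _ _ _ => sm_pos' ht ht1 (pm _ _ _) _)
    (κ1 := Cap1 ch + -Real.log (1 - t)) (κ2 := 0) (τ := -Real.log (1-t))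
    (Dm := Real.log (Fintype.card Y / t))
    (fun _ _ => by have := hq1k; linarith [hq1k (x1 ‹_› (‹W1 × W2› : W1 × W2).1) (x2 ‹_› (‹W1 × W2› : W1 × W2).2)])
    (fun _ _ => kl_self_le _)
    (fun a b x y i => kl_sm_le ht ht1 (hch _ _) (pm _ _ _).1)
    (fun i a b => miNoQ1 ch (cl α (x1 i) a) (cl β (x2 i) b))
    (fun i a b => by
      have := avg1 hch ht ht1 (cl_pmf α (x1 i) a) (cl_pmf β (x2 i) b)
      linarith)
    (fun w y => dec1 y = w.1) (Bd := Fintype.card (A × B × W2))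
    (by simp only [Fintype.card_prod, Nat.cast_mul]; positivity)
    (by
      refine coreB (fun w => (α w.1, β w.2, w.2))
        (fun g => ph s1 s2 (fun i y => ch (x1 i (dec1 y)) (x2 i g.2.2)) (fun i y => ch (x1 i (dec1 y)) (x2 i g.2.2))
          (fun i _ => q1 (x2 i g.2.2)) (fun i _ => sm t (mix (cl α (x1 i) g.1) fun x => ch x (x2 i g.2.2))))
        ?_ y0 L _ ?_ ?_
      · intro g
        refine ker_ph hs1 hs2 (fun _ _ => hch _ _) (fun _ _ => hch _ _) (fun _ _ => hq1 _)
          (fun _ _ => sm_pmf ht ht1 (pm _ _ _)) ?_ ?_ (fun _ _ _ _ _ => rfl) (fun _ _ _ _ => rfl)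
        · intro i y y' h h1 _; beta_reduce; rw [hd1 i y y' h h1]
        · intro i y y' h h1; beta_reduce; rw [hd1 i y y' h h1]
      · intro w y h i _
        simp only [ph, cK, h]
      · intro w w' y h h' hγ
        simp only [Prod.mk.injEq] at hγ
        exact Prod.ext (h.symm.trans h') hγ.2.2)
  refine le_trans (le_of_eq ?_) H
  congr 2
  simp only [Fintype.card_prod, Nat.cast_mul]
  field_simp

lemma conv2 {ch : X1 → X2 → Y → ℝ} (hch : ∀ a b, IsPMF (ch a b)) {x1 : ℕ → W1 → X1} {x2 : ℕ → W2 → X2}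
    {s1 s2 : ℕ → (ℕ → Y) → Prop} (hs1 : ∀ i, Adp i (s1 i)) (hs2 : ∀ i, Adp i (s2 i))
    (y0 : ℕ → Y) (L : ℕ) {m : ℕ} {f : Fin m → W1 × W2 → ℝ} {η : ℝ} {α : W1 → A} {β : W2 → B}
    (hg : Good x1 x2 f η α β) (bl : ℕ → Fin m)
    (hf : ∀ i < L, ∀ w, PS y0 L (fun y => Pr (cK ch x1 x2 w) L y * ind (¬ s1 i y ∧ ¬ s2 i y)) ≤ f (bl i) w)
    (hf0 : ∀ b w, 0 ≤ f b w) {t : ℝ} (ht : 0 < t) (ht1 : t < 1)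
    (dec2 : (ℕ → Y) → W2) (hd2 : ∀ i y y', (∀ j < i, y j = y' j) → s2 i y → dec2 y = dec2 y') :
    Ex ch x1 x2 y0 L (fun w y => ind (dec2 y = w.2)) *
        Real.log (Fintype.card W2 / (Fintype.card A * Fintype.card B)) ≤
      (∑ i ∈ Finset.range L, ∑ w, f (bl i) w *
        (miNoQ2 ch (cl α (x1 i) (α w.1)) (cl β (x2 i) (β w.2)) + -Real.log (1 - t))) / Fintype.card (W1 × W2)
      + L * (η * Real.log (Fintype.card Y / t))
      + 0 * Ex ch x1 x2 y0 L (fun _ y => ∑ i ∈ Finset.range L, ind (¬ s1 i y ∧ s2 i y))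
      + (Cap2 ch + -Real.log (1 - t)) * Ex ch x1 x2 y0 L (fun _ y => ∑ i ∈ Finset.range L, ind (s1 i y ∧ ¬ s2 i y)) + 1 := by
  classical
  obtain ⟨q2, hq2, hq2p, hq2k⟩ := exists_q2 hch ht ht1
  have hA0 : 0 < Fintype.card A := Fintype.card_pos_iff.2 ⟨α (Classical.arbitrary W1)⟩
  have hB0 : 0 < Fintype.card B := Fintype.card_pos_iff.2 ⟨β (Classical.arbitrary W2)⟩
  have hW1 : 0 < Fintype.card W1 := Fintype.card_pos
  have hA0' : (0:ℝ) < Fintype.card A := by exact_mod_cast hA0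
  have hB0' : (0:ℝ) < Fintype.card B := by exact_mod_cast hB0
  have hW1' : (0:ℝ) < Fintype.card W1 := by exact_mod_cast hW1
  have pm : ∀ i b x, IsPMF (mix (cl β (x2 i) b) (ch x)) := fun i a y =>
    mix_pmf (cl_pmf _ _ _) fun _ => hch _ _
  have H := conv0 hch hs1 hs2 y0 L hg bl hf hf0 (fun w i => ch (x1 i w.1) (x2 i w.2))
    (fun w i => q2 (x1 i w.1))
    (fun _ b x _ i => sm t (mix (cl β (x2 i) b) (ch x)))
    (fun _ _ => hch _ _) (fun _ _ => hq2 _) (fun _ _ _ _ _ => sm_pmf ht ht1 (pm _ _ _))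
    (fun _ _ _ h => h) (fun _ _ _ _ => hq2p _ _) (fun _ _ _ _ _ _ => sm_pos' ht ht1 (pm _ _ _) _)
    (κ1 := 0) (κ2 := Cap2 ch + -Real.log (1 - t)) (τ := -Real.log (1-t))
    (Dm := Real.log (Fintype.card Y / t))
    (fun _ _ => kl_self_le _)
    (fun _ _ => by linarith [hq2k (x1 ‹_› (‹W1 × W2› : W1 × W2).1) (x2 ‹_› (‹W1 × W2› : W1 × W2).2)])
    (fun a b x y i => kl_sm_le ht ht1 (hch _ _) (pm _ _ _).1)
    (fun i a b => miNoQ2 ch (cl α (x1 i) a) (cl β (x2 i) b))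
    (fun i a b => by
      have := avg2 hch ht ht1 (cl_pmf α (x1 i) a) (cl_pmf β (x2 i) b)
      linarith)
    (fun w y => dec2 y = w.2) (Bd := Fintype.card (A × B × W1))
    (by simp only [Fintype.card_prod, Nat.cast_mul]; positivity)
    (by
      refine coreB (fun w => (α w.1, β w.2, w.1))
        (fun g => ph s1 s2 (fun i y => ch (x1 i g.2.2) (x2 i (dec2 y))) (fun i _ => q2 (x1 i g.2.2))
          (fun i y => ch (x1 i g.2.2) (x2 i (dec2 y)))
          (fun i _ => sm t (mix (cl β (x2 i) g.2.1) (ch (x1 i g.2.2)))))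
        ?_ y0 L _ ?_ ?_
      · intro g
        refine ker_ph hs1 hs2 (fun _ _ => hch _ _) (fun _ _ => hq2 _) (fun _ _ => hch _ _)
          (fun _ _ => sm_pmf ht ht1 (pm _ _ _)) ?_ (fun _ _ _ _ _ => rfl) ?_ (fun _ _ _ _ => rfl)
        · intro i y y' h _ h1; beta_reduce; rw [hd2 i y y' h h1]
        · intro i y y' h h1; beta_reduce; rw [hd2 i y y' h h1]
      · intro w y h i _
        simp only [ph, cK, h]
      · intro w w' y h h' hγ
        simp only [Prod.mk.injEq] at hγ
        exact Prod.ext hγ.2.2 (h.symm.trans h'))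
  refine le_trans (le_of_eq ?_) H
  congr 2
  simp only [Fintype.card_prod, Nat.cast_mul]
  field_simp

lemma conv12 {ch : X1 → X2 → Y → ℝ} (hch : ∀ a b, IsPMF (ch a b)) {x1 : ℕ → W1 → X1} {x2 : ℕ → W2 → X2}
    {s1 s2 : ℕ → (ℕ → Y) → Prop} (hs1 : ∀ i, Adp i (s1 i)) (hs2 : ∀ i, Adp i (s2 i))
    (y0 : ℕ → Y) (L : ℕ) {m : ℕ} {f : Fin m → W1 × W2 → ℝ} {η : ℝ} {α : W1 → A} {β : W2 → B}
    (hg : Good x1 x2 f η α β) (bl : ℕ → Fin m)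
    (hf : ∀ i < L, ∀ w, PS y0 L (fun y => Pr (cK ch x1 x2 w) L y * ind (¬ s1 i y ∧ ¬ s2 i y)) ≤ f (bl i) w)
    (hf0 : ∀ b w, 0 ≤ f b w) {t : ℝ} (ht : 0 < t) (ht1 : t < 1)
    (dec1 : (ℕ → Y) → W1) (hd1 : ∀ i y y', (∀ j < i, y j = y' j) → s1 i y → dec1 y = dec1 y')
    (dec2 : (ℕ → Y) → W2) (hd2 : ∀ i y y', (∀ j < i, y j = y' j) → s2 i y → dec2 y = dec2 y') :
    Ex ch x1 x2 y0 L (fun w y => ind (dec1 y = w.1 ∧ dec2 y = w.2)) *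
        Real.log (Fintype.card W1 * Fintype.card W2 / (Fintype.card A * Fintype.card B)) ≤
      (∑ i ∈ Finset.range L, ∑ w, f (bl i) w *
        (miNoQ12 ch (cl α (x1 i) (α w.1)) (cl β (x2 i) (β w.2)) + -Real.log (1 - t))) / Fintype.card (W1 × W2)
      + L * (η * Real.log (Fintype.card Y / t))
      + (Cap1 ch + -Real.log (1 - t)) * Ex ch x1 x2 y0 L (fun _ y => ∑ i ∈ Finset.range L, ind (¬ s1 i y ∧ s2 i y))
      + (Cap2 ch + -Real.log (1 - t)) * Ex ch x1 x2 y0 L (fun _ y => ∑ i ∈ Finset.range L, ind (s1 i y ∧ ¬ s2 i y)) + 1 := by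
  classical
  obtain ⟨q1, hq1, hq1p, hq1k⟩ := exists_q1 hch ht ht1
  obtain ⟨q2, hq2, hq2p, hq2k⟩ := exists_q2 hch ht ht1
  have hA0 : 0 < Fintype.card A := Fintype.card_pos_iff.2 ⟨α (Classical.arbitrary W1)⟩
  have hB0 : 0 < Fintype.card B := Fintype.card_pos_iff.2 ⟨β (Classical.arbitrary W2)⟩
  have hA0' : (0:ℝ) < Fintype.card A := by exact_mod_cast hA0
  have hB0' : (0:ℝ) < Fintype.card B := by exact_mod_cast hB0
  have pm : ∀ i a b, IsPMF (mix (prodP (cl α (x1 i) a) (cl β (x2 i) b)) (unc ch)) := fun i a y =>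
    mix_pmf (prodP_pmf (cl_pmf _ _ _) (cl_pmf _ _ _)) fun _ => hch _ _
  have H := conv0 hch hs1 hs2 y0 L hg bl hf hf0 (fun w i => q1 (x2 i w.2))
    (fun w i => q2 (x1 i w.1))
    (fun a b _ _ i => sm t (mix (prodP (cl α (x1 i) a) (cl β (x2 i) b)) (unc ch)))
    (fun _ _ => hq1 _) (fun _ _ => hq2 _) (fun _ _ _ _ _ => sm_pmf ht ht1 (pm _ _ _))
    (fun _ _ _ _ => hq1p _ _) (fun _ _ _ _ => hq2p _ _) (fun _ _ _ _ _ _ => sm_pos' ht ht1 (pm _ _ _) _)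
    (κ1 := Cap1 ch + -Real.log (1 - t)) (κ2 := Cap2 ch + -Real.log (1 - t)) (τ := -Real.log (1-t))
    (Dm := Real.log (Fintype.card Y / t))
    (fun _ _ => by linarith [hq1k (x1 ‹_› (‹W1 × W2› : W1 × W2).1) (x2 ‹_› (‹W1 × W2› : W1 × W2).2)])
    (fun _ _ => by linarith [hq2k (x1 ‹_› (‹W1 × W2› : W1 × W2).1) (x2 ‹_› (‹W1 × W2› : W1 × W2).2)])
    (fun a b x y i => kl_sm_le ht ht1 (hch _ _) (pm _ _ _).1)
    (fun i a b => miNoQ12 ch (cl α (x1 i) a) (cl β (x2 i) b))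
    (fun i a b => by
      have := avg12 hch ht ht1 (cl_pmf α (x1 i) a) (cl_pmf β (x2 i) b)
      linarith)
    (fun w y => dec1 y = w.1 ∧ dec2 y = w.2) (Bd := Fintype.card (A × B))
    (by simp only [Fintype.card_prod, Nat.cast_mul]; positivity)
    (by
      refine coreB (fun w => (α w.1, β w.2))
        (fun g => ph s1 s2 (fun i y => ch (x1 i (dec1 y)) (x2 i (dec2 y))) (fun i y => q2 (x1 i (dec1 y)))
          (fun i y => q1 (x2 i (dec2 y)))
          (fun i _ => sm t (mix (prodP (cl α (x1 i) g.1) (cl β (x2 i) g.2)) (unc ch))))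
        ?_ y0 L _ ?_ ?_
      · intro g
        refine ker_ph hs1 hs2 (fun _ _ => hch _ _) (fun _ _ => hq2 _) (fun _ _ => hq1 _)
          (fun _ _ => sm_pmf ht ht1 (pm _ _ _)) ?_ ?_ ?_ (fun _ _ _ _ => rfl)
        · intro i y y' h h1 h2; beta_reduce; rw [hd1 i y y' h h1, hd2 i y y' h h2]
        · intro i y y' h h1; beta_reduce; rw [hd1 i y y' h h1]
        · intro i y y' h h1; beta_reduce; rw [hd2 i y y' h h1]
      · intro w y h i _
        simp only [ph, cK, h.1, h.2]
      · intro w w' y h h' hγ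
        exact Prod.ext (h.1.symm.trans h'.1) (h.2.symm.trans h'.2))
  refine le_trans (le_of_eq ?_) H
  congr 2
  simp only [Fintype.card_prod, Nat.cast_mul]

end conv3
end OB

namespace OB

section meas

lemma nullMeas_cells {Ω ι : Type} [MeasurableSpace Ω] [Fintype ι] (P : Measure Ω) [IsProbabilityMeasure P]
    (Z : Ω → ι) (h : ∑ i, P (Z ⁻¹' {i}) = 1) (i : ι) : NullMeasurableSet (Z ⁻¹' {i}) P := by
  classical
  set T := toMeasurable P (Z ⁻¹' {i})
  set U := toMeasurable P (⋃ j ∈ Finset.univ.erase i, Z ⁻¹' {j})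
  have hT : Z ⁻¹' {i} ⊆ T := subset_toMeasurable _ _
  have hU : (⋃ j ∈ Finset.univ.erase i, Z ⁻¹' {j}) ⊆ U := subset_toMeasurable _ _
  have hTm : MeasurableSet T := measurableSet_toMeasurable _ _
  have hUm : MeasurableSet U := measurableSet_toMeasurable _ _
  have hcov : T ∪ U = Set.univ := by
    refine Set.eq_univ_of_forall fun ω => ?_
    by_cases hω : Z ω = i
    · exact Or.inl (hT hω)
    · exact Or.inr (hU (by simpa using hω))
  have h1 : P T + P U ≤ 1 := by
    rw [measure_toMeasurable, measure_toMeasurable, ← h, ← Finset.add_sum_erase _ _ (Finset.mem_univ i)]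
    gcongr
    exact measure_biUnion_finset_le _ _
  have h2 := measure_union_add_inter T hUm (μ := P)
  rw [hcov, measure_univ] at h2
  have h3 : P (T ∩ U) = 0 := by
    have : 1 + P (T ∩ U) ≤ 1 + 0 := by rw [h2, add_zero]; exact h1
    have := (ENNReal.add_le_add_iff_left ENNReal.one_ne_top).1 this
    exact le_antisymm this (zero_le)
  refine NullMeasurableSet.congr hTm.nullMeasurableSet ?_
  refine (ae_eq_set.2 ⟨?_, ?_⟩)
  · refine measure_mono_null ?_ h3
    rintro ω ⟨a, b⟩
    refine ⟨a, hU ?_⟩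
    simpa using b
  · rw [Set.diff_eq_empty.2 hT]; simp

variable {Y : Type} [Fintype Y]

lemma PS_delta (y0 : ℕ → Y) (L : ℕ) {G : (ℕ → Y) → ℝ} (hG : Adp L G) (z : ℕ → Y) :
    PS y0 L (fun y => G y * ind (∀ i < L, z i = y i)) = G z := by
  classical
  induction L generalizing G with
  | zero => simp [PS, ind]; exact hG _ _ (by simp)
  | succ L ih =>
    have e : ∀ y : ℕ → Y, ∑ a, G (Function.update y L a) * ind (∀ i < L + 1, z i = Function.update y L a i) =
        G (Function.update y L (z L)) * ind (∀ i < L, z i = y i) := by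
      intro y
      rw [Finset.sum_eq_single (z L)]
      · congr 1
        unfold ind
        congr 1
        apply propext
        constructor
        · intro h i hi; have := h i (by omega); rwa [Function.update_of_ne (by omega)] at this
        · intro h i hi
          by_cases hiL : i = L
          · subst hiL; simp
          · rw [Function.update_of_ne hiL]; exact h i (by omega)
      · intro a _ ha
        have : ¬ (∀ i < L + 1, z i = Function.update y L a i) := by
          intro h; have := h L (by omega); simp at this; exact ha this.symm
        unfold ind; rw [if_neg this, mul_zero]
      · simp
    simp only [PS, e]
    rw [ih (G := fun y => G (Function.update y L (z L)))]
    · simp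
    · intro y y' h
      refine hG _ _ fun j hj => ?_
      by_cases hjL : j = L
      · subst hjL; simp
      · rw [Function.update_of_ne hjL, Function.update_of_ne hjL]; exact h j (by omega)

lemma integral_PS {Ω : Type} [MeasurableSpace Ω] (P : Measure Ω) (y0 : ℕ → Y) (L : ℕ)
    (h : (ℕ → Y) → Ω → ℝ) (hi : ∀ y, Integrable (h y) P) :
    Integrable (fun ω => PS y0 L (fun y => h y ω)) P ∧
      ∫ ω, PS y0 L (fun y => h y ω) ∂P = PS y0 L (fun y => ∫ ω, h y ω ∂P) := by
  induction L generalizing h with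
  | zero => exact ⟨hi _, rfl⟩
  | succ L ih =>
    have hi' : ∀ y, Integrable (fun ω => ∑ a, h (Function.update y L a) ω) P := fun y =>
      integrable_finset_sum _ fun a _ => hi _
    obtain ⟨a, b⟩ := ih (fun y ω => ∑ a, h (Function.update y L a) ω) hi'
    refine ⟨a, ?_⟩
    simp only [PS]
    rw [b]
    congr 1
    funext y
    exact integral_finset_sum _ fun a _ => hi _

variable {X1 X2 : Type} [Fintype X1] [Fintype X2]

lemma meas_link {Ω : Type} [MeasurableSpace Ω] (P : Measure Ω) [IsProbabilityMeasure P]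
    {ch : X1 → X2 → Y → ℝ} (hch : ∀ a b, IsPMF (ch a b))
    {M₁ M₂ : ℕ} (hM1 : 0 < M₁) (hM2 : 0 < M₂) {W₁ : Ω → Fin M₁} {W₂ : Ω → Fin M₂}
    {x1 : ℕ → Fin M₁ → X1} {x2 : ℕ → Fin M₂ → X2} {V : ℕ → Ω → Y}
    (hlaw : ∀ (w₁ : Fin M₁) (w₂ : Fin M₂) (n : ℕ) (y : ℕ → Y),
          P {ω | W₁ ω = w₁ ∧ W₂ ω = w₂ ∧ ∀ i < n, V i ω = y i} =
            ENNReal.ofReal ((1 / ((M₁ : ℝ) * (M₂ : ℝ))) *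
              ∏ i ∈ Finset.range n, ch (x1 i w₁) (x2 i w₂) (y i)))
    (y0 : ℕ → Y) (L : ℕ) (F : Fin M₁ × Fin M₂ → (ℕ → Y) → ℝ) (hF : ∀ w, Adp L (F w)) :
    Integrable (fun ω => F (W₁ ω, W₂ ω) (fun i => V i ω)) P ∧
    ∫ ω, F (W₁ ω, W₂ ω) (fun i => V i ω) ∂P = Ex ch x1 x2 y0 L F := by
  classical
  have hM1' : (0:ℝ) < M₁ := by exact_mod_cast hM1
  have hM2' : (0:ℝ) < M₂ := by exact_mod_cast hM2
  set cell : Fin M₁ × Fin M₂ → (ℕ → Y) → Set Ω := fun w y =>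
    {ω | W₁ ω = w.1 ∧ W₂ ω = w.2 ∧ ∀ i < L, V i ω = y i} with hcell
  have hnull : ∀ w y, NullMeasurableSet (cell w y) P := by
    intro w y
    set Z : Ω → (Fin M₁ × Fin M₂) × (Fin L → Y) := fun ω => ((W₁ ω, W₂ ω), fun i => V i ω)
    have hZ : ∀ (w : Fin M₁ × Fin M₂) (y : ℕ → Y), Z ⁻¹' {(w, fun i : Fin L => y i)} = cell w y := by
      intro w y
      ext ω
      simp only [Z, hcell, Set.mem_preimage, Set.mem_singleton_iff, Set.mem_ofPred_eq, Prod.ext_iff, funext_iff]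
      constructor
      · rintro ⟨⟨a, b⟩, c⟩; exact ⟨a, b, fun i hi => c ⟨i, hi⟩⟩
      · rintro ⟨a, b, c⟩; exact ⟨⟨a, b⟩, fun i => c i i.2⟩
    rw [← hZ]
    refine nullMeas_cells P Z ?_ _
    have e : ∀ z : (Fin M₁ × Fin M₂) × (Fin L → Y), P (Z ⁻¹' {z}) =
       ENNReal.ofReal ((1 / ((M₁ : ℝ) * (M₂ : ℝ))) * ∏ i : Fin L, ch (x1 i z.1.1) (x2 i z.1.2) (z.2 i)) := by
      intro z
      have h1 := hZ z.1 (fun i => if h : i < L then z.2 ⟨i, h⟩ else y0 i)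
      have h2 : (z.1, fun i : Fin L => (fun i => if h : i < L then z.2 ⟨i, h⟩ else y0 i) (i:ℕ)) = z := by
        refine Prod.ext rfl ?_
        funext i; simp
      rw [h2] at h1
      rw [h1, hcell]
      refine (hlaw _ _ _ _).trans ?_
      congr 2
      rw [Finset.prod_range]
      refine Finset.prod_congr rfl fun i _ => ?_
      simp
    simp_rw [e]
    have nn : ∀ z : (Fin M₁ × Fin M₂) × (Fin L → Y), 0 ≤ (1 / ((M₁ : ℝ) * (M₂ : ℝ))) * ∏ i : Fin L, ch (x1 i z.1.1) (x2 i z.1.2) (z.2 i) :=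
      fun z => mul_nonneg (by positivity) (Finset.prod_nonneg fun i _ => (hch _ _).1 _)
    rw [← ENNReal.ofReal_sum_of_nonneg fun z _ => nn z, ← Finset.mul_sum, Fintype.sum_prod_type]
    have e3 : ∀ w : Fin M₁ × Fin M₂, ∑ y : Fin L → Y, ∏ i : Fin L, ch (x1 i w.1) (x2 i w.2) (y i) = 1 := by
      intro w
      have := (Finset.prod_univ_sum (fun _ : Fin L => (Finset.univ : Finset Y)) (fun i a => ch (x1 i w.1) (x2 i w.2) a)).symm
      rw [Fintype.piFinset_univ] at this
      rw [this]
      exact Finset.prod_eq_one fun i _ => (hch _ _).2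
    simp_rw [e3]
    simp
    field_simp
  have hreal : ∀ w y, P.real (cell w y) = 1 / ((M₁ : ℝ) * (M₂ : ℝ)) * Pr (cK ch x1 x2 w) L y := by
    intro w y
    rw [Measure.real, hcell]
    beta_reduce
    rw [hlaw, ENNReal.toReal_ofReal]
    · rfl
    · exact mul_nonneg (by positivity) (Finset.prod_nonneg fun i _ => (hch _ _).1 _)
  have hind : ∀ w y, (fun ω => F w y * ind (W₁ ω = w.1 ∧ W₂ ω = w.2 ∧ ∀ i < L, V i ω = y i)) =
      fun ω => F w y * (cell w y).indicator (fun _ => (1:ℝ)) ω := by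
    intro w y; funext ω
    unfold ind Set.indicator
    simp only [hcell, Set.mem_ofPred_eq]
    congr
  have hint : ∀ w y, Integrable (fun ω => F w y * ind (W₁ ω = w.1 ∧ W₂ ω = w.2 ∧ ∀ i < L, V i ω = y i)) P := by
    intro w y
    rw [hind]
    exact ((integrable_const (1:ℝ)).indicator₀ (hnull w y)).const_mul _
  have hval : ∀ w y, ∫ ω, F w y * ind (W₁ ω = w.1 ∧ W₂ ω = w.2 ∧ ∀ i < L, V i ω = y i) ∂P =
      1 / ((M₁ : ℝ) * (M₂ : ℝ)) * (Pr (cK ch x1 x2 w) L y * F w y) := by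
    intro w y
    rw [hind, integral_const_mul, integral_indicator₀ (hnull w y)]
    simp only [integral_const, smul_eq_mul, mul_one]
    rw [measureReal_restrict_apply_univ, hreal]; ring
  have pt : (fun ω => F (W₁ ω, W₂ ω) (fun i => V i ω)) = fun ω => ∑ w, PS y0 L (fun y =>
      F w y * ind (W₁ ω = w.1 ∧ W₂ ω = w.2 ∧ ∀ i < L, V i ω = y i)) := by
    funext ω
    rw [Finset.sum_eq_single (W₁ ω, W₂ ω)]
    · rw [← PS_delta y0 L (hF (W₁ ω, W₂ ω)) (fun i => V i ω)]
      simp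
    · intro w _ hw
      have : ∀ y : ℕ → Y, ¬ (W₁ ω = w.1 ∧ W₂ ω = w.2 ∧ ∀ i < L, V i ω = y i) := by
        rintro y ⟨a, b, _⟩; exact hw (Prod.ext a.symm b.symm)
      simp [ind, this, PS_zero]
    · simp
  rw [pt]
  refine ⟨integrable_finset_sum _ fun w _ => (integral_PS P y0 L _ (hint w)).1, ?_⟩
  rw [integral_finset_sum _ fun w _ => (integral_PS P y0 L _ (hint w)).1]
  unfold Ex
  rw [Finset.sum_div]
  refine Finset.sum_congr rfl fun w _ => ?_
  rw [(integral_PS P y0 L _ (hint w)).2]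
  simp_rw [hval]
  rw [PS_mul]
  simp only [Fintype.card_prod, Fintype.card_fin, Nat.cast_mul]
  ring

end meas
end OB

namespace OB

section stp

def st {Ω Y : Type} (V : ℕ → Ω → Y) (N : Ω → ℕ) (i : ℕ) (y : ℕ → Y) : Prop :=
  ∃ ω, N ω ≤ i ∧ ∀ j < N ω, V j ω = y j

variable {Ω Y W : Type} {V : ℕ → Ω → Y} {N : Ω → ℕ}

lemma st_adp (i : ℕ) : Adp i (st V N i) := by
  have : ∀ y y' : ℕ → Y, (∀ j < i, y j = y' j) → st V N i y → st V N i y' := by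
    rintro y y' h ⟨ω, h1, h2⟩
    exact ⟨ω, h1, fun j hj => (h2 j hj).trans (h j (by omega))⟩
  intro y y' h
  exact propext ⟨this y y' h, this y' y fun j hj => (h j hj).symm⟩

lemma st_mono {i i' : ℕ} (h : i ≤ i') {y : ℕ → Y} : st V N i y → st V N i' y := by
  rintro ⟨ω, h1, h2⟩
  exact ⟨ω, h1.trans h, h2⟩

lemma stop_eq (hN : ∀ (n : ℕ) (ω ω' : Ω), (∀ i < n, V i ω = V i ω') → N ω = n → N ω' = n)
    {ω ω' : Ω} {y : ℕ → Y} (h : ∀ j < N ω, V j ω = y j) (h' : ∀ j < N ω', V j ω' = y j) : N ω = N ω' := by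
  rcases le_total (N ω) (N ω') with hl | hl
  · exact (hN (N ω) ω ω' (fun i hi => (h i hi).trans (h' i (by omega)).symm) rfl).symm
  · exact hN (N ω') ω' ω (fun i hi => (h' i hi).trans (h i (by omega)).symm) rfl

lemma st_iff (hN : ∀ (n : ℕ) (ω ω' : Ω), (∀ i < n, V i ω = V i ω') → N ω = n → N ω' = n)
    (i : ℕ) (ω : Ω) : st V N i (fun j => V j ω) ↔ N ω ≤ i := by
  constructor
  · rintro ⟨ω', h1, h2⟩
    rw [stop_eq hN (ω := ω) (ω' := ω') (y := fun j => V j ω) (fun _ _ => rfl) h2]; exact h1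
  · intro h; exact ⟨ω, h, fun _ _ => rfl⟩

open Classical in
def dc (V : ℕ → Ω → Y) (N : Ω → ℕ) (g : (ℕ → Option Y) → W) (y : ℕ → Y) : W :=
  if h : ∃ ω, ∀ j < N ω, V j ω = y j then g (Yprefix V N h.choose) else g (fun _ => none)

lemma dc_eq (hN : ∀ (n : ℕ) (ω ω' : Ω), (∀ i < n, V i ω = V i ω') → N ω = n → N ω' = n)
    (g : (ℕ → Option Y) → W) {ω : Ω} {y : ℕ → Y} (h : ∀ j < N ω, V j ω = y j) :
    dc V N g y = g (Yprefix V N ω) := by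
  have hx : ∃ ω, ∀ j < N ω, V j ω = y j := ⟨ω, h⟩
  unfold dc
  rw [dif_pos hx]
  congr 1
  have h' := hx.choose_spec
  have e := stop_eq hN h h'
  funext i
  unfold Yprefix
  rw [← e]
  split_ifs with hi
  · rw [h i hi, h' i (by omega)]
  · rfl

open Classical in
def dL (V : ℕ → Ω → Y) (N : Ω → ℕ) (g : (ℕ → Option Y) → W) (L : ℕ) (y : ℕ → Y) : W :=
  if st V N L y then dc V N g y else g (fun _ => none)

lemma dc_adp (hN : ∀ (n : ℕ) (ω ω' : Ω), (∀ i < n, V i ω = V i ω') → N ω = n → N ω' = n)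
    (g : (ℕ → Option Y) → W) {i : ℕ} {y y' : ℕ → Y} (hy : ∀ j < i, y j = y' j) (h : st V N i y) :
    dc V N g y = dc V N g y' := by
  obtain ⟨ω, h1, h2⟩ := h
  rw [dc_eq hN g h2, dc_eq hN g (ω := ω) (y := y') fun j hj => (h2 j hj).trans (hy j (by omega))]

lemma dL_adp (hN : ∀ (n : ℕ) (ω ω' : Ω), (∀ i < n, V i ω = V i ω') → N ω = n → N ω' = n)
    (g : (ℕ → Option Y) → W) (L : ℕ) : Adp L (dL V N g L) := by
  intro y y' h
  unfold dL
  rw [← st_adp L y y' h]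
  split_ifs with hs
  · exact dc_adp hN g h hs
  · rfl

lemma dL_adp' (hN : ∀ (n : ℕ) (ω ω' : Ω), (∀ i < n, V i ω = V i ω') → N ω = n → N ω' = n)
    (g : (ℕ → Option Y) → W) (L : ℕ) (i : ℕ) (y y' : ℕ → Y) (h : ∀ j < i, y j = y' j) (hs : st V N i y) :
    dL V N g L y = dL V N g L y' := by
  rcases le_total i L with hl | hl
  · have h2 : st V N i y' := by rw [← st_adp i y y' h]; exact hs
    unfold dL
    rw [if_pos (st_mono hl hs), if_pos (st_mono hl h2)]
    exact dc_adp hN g h hs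
  · exact (dL_adp hN g L).mono hl y y' h

lemma dL_at (hN : ∀ (n : ℕ) (ω ω' : Ω), (∀ i < n, V i ω = V i ω') → N ω = n → N ω' = n)
    (g : (ℕ → Option Y) → W) {L : ℕ} {ω : Ω} (h : N ω ≤ L) :
    dL V N g L (fun j => V j ω) = g (Yprefix V N ω) := by
  unfold dL
  rw [if_pos ((st_iff hN L ω).2 h), dc_eq hN g fun _ _ => rfl]

end stp

lemma sum_ind_le (L : ℕ) (p : ℕ → Prop) (S : Finset ℕ) (h : ∀ i, p i → i ∈ S) :
    ∑ i ∈ Finset.range L, ind (p i) ≤ S.card := by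
  classical
  unfold ind
  rw [Finset.sum_ite]
  simp only [Finset.sum_const, nsmul_eq_mul, mul_one, mul_zero, add_zero]
  exact_mod_cast Finset.card_le_card fun i hi => h i (Finset.mem_filter.1 hi).2

lemma cnt1 (L a b : ℕ) : ∑ i ∈ Finset.range L, ind (¬ a ≤ i ∧ b ≤ i) ≤ (a : ℝ) - ((min a b : ℕ) : ℝ) := by
  refine (sum_ind_le L _ (Finset.Ico (min a b) a) fun i hi => ?_).trans (le_of_eq ?_)
  · simp; omega
  · rw [Nat.card_Ico, Nat.cast_sub (min_le_left _ _)]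

lemma ind_mono {p q : Prop} (h : p → q) : ind p ≤ ind q := by
  unfold ind; split_ifs <;> simp_all

lemma ind_true {p : Prop} (h : p) : ind p = 1 := by unfold ind; simp [h]

section ex
variable {X1 X2 Y W1 W2 : Type} [Fintype X1] [Fintype X2] [Fintype Y] [Fintype W1] [Fintype W2]

omit [Fintype X1] [Fintype X2] in
lemma Ex_mono {ch : X1 → X2 → Y → ℝ} (hch : ∀ a b, IsPMF (ch a b)) {x1 : ℕ → W1 → X1} {x2 : ℕ → W2 → X2}
    (y0 : ℕ → Y) (L : ℕ) {F G : W1 × W2 → (ℕ → Y) → ℝ} (h : ∀ w y, F w y ≤ G w y) :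
    Ex ch x1 x2 y0 L F ≤ Ex ch x1 x2 y0 L G := by
  unfold Ex
  gcongr with w hw
  exact PS_mono y0 L fun y => mul_le_mul_of_nonneg_left (h w y) (Pr_nonneg (cK_ker hch x1 x2 w) L y)

omit [Fintype X1] [Fintype X2] in
lemma Ex_one [Nonempty W1] [Nonempty W2] {ch : X1 → X2 → Y → ℝ} (hch : ∀ a b, IsPMF (ch a b)) {x1 : ℕ → W1 → X1} {x2 : ℕ → W2 → X2}
    (y0 : ℕ → Y) (L : ℕ) :
    Ex ch x1 x2 y0 L (fun _ _ => 1) = 1 := by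
  unfold Ex
  have hM : (0:ℝ) < Fintype.card (W1 × W2) := by exact_mod_cast Fintype.card_pos
  simp only [mul_one]
  rw [Finset.sum_congr rfl fun w _ => PS_Pr (cK_ker hch x1 x2 w) y0 L]
  rw [Finset.sum_const, Finset.card_univ, nsmul_eq_mul, mul_one, div_self hM.ne']
end ex

end OB

namespace OB

section code

lemma mixt {W : Type} [Fintype W] {M : ℝ} (hM : 0 < M) (L : ℕ) (f : ℕ → W → ℝ) {nP : ℝ}
    (hn : 0 < nP) (τ : ℝ) (hP : (∑ i ∈ Finset.range L, ∑ w, f i w) / M = nP) (J : ℕ → W → ℝ) :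
    (∑ i ∈ Finset.range L, ∑ w, f i w * (J i w + τ)) / M =
      nP * ((∑ k : Fin L × W, f k.1 k.2 / (M * nP) * J k.1 k.2) + τ) := by
  have e1 : ∑ k : Fin L × W, f k.1 k.2 / (M * nP) * J k.1 k.2 =
      (∑ i ∈ Finset.range L, ∑ w, f i w * J i w) / (M * nP) := by
    rw [Fintype.sum_prod_type, Finset.sum_range, Finset.sum_div]
    refine Finset.sum_congr rfl fun i _ => ?_
    rw [Finset.sum_div]
    exact Finset.sum_congr rfl fun w _ => by ring
  have e2 : ∑ i ∈ Finset.range L, ∑ w, f i w * (J i w + τ) =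
      (∑ i ∈ Finset.range L, ∑ w, f i w * J i w) + (∑ i ∈ Finset.range L, ∑ w, f i w) * τ := by
    simp only [mul_add, Finset.sum_add_distrib, ← Finset.sum_mul]
  rw [e1, e2]
  have hP' : (∑ i ∈ Finset.range L, ∑ w, f i w) = nP * M := by
    rw [← hP]; field_simp
  rw [hP']
  field_simp

variable {X1 X2 Y : Type} [Fintype X1] [Fintype X2] [Fintype Y] [Nonempty X1] [Nonempty X2]

lemma code_lemma {ch : X1 → X2 → Y → ℝ} (hch : ∀ a b, IsPMF (ch a b)) (y0 : ℕ → Y)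
    {Ω : Type} [MeasurableSpace Ω] (P : Measure Ω) [IsProbabilityMeasure P]
    {M₁ M₂ : ℕ} (hM1 : 0 < M₁) (hM2 : 0 < M₂) {W₁ : Ω → Fin M₁} {W₂ : Ω → Fin M₂}
    {x1 : ℕ → Fin M₁ → X1} {x2 : ℕ → Fin M₂ → X2} {V : ℕ → Ω → Y}
    (hlaw : ∀ (w₁ : Fin M₁) (w₂ : Fin M₂) (n : ℕ) (y : ℕ → Y),
          P {ω | W₁ ω = w₁ ∧ W₂ ω = w₂ ∧ ∀ i < n, V i ω = y i} =
            ENNReal.ofReal ((1 / ((M₁ : ℝ) * (M₂ : ℝ))) *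
              ∏ i ∈ Finset.range n, ch (x1 i w₁) (x2 i w₂) (y i)))
    {N₁ N₂ : Ω → ℕ}
    (hN1 : ∀ (n : ℕ) (ω ω' : Ω), (∀ i < n, V i ω = V i ω') → N₁ ω = n → N₁ ω' = n)
    (hN2 : ∀ (n : ℕ) (ω ω' : Ω), (∀ i < n, V i ω = V i ω') → N₂ ω = n → N₂ ω' = n)
    (hI1 : Integrable (fun ω => (N₁ ω : ℝ)) P) (hI2 : Integrable (fun ω => (N₂ ω : ℝ)) P)
    {EN₁ EN₂ EN : ℝ} (hE1 : EN₁ = ∫ ω, (N₁ ω : ℝ) ∂P) (hE2 : EN₂ = ∫ ω, (N₂ ω : ℝ) ∂P)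
    (hE : EN = ∫ ω, ((min (N₁ ω) (N₂ ω) : ℕ) : ℝ) ∂P)
    (g₁ : (ℕ → Option Y) → Fin M₁) (g₂ : (ℕ → Option Y) → Fin M₂) {ε : ℝ} (hε : 0 < ε)
    (herr : P {ω | g₁ (Yprefix V N₁ ω) ≠ W₁ ω ∨ g₂ (Yprefix V N₂ ω) ≠ W₂ ω} < ENNReal.ofReal ε)
    {m l k : ℕ} (hm : 0 < m) (hl : 0 < l) {t η : ℝ} (ht : 0 < t) (ht1 : t < 1) (hη : 0 < η)
    (hk : (m : ℝ) < k * η ^ 2) {ρ : ℝ} (hρ : ε + (EN₁ + EN₂) / ((m * l : ℕ) : ℝ) ≤ ρ) :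
    ∃ (K : Type) (_ : Fintype K) (w : K → ℝ) (π₁ : K → X1 → ℝ)
      (π₂ : K → X2 → ℝ) (nP : ℝ), IsPMF w ∧ (∀ k, IsPMF (π₁ k)) ∧ (∀ k, IsPMF (π₂ k)) ∧
      0 < nP ∧ nP ≤ EN + l ∧ 0 ≤ EN ∧ EN ≤ EN₁ ∧ EN ≤ EN₂ ∧ 
      (1 - ρ) * Real.log M₁ ≤ nP * ((∑ k, w k * miNoQ1 ch (π₁ k) (π₂ k)) + -Real.log (1 - t))
        + ((m * l : ℕ) : ℝ) * (η * Real.log (Fintype.card Y / t))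
        + (Cap1 ch + -Real.log (1 - t)) * (EN₁ - EN) + 1
        + k * Real.log (Fintype.card X1 * Fintype.card X2) ∧
      (1 - ρ) * Real.log M₂ ≤ nP * ((∑ k, w k * miNoQ2 ch (π₁ k) (π₂ k)) + -Real.log (1 - t))
        + ((m * l : ℕ) : ℝ) * (η * Real.log (Fintype.card Y / t))
        + (Cap2 ch + -Real.log (1 - t)) * (EN₂ - EN) + 1
        + k * Real.log (Fintype.card X1 * Fintype.card X2) ∧
      (1 - ρ) * (Real.log M₁ + Real.log M₂) ≤
        nP * ((∑ k, w k * miNoQ12 ch (π₁ k) (π₂ k)) + -Real.log (1 - t))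
        + ((m * l : ℕ) : ℝ) * (η * Real.log (Fintype.card Y / t))
        + (Cap1 ch + -Real.log (1 - t)) * (EN₁ - EN)
        + (Cap2 ch + -Real.log (1 - t)) * (EN₂ - EN) + 1
        + k * Real.log (Fintype.card X1 * Fintype.card X2) := by
  classical
  haveI : Nonempty (Fin M₁) := ⟨⟨0, hM1⟩⟩
  haveI : Nonempty (Fin M₂) := ⟨⟨0, hM2⟩⟩
  obtain ⟨L, hL⟩ : ∃ L, L = m * l := ⟨_, rfl⟩
  have hL0 : 0 < L := by rw [hL]; positivity
  have hL0' : (0:ℝ) < L := by exact_mod_cast hL0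
  rw [← hL] at hρ ⊢
  have hMM : (0:ℝ) < Fintype.card (Fin M₁ × Fin M₂) := by exact_mod_cast Fintype.card_pos
  have hτ : 0 ≤ -Real.log (1 - t) := by
    have := Real.log_nonpos (x := 1 - t) (by linarith) (by linarith); linarith
  have hC1 : 0 ≤ Cap1 ch := Cap1_nonneg hch
  have hC2 : 0 ≤ Cap2 ch := by rw [Cap2_eq]; exact Cap1_nonneg (ch := sw ch) fun a b => hch b a
  generalize hτe : -Real.log (1 - t) = τ at *
  -- integrability of the minimum
  have hIm : Integrable (fun ω => ((min (N₁ ω) (N₂ ω) : ℕ) : ℝ)) P := by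
    have := hI1.inf hI2
    refine this.congr (Filter.Eventually.of_forall fun ω => ?_)
    simp
  have hEN0 : 0 ≤ EN := by rw [hE]; exact integral_nonneg fun ω => by positivity
  have hEN1 : EN ≤ EN₁ := by
    rw [hE, hE1]; exact integral_mono hIm hI1 fun ω => by simp
  have hEN2 : EN ≤ EN₂ := by
    rw [hE, hE2]; exact integral_mono hIm hI2 fun ω => by simp
  set s1 := st V N₁ with hs1d
  set s2 := st V N₂ with hs2d
  have hs1 : ∀ i, Adp i (s1 i) := fun i => st_adp i
  have hs2 : ∀ i, Adp i (s2 i) := fun i => st_adp i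
  let Fb : ℕ → (ℕ → Y) → ℝ := fun b y => ind (b = 0 ∨ (¬ s1 (b * l) y ∧ ¬ s2 (b * l) y))
  have hFb : ∀ b ≤ m, Adp L (Fb b) := by
    intro b hb y y' h
    have hbl : b * l ≤ L := by rw [hL]; exact Nat.mul_le_mul_right _ hb
    simp only [Fb]
    rw [(hs1 (b*l)).mono hbl y y' h, (hs2 (b*l)).mono hbl y y' h]
  let f : Fin m → Fin M₁ × Fin M₂ → ℝ := fun b w => PS y0 L (fun y => Pr (cK ch x1 x2 w) L y * Fb b y)
  have hPr : ∀ w y, 0 ≤ Pr (cK ch x1 x2 w) L y := fun w y => Pr_nonneg (cK_ker hch x1 x2 w) L y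
  have hf0 : ∀ b w, 0 ≤ f b w := fun b w => PS_nonneg y0 L fun y => mul_nonneg (hPr w y) (ind_nonneg _)
  have hf1 : ∀ b w, f b w ≤ 1 := fun b w => by
    rw [← PS_Pr (cK_ker hch x1 x2 w) y0 L]
    refine PS_mono y0 L fun y => ?_
    exact mul_le_of_le_one_right (hPr w y) (ind_le_one _)
  let bl : ℕ → Fin m := fun i => ⟨(i / l) % m, Nat.mod_lt _ hm⟩
  have hbl : ∀ i < L, ((bl i : Fin m) : ℕ) = i / l := fun i hi => by
    refine Nat.mod_eq_of_lt ?_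
    rw [Nat.div_lt_iff_lt_mul hl, ← hL]; exact hi
  have hf : ∀ i < L, ∀ w, PS y0 L (fun y => Pr (cK ch x1 x2 w) L y * ind (¬ s1 i y ∧ ¬ s2 i y)) ≤ f (bl i) w := by
    intro i hi w
    refine PS_mono y0 L fun y => mul_le_mul_of_nonneg_left (ind_mono ?_) (hPr w y)
    rintro ⟨h1, h2⟩
    right
    rw [hbl i hi]
    have : i / l * l ≤ i := Nat.div_mul_le_self i l
    exact ⟨fun h => h1 (st_mono this h), fun h => h2 (st_mono this h)⟩
  obtain ⟨A, B, iA, iB, α, β, hcard, hg⟩ := regularity x1 x2 hf0 hf1 hη hk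
  have hA0 : 0 < Fintype.card A := Fintype.card_pos_iff.2 ⟨α (Classical.arbitrary _)⟩
  have hB0 : 0 < Fintype.card B := Fintype.card_pos_iff.2 ⟨β (Classical.arbitrary _)⟩
  have hA0' : (0:ℝ) < Fintype.card A := by exact_mod_cast hA0
  have hB0' : (0:ℝ) < Fintype.card B := by exact_mod_cast hB0
  have hK : Real.log (Fintype.card A * Fintype.card B) ≤ k * Real.log (Fintype.card X1 * Fintype.card X2) := by
    rw [← Real.log_pow]
    exact Real.log_le_log (by positivity) (by exact_mod_cast hcard)
  have hK0 : 0 ≤ Real.log ((Fintype.card A : ℝ) * Fintype.card B) := by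
    apply Real.log_nonneg
    exact_mod_cast Nat.mul_pos hA0 hB0
  -- nP
  obtain ⟨nP, hnP⟩ : ∃ nP, (∑ i ∈ Finset.range L, ∑ w, f (bl i) w) / Fintype.card (Fin M₁ × Fin M₂) = nP := ⟨_, rfl⟩
  have hnPE : nP = Ex ch x1 x2 y0 L (fun _ y => ∑ i ∈ Finset.range L, Fb (bl i) y) := by
    rw [← hnP]; unfold Ex
    congr 1
    rw [Finset.sum_comm]
    refine Finset.sum_congr rfl fun w _ => ?_
    simp only [f, Finset.mul_sum]
    rw [PS_sum]
  have hnP0 : 0 < nP := by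
    rw [← hnP]
    refine div_pos ?_ hMM
    refine Finset.sum_pos' (fun i _ => Finset.sum_nonneg fun w _ => hf0 _ _) ⟨0, Finset.mem_range.2 hL0, ?_⟩
    refine Finset.sum_pos (fun w _ => ?_) Finset.univ_nonempty
    have : f (bl 0) w = 1 := by
      rw [← PS_Pr (cK_ker hch x1 x2 w) y0 L]
      have hb : ((bl 0 : Fin m) : ℕ) = 0 := by rw [hbl 0 hL0]; simp
      simp only [f, Fb]
      congr 1; funext y
      rw [ind_true (Or.inl hb), mul_one]
    rw [this]; exact one_pos
  have hnPle : nP ≤ EN + l := by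
    have ml := meas_link P hch hM1 hM2 hlaw y0 L (fun _ y => ∑ i ∈ Finset.range L, Fb (bl i) y)
      (fun w y y' h => Finset.sum_congr rfl fun i _ => hFb _ (bl i).2.le y y' h)
    rw [hnPE, ← ml.2]
    have : EN + l = ∫ ω, (((min (N₁ ω) (N₂ ω) : ℕ) : ℝ) + l) ∂P := by
      rw [integral_add hIm (integrable_const _), ← hE]; simp
    rw [this]
    refine integral_mono ml.1 (hIm.add (integrable_const _)) fun ω => ?_
    have h1 : ∑ i ∈ Finset.range L, Fb (bl i) (fun i => V i ω) ≤
        ∑ i ∈ Finset.range L, ind (i < min (N₁ ω) (N₂ ω) + l) := by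
      refine Finset.sum_le_sum fun i hi => ind_mono ?_
      rw [hbl i (Finset.mem_range.1 hi), hs1d, hs2d, st_iff hN1, st_iff hN2]
      have h3 : i < (i / l) * l + l := by
        have := Nat.lt_div_mul_add (a := i) hl; exact this
      rintro (h | ⟨h, h'⟩)
      · rw [h] at h3; omega
      · omega
    refine h1.trans ((sum_ind_le L _ (Finset.range (min (N₁ ω) (N₂ ω) + l)) fun i hi => Finset.mem_range.2 hi).trans ?_)
    simp
  -- waiting terms
  have hw1 : Ex ch x1 x2 y0 L (fun _ y => ∑ i ∈ Finset.range L, ind (¬ s1 i y ∧ s2 i y)) ≤ EN₁ - EN := by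
    have ml := meas_link P hch hM1 hM2 hlaw y0 L (fun _ y => ∑ i ∈ Finset.range L, ind (¬ s1 i y ∧ s2 i y))
      (fun w y y' h => Finset.sum_congr rfl fun i hi => by
        have hi := (Finset.mem_range.1 hi).le
        rw [(hs1 i).mono hi y y' h, (hs2 i).mono hi y y' h])
    rw [← ml.2, hE1, hE, ← integral_sub hI1 hIm]
    refine integral_mono ml.1 (hI1.sub hIm) fun ω => ?_
    refine le_trans (le_of_eq ?_) (cnt1 L (N₁ ω) (N₂ ω))
    exact Finset.sum_congr rfl fun i _ => by rw [hs1d, hs2d, st_iff hN1, st_iff hN2]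
  have hw2 : Ex ch x1 x2 y0 L (fun _ y => ∑ i ∈ Finset.range L, ind (s1 i y ∧ ¬ s2 i y)) ≤ EN₂ - EN := by
    have ml := meas_link P hch hM1 hM2 hlaw y0 L (fun _ y => ∑ i ∈ Finset.range L, ind (s1 i y ∧ ¬ s2 i y))
      (fun w y y' h => Finset.sum_congr rfl fun i hi => by
        have hi := (Finset.mem_range.1 hi).le
        rw [(hs1 i).mono hi y y' h, (hs2 i).mono hi y y' h])
    rw [← ml.2, hE2, hE, ← integral_sub hI2 hIm]
    refine integral_mono ml.1 (hI2.sub hIm) fun ω => ?_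
    have := cnt1 L (N₂ ω) (N₁ ω)
    rw [min_comm] at this
    refine le_trans (le_of_eq ?_) this
    exact Finset.sum_congr rfl fun i _ => by rw [hs1d, hs2d, st_iff hN1, st_iff hN2, and_comm]
  -- correctness
  have hd1 := dL_adp' hN1 g₁ L
  have hd2 := dL_adp' hN2 g₂ L
  set dec1 := dL V N₁ g₁ L with hdec1
  set dec2 := dL V N₂ g₂ L with hdec2
  have hcor : 1 - ρ ≤ Ex ch x1 x2 y0 L (fun w y => ind (dec1 y = w.1 ∧ dec2 y = w.2)) := by
    have ml := meas_link P hch hM1 hM2 hlaw y0 L (fun w y => ind (dec1 y = w.1 ∧ dec2 y = w.2))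
      (fun w y y' h => by
        beta_reduce
        rw [hdec1, hdec2, dL_adp hN1 g₁ L y y' h, dL_adp hN2 g₂ L y y' h])
    rw [← ml.2]
    set S := {ω | g₁ (Yprefix V N₁ ω) ≠ W₁ ω ∨ g₂ (Yprefix V N₂ ω) ≠ W₂ ω} with hS
    let T := toMeasurable P S
    have hTm : MeasurableSet T := measurableSet_toMeasurable P S
    have hTr : P.real T ≤ ε := by
      rw [Measure.real, measure_toMeasurable]
      refine ENNReal.toReal_le_of_le_ofReal hε.le herr.le
    have hTi : Integrable (T.indicator fun _ => (1:ℝ)) P := (integrable_const (1:ℝ)).indicator hTm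
    have hsumi : Integrable (fun ω => ((N₁ ω : ℝ) + N₂ ω) / L) P := (hI1.add hI2).div_const _
    have key : ∫ _, (1:ℝ) ∂P ≤ ∫ ω, (ind (dec1 (fun i => V i ω) = W₁ ω ∧ dec2 (fun i => V i ω) = W₂ ω) +
        T.indicator (fun _ => (1:ℝ)) ω + ((N₁ ω : ℝ) + N₂ ω) / L) ∂P := by
      refine integral_mono (integrable_const _) ((ml.1.add hTi).add hsumi) fun ω => ?_
      have q1 : 0 ≤ ind (dec1 (fun i => V i ω) = W₁ ω ∧ dec2 (fun i => V i ω) = W₂ ω) := ind_nonneg _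
      have q2 : 0 ≤ T.indicator (fun _ => (1:ℝ)) ω := Set.indicator_nonneg (fun _ _ => zero_le_one) ω
      have q3 : 0 ≤ ((N₁ ω : ℝ) + N₂ ω) / L := by positivity
      beta_reduce
      by_cases h1 : N₁ ω ≤ L ∧ N₂ ω ≤ L
      · by_cases hw : ω ∈ S
        · have : T.indicator (fun _ => (1:ℝ)) ω = 1 := Set.indicator_of_mem (subset_toMeasurable P S hw) _
          linarith
        · rw [hS, Set.mem_ofPred_eq] at hw
          push Not at hw
          have : ind (dec1 (fun i => V i ω) = W₁ ω ∧ dec2 (fun i => V i ω) = W₂ ω) = 1 := by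
            apply ind_true
            rw [hdec1, hdec2, dL_at hN1 g₁ h1.1, dL_at hN2 g₂ h1.2]
            exact hw
          linarith
      · have : (L:ℝ) ≤ (N₁ ω : ℝ) + N₂ ω := by exact_mod_cast (by omega : L ≤ N₁ ω + N₂ ω)
        have : 1 ≤ ((N₁ ω : ℝ) + N₂ ω) / L := by rwa [le_div_iff₀ hL0', one_mul]
        linarith
    have h1i : Integrable (fun ω => ind (dec1 (fun i => V i ω) = W₁ ω ∧ dec2 (fun i => V i ω) = W₂ ω)) P := ml.1
    have h2i : Integrable (fun ω => ind (dec1 (fun i => V i ω) = W₁ ω ∧ dec2 (fun i => V i ω) = W₂ ω) +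
      T.indicator (fun _ => (1:ℝ)) ω) P := h1i.add hTi
    rw [integral_add h2i hsumi, integral_add h1i hTi, integral_indicator hTm, integral_div,
      integral_add hI1 hI2, ← hE1, ← hE2] at key
    simp only [integral_const, smul_eq_mul, mul_one, measureReal_restrict_apply_univ, probReal_univ] at key
    linarith
  have hcor1 : 1 - ρ ≤ Ex ch x1 x2 y0 L (fun w y => ind (dec1 y = w.1)) :=
    hcor.trans (Ex_mono hch y0 L fun w y => ind_mono fun h => h.1)
  have hcor2 : 1 - ρ ≤ Ex ch x1 x2 y0 L (fun w y => ind (dec2 y = w.2)) :=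
    hcor.trans (Ex_mono hch y0 L fun w y => ind_mono fun h => h.2)
  have Ele : ∀ p : Fin M₁ × Fin M₂ → (ℕ → Y) → Prop, Ex ch x1 x2 y0 L (fun w y => ind (p w y)) ≤ 1 := fun p => by
    rw [← Ex_one hch (x1 := x1) (x2 := x2) y0 L]
    exact Ex_mono hch y0 L fun w y => ind_le_one _
  have hM1r : (1:ℝ) ≤ M₁ := by exact_mod_cast hM1
  have hM2r : (1:ℝ) ≤ M₂ := by exact_mod_cast hM2
  have hl1 : 0 ≤ Real.log M₁ := Real.log_nonneg hM1r
  have hl2 : 0 ≤ Real.log M₂ := Real.log_nonneg hM2r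
  have arith : ∀ {p lm la lk : ℝ}, 1 - ρ ≤ p → p ≤ 1 → 0 ≤ lm → 0 ≤ la → la ≤ lk →
      (1 - ρ) * lm ≤ p * (lm - la) + lk := by
    intro p lm la lk a b c d e
    nlinarith
  have c1 := conv1 hch hs1 hs2 y0 L hg bl hf hf0 ht ht1 dec1 hd1
  have c2 := conv2 hch hs1 hs2 y0 L hg bl hf hf0 ht ht1 dec2 hd2
  have c3 := conv12 hch hs1 hs2 y0 L hg bl hf hf0 ht ht1 dec1 hd1 dec2 hd2
  rw [hτe, mixt hMM L (fun i w => f (bl i) w) hnP0 τ hnP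
    (fun i w => miNoQ1 ch (cl α (x1 i) (α w.1)) (cl β (x2 i) (β w.2)))] at c1
  rw [hτe, mixt hMM L (fun i w => f (bl i) w) hnP0 τ hnP
    (fun i w => miNoQ2 ch (cl α (x1 i) (α w.1)) (cl β (x2 i) (β w.2)))] at c2
  rw [hτe, mixt hMM L (fun i w => f (bl i) w) hnP0 τ hnP
    (fun i w => miNoQ12 ch (cl α (x1 i) (α w.1)) (cl β (x2 i) (β w.2)))] at c3
  rw [Real.log_div (by simp; omega) (by positivity)] at c1 c2
  rw [Real.log_div (by simp; omega) (by positivity), Real.log_mul (by simp; omega) (by simp; omega)] at c3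
  simp only [Fintype.card_fin] at c1 c2 c3
  have u1 := mul_le_mul_of_nonneg_left hw1 (by linarith : 0 ≤ Cap1 ch + τ)
  have u2 := mul_le_mul_of_nonneg_left hw2 (by linarith : 0 ≤ Cap2 ch + τ)
  have v1 := arith hcor1 (Ele _) hl1 hK0 hK
  have v2 := arith hcor2 (Ele _) hl2 hK0 hK
  have v3 := arith hcor (Ele _) (add_nonneg hl1 hl2) hK0 hK
  refine ⟨Fin L × (Fin M₁ × Fin M₂), inferInstance,
    fun k => f (bl k.1) k.2 / (Fintype.card (Fin M₁ × Fin M₂) * nP),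
    fun k => cl α (x1 k.1) (α k.2.1), fun k => cl β (x2 k.1) (β k.2.2), nP, ⟨?_, ?_⟩,
    fun k => cl_pmf _ _ _, fun k => cl_pmf _ _ _, hnP0, hnPle, hEN0, hEN1, hEN2, ?_, ?_, ?_⟩
  · intro k; exact div_nonneg (hf0 _ _) (by positivity)
  · have := mixt hMM L (fun i w => f (bl i) w) hnP0 0 hnP (fun _ _ => 1)
    simp only [add_zero, mul_one] at this
    rw [hnP] at this
    have h2 : nP * (∑ k : Fin L × (Fin M₁ × Fin M₂), f (bl k.1) k.2 / (Fintype.card (Fin M₁ × Fin M₂) * nP)) = nP * 1 := by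
      rw [← this, mul_one]
    exact mul_left_cancel₀ hnP0.ne' h2
  · linarith
  · linarith
  · linarith

end code
end OB

namespace OB

lemma wavg_le {K : Type} [Fintype K] {w : K → ℝ} (hw : IsPMF w) {g : K → ℝ} {C : ℝ} (h : ∀ k, g k ≤ C) :
    ∑ k, w k * g k ≤ C := by
  calc ∑ k, w k * g k ≤ ∑ k, w k * C := Finset.sum_le_sum fun k _ => mul_le_mul_of_nonneg_left (h k) (hw.1 k)
    _ = C := by rw [← Finset.sum_mul, hw.2, one_mul]

lemma num0 {nP E l I τ κ n C : ℝ} (hnP : nP ≤ E + l) (hl : l ≤ 2 * (κ * n)) (hE : E ≤ n) (hI : 0 ≤ I)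
    (hIC : I ≤ C) (hτ : 0 ≤ τ) (hτκ : τ ≤ κ) (hκ : κ ≤ 1) (hκ0 : 0 < κ) (hn : 0 ≤ n) :
    nP * (I + τ) ≤ E * I + κ * n * (2 * C + 3) := by
  have hκn : 0 ≤ κ * n := by positivity
  have h1 : nP * (I + τ) ≤ (E + l) * (I + τ) := mul_le_mul_of_nonneg_right hnP (by linarith)
  have h2 : E * τ ≤ n * τ := mul_le_mul_of_nonneg_right hE hτ
  have h3 : n * τ ≤ n * κ := mul_le_mul_of_nonneg_left hτκ hn
  have h4 : l * (I + τ) ≤ 2 * (κ * n) * (I + τ) := mul_le_mul_of_nonneg_right hl (by linarith)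
  have h5 : 2 * (κ * n) * (I + τ) ≤ 2 * (κ * n) * (C + 1) :=
    mul_le_mul_of_nonneg_left (by linarith) (by linarith)
  nlinarith

lemma numLHS {κ lm R E : ℝ} (hκ0 : 0 < κ) (hκ : κ ≤ 1 / 2) (hlm : R * E ≤ lm) (hE : 0 < E) :
    R * E - 2 * κ * |R| * E ≤ (1 - 2 * κ) * lm := by
  have h1 : (1 - 2 * κ) * (R * E) ≤ (1 - 2 * κ) * lm := mul_le_mul_of_nonneg_left hlm (by linarith)
  have h2 : κ * E * R ≤ κ * E * |R| := mul_le_mul_of_nonneg_left (le_abs_self R) (by positivity)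
  nlinarith

set_option maxHeartbeats 1600000 in
lemma theorem1
    {X1 X2 Y : Type} [Fintype X1] [Fintype X2] [Fintype Y]
    (ch : X1 → X2 → Y → ℝ) (hch : ∀ a b, IsPMF (ch a b))
    (r₁ r₂ s : ℝ) (hr₁ : 0 < r₁) 
    (hs : s = r₂ / r₁)
    (R₁ R₂ : ℝ)
    (hach : ∀ ε : ℝ, 0 < ε →
      ∃ (Ω : Type) (_ : MeasurableSpace Ω) (P : Measure Ω)
        (_ : IsProbabilityMeasure P)
        (M₁ M₂ : ℕ) (W₁ : Ω → Fin M₁) (W₂ : Ω → Fin M₂)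
        (enc1 : ℕ → Fin M₁ → X1) (enc2 : ℕ → Fin M₂ → X2)
        (V : ℕ → Ω → Y) (N₁ N₂ : Ω → ℕ)
        (g₁ : (ℕ → Option Y) → Fin M₁) (g₂ : (ℕ → Option Y) → Fin M₂)
        (EN₁ EN₂ EN : ℝ),
        0 < M₁ ∧ 0 < M₂ ∧
        (∀ (w₁ : Fin M₁) (w₂ : Fin M₂) (n : ℕ) (y : ℕ → Y),
          P {ω | W₁ ω = w₁ ∧ W₂ ω = w₂ ∧ ∀ i < n, V i ω = y i} =
            ENNReal.ofReal ((1 / ((M₁ : ℝ) * (M₂ : ℝ))) *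
              ∏ i ∈ Finset.range n, ch (enc1 i w₁) (enc2 i w₂) (y i))) ∧
        (∀ (n : ℕ) (ω ω' : Ω),
          (∀ i < n, V i ω = V i ω') → N₁ ω = n → N₁ ω' = n) ∧
        (∀ (n : ℕ) (ω ω' : Ω),
          (∀ i < n, V i ω = V i ω') → N₂ ω = n → N₂ ω' = n) ∧
        Integrable (fun ω => (N₁ ω : ℝ)) P ∧
        Integrable (fun ω => (N₂ ω : ℝ)) P ∧
        EN₁ = ∫ ω, (N₁ ω : ℝ) ∂P ∧
        EN₂ = ∫ ω, (N₂ ω : ℝ) ∂P ∧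
        EN = ∫ ω, ((min (N₁ ω) (N₂ ω) : ℕ) : ℝ) ∂P ∧
        R₁ ≤ Real.log M₁ / EN₁ ∧
        R₂ ≤ Real.log M₂ / EN₂ ∧
        P {ω | g₁ (Yprefix V N₁ ω) ≠ W₁ ω ∨ g₂ (Yprefix V N₂ ω) ≠ W₂ ω} <
          ENNReal.ofReal ε ∧
        r₁ ≤ EN / EN₁ ∧ r₂ ≤ EN / EN₂ ∧ EN₁ / EN₂ = s ∧
        1 / ε ≤ EN₁ ∧ 1 / ε ≤ EN₂) :
    ∃ (σq : Fin 2 → ℝ) (π₁ : Fin 2 → X1 → ℝ) (π₂ : Fin 2 → X2 → ℝ),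
      IsPMF σq ∧ (∀ q, IsPMF (π₁ q)) ∧ (∀ q, IsPMF (π₂ q)) ∧
      R₁ ≤ r₁ * mi1 ch σq π₁ π₂ + (1 - r₁) * Cap1 ch ∧
      R₂ ≤ r₂ * mi2 ch σq π₁ π₂ + (1 - r₂) * Cap2 ch ∧
      s * R₁ + R₂ ≤ r₂ * mi12 ch σq π₁ π₂ +
        s * (1 - r₁) * Cap1 ch + (1 - r₂) * Cap2 ch := by
  have hpre : Nonempty X1 ∧ Nonempty X2 ∧ 0 < s := by
    obtain ⟨Ω, _, P, _, M₁, M₂, W₁, W₂, e1, e2, V, N₁, N₂, g₁, g₂, EN₁, EN₂, EN, hM1, hM2, -, -, -, -, -, -, -,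
      -, -, -, -, -, -, h1, h2, h3⟩ := hach 1 one_pos
    refine ⟨⟨e1 0 ⟨0, hM1⟩⟩, ⟨e2 0 ⟨0, hM2⟩⟩, ?_⟩
    rw [← h1]
    exact div_pos (by linarith) (by linarith)
  obtain ⟨hX1, hX2, hs0⟩ := hpre
  have hsr : s * r₁ = r₂ := by rw [hs]; field_simp
  have hr₂ : 0 < r₂ := by rw [← hsr]; positivity
  have hY : Nonempty Y := by
    by_contra h
    rw [not_nonempty_iff] at h
    have := (hch (Classical.arbitrary X1) (Classical.arbitrary X2)).2
    simp at this
  have hC1 : 0 ≤ Cap1 ch := Cap1_nonneg hch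
  have hC2 : 0 ≤ Cap2 ch := by rw [Cap2_eq]; exact Cap1_nonneg (ch := sw ch) fun a b => hch b a
  refine final_reduction hch hr₁ hr₂ hs fun δ hδ => ?_
  obtain ⟨C, hC⟩ : ∃ C, C = Cap1 ch + Cap2 ch := ⟨_, rfl⟩
  obtain ⟨Q, hQ⟩ : ∃ Q, Q = (2 + s + 1 / s) * (2 * C + 8) + 2 * |R₁| * (1 + s) + 2 * |R₂| := ⟨_, rfl⟩
  have hC0 : 0 ≤ C := by linarith
  have hQ0 : 0 < Q := by rw [hQ]; positivity
  obtain ⟨κ, hκ⟩ : ∃ κ, κ = min (1/2) (δ / Q) := ⟨_, rfl⟩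
  have hκ0 : 0 < κ := by rw [hκ]; positivity
  have hκ2 : κ ≤ 1/2 := by rw [hκ]; exact min_le_left _ _
  have hκQ : κ * Q ≤ δ := by
    rw [← le_div_iff₀ hQ0, hκ]; exact min_le_right _ _
  obtain ⟨m, hm⟩ : ∃ m : ℕ, 1 / κ ^ 2 ≤ m := exists_nat_ge _
  have hm0 : (0:ℝ) < m := lt_of_lt_of_le (by positivity) hm
  have hm0' : 0 < m := by exact_mod_cast hm0
  obtain ⟨t, ht⟩ : ∃ t, t = κ / (1 + κ) := ⟨_, rfl⟩
  have ht0 : 0 < t := by rw [ht]; positivity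
  have ht1 : t < 1 := by rw [ht, div_lt_one (by linarith)]; linarith
  have htau : -Real.log (1 - t) = Real.log (1 + κ) := by
    rw [← Real.log_inv]; congr 1; rw [ht]; field_simp; ring
  have hτ0 : 0 ≤ -Real.log (1 - t) := by rw [htau]; exact Real.log_nonneg (by linarith)
  have hτκ : -Real.log (1 - t) ≤ κ := by
    rw [htau]; have := Real.log_le_sub_one_of_pos (x := 1 + κ) (by linarith); linarith
  generalize hτe : -Real.log (1 - t) = τ at *
  obtain ⟨D, hD⟩ : ∃ D, D = Real.log (Fintype.card Y / t) := ⟨_, rfl⟩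
  have hD0 : 0 < D := by
    rw [hD]; apply Real.log_pos
    rw [lt_div_iff₀ ht0, one_mul]
    have : (1:ℝ) ≤ Fintype.card Y := by exact_mod_cast Fintype.card_pos
    linarith
  obtain ⟨η, hη⟩ : ∃ η, η = κ / (m * D) := ⟨_, rfl⟩
  have hη0 : 0 < η := by rw [hη]; positivity
  obtain ⟨k, hk⟩ : ∃ k : ℕ, (m:ℝ) / η ^ 2 < k := exists_nat_gt _
  have hk' : (m:ℝ) < k * η ^ 2 := by rwa [div_lt_iff₀ (by positivity)] at hk
  obtain ⟨G, hG⟩ : ∃ G, G = 1 + k * Real.log (Fintype.card X1 * Fintype.card X2) := ⟨_, rfl⟩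
  have hG1 : 1 ≤ G := by
    rw [hG]
    have : 0 ≤ Real.log ((Fintype.card X1 : ℝ) * Fintype.card X2) := Real.log_nonneg (by
      exact_mod_cast Nat.mul_pos Fintype.card_pos Fintype.card_pos)
    have : 0 ≤ k * Real.log ((Fintype.card X1 : ℝ) * Fintype.card X2) := by positivity
    linarith
  have hε0 : 0 < κ / G := by positivity
  have hεκ : κ / G ≤ κ := div_le_self hκ0.le hG1
  obtain ⟨Ω, _, P, _, M₁, M₂, W₁, W₂, e1, e2, V, N₁, N₂, g₁, g₂, E1, E2, E, hM1, hM2, hlaw, hN1, hN2, hI1, hI2,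
      hE1, hE2, hE, hR1, hR2, herr, hr1E, hr2E, hsE, h1ε, h2ε⟩ := hach (κ / G) hε0
  rw [one_div_div, div_le_iff₀ hκ0] at h1ε h2ε
  have hE1p : 0 < E1 := by by_contra h; push Not at h; have := mul_nonpos_of_nonpos_of_nonneg h hκ0.le; linarith
  have hE2p : 0 < E2 := by by_contra h; push Not at h; have := mul_nonpos_of_nonpos_of_nonneg h hκ0.le; linarith
  obtain ⟨n, hn⟩ : ∃ n, n = E1 + E2 := ⟨_, rfl⟩
  have hn0 : 0 < n := by linarith
  obtain ⟨l, hl⟩ : ∃ l : ℕ, l = ⌈κ * n⌉₊ := ⟨_, rfl⟩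
  have hl0 : 0 < l := by rw [hl]; exact Nat.ceil_pos.2 (by positivity)
  have hl1 : κ * n ≤ l := by rw [hl]; exact Nat.le_ceil _
  have hl2 : (l:ℝ) ≤ 2 * (κ * n) := by
    have := (Nat.ceil_lt_add_one (a := κ * n) (by positivity)).le
    rw [← hl] at this
    have : κ * n = E1 * κ + E2 * κ := by rw [hn]; ring
    have : 0 < E2 * κ := by positivity
    linarith
  have hρ : κ / G + (E1 + E2) / ((m * l : ℕ) : ℝ) ≤ 2 * κ := by
    have hl0' : (0:ℝ) < l := by exact_mod_cast hl0
    have : (E1 + E2) / ((m * l : ℕ) : ℝ) ≤ κ := by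
      rw [← hn]; push_cast
      rw [div_le_iff₀ (by positivity)]
      have h1 : 1 ≤ κ ^ 2 * m := by rw [div_le_iff₀ (by positivity)] at hm; linarith
      have h2 : κ * m * (κ * n) ≤ κ * m * l := mul_le_mul_of_nonneg_left hl1 (by positivity)
      have h3 : 1 * n ≤ κ ^ 2 * m * n := mul_le_mul_of_nonneg_right h1 hn0.le
      linarith
    linarith
  obtain ⟨K, iK, w, π₁, π₂, nP, hw, hp1, hp2, hnP0, hnPle, hEN0, hEN1, hEN2, c1, c2, c3⟩ :=
    code_lemma hch (fun _ => Classical.arbitrary Y) P hM1 hM2 hlaw hN1 hN2 hI1 hI2 hE1 hE2 hE g₁ g₂ hε0 herr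
      hm0' hl0 ht0 ht1 hη0 hk' hρ
  refine ⟨K, iK, w, π₁, π₂, hw, hp1, hp2, ?_⟩
  have i1 : ∑ k, w k * miNoQ1 ch (π₁ k) (π₂ k) ≤ Cap1 ch := wavg_le hw fun k => miNoQ1_le_Cap1 hch (hp1 k) (hp2 k)
  have i2 : ∑ k, w k * miNoQ2 ch (π₁ k) (π₂ k) ≤ Cap2 ch := wavg_le hw fun k => miNoQ2_le_Cap2 hch (hp1 k) (hp2 k)
  have i3 : ∑ k, w k * miNoQ12 ch (π₁ k) (π₂ k) ≤ C := wavg_le hw fun k => by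
    have := submod hch (hp1 k) (hp2 k)
    have := miNoQ1_le_Cap1 hch (hp1 k) (hp2 k)
    have := miNoQ2_le_Cap2 hch (hp1 k) (hp2 k)
    linarith
  have j1 : 0 ≤ ∑ k, w k * miNoQ1 ch (π₁ k) (π₂ k) :=
    Finset.sum_nonneg fun k _ => mul_nonneg (hw.1 k) (miNoQ1_nonneg hch (hp1 k) (hp2 k))
  have j2 : 0 ≤ ∑ k, w k * miNoQ2 ch (π₁ k) (π₂ k) :=
    Finset.sum_nonneg fun k _ => mul_nonneg (hw.1 k) (miNoQ2_nonneg hch (hp1 k) (hp2 k))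
  have j3 : 0 ≤ ∑ k, w k * miNoQ12 ch (π₁ k) (π₂ k) :=
    Finset.sum_nonneg fun k _ => mul_nonneg (hw.1 k) (miNoQ12_nonneg hch (hp1 k) (hp2 k))
  generalize (∑ k, w k * miNoQ1 ch (π₁ k) (π₂ k)) = I1 at *
  generalize (∑ k, w k * miNoQ2 ch (π₁ k) (π₂ k)) = I2 at *
  generalize (∑ k, w k * miNoQ12 ch (π₁ k) (π₂ k)) = I3 at *
  generalize Cap1 ch = C1 at *
  generalize Cap2 ch = C2 at *
  rw [hτe] at c1 c2 c3
  have hLη : ((m * l : ℕ) : ℝ) * (η * Real.log (Fintype.card Y / t)) = κ * l := by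
    rw [← hD, hη]; push_cast; field_simp
  rw [hLη, add_assoc _ (1:ℝ), ← hG] at c1 c2 c3
  rw [le_div_iff₀ hE1p] at hR1 hr1E
  rw [le_div_iff₀ hE2p] at hR2 hr2E
  rw [div_eq_iff hE2p.ne'] at hsE
  have q1 := numLHS hκ0 hκ2 hR1 hE1p
  have q2 := numLHS hκ0 hκ2 hR2 hE2p
  have hEn : E ≤ n := by linarith
  have z1 := num0 hnPle hl2 hEn j1 (i1.trans (by linarith : C1 ≤ C)) hτ0 hτκ (by linarith) hκ0 hn0.le
  have z2 := num0 hnPle hl2 hEn j2 (i2.trans (by linarith : C2 ≤ C)) hτ0 hτκ (by linarith) hκ0 hn0.le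
  have z3 := num0 hnPle hl2 hEn j3 i3 hτ0 hτκ (by linarith) hκ0 hn0.le
  have hκl : κ * l ≤ 2 * (κ * n) := by
    have : κ * l ≤ 1 * l := mul_le_mul_of_nonneg_right (by linarith) (by positivity)
    linarith
  have hκn : κ * n = κ * E1 + κ * E2 := by rw [hn]; ring
  have hκ1 : 0 ≤ κ * E1 := by positivity
  have hκ2 : 0 ≤ κ * E2 := by positivity
  have t1 : τ * (E1 - E) ≤ κ * n := by
    have : τ * (E1 - E) ≤ κ * (E1 - E) := mul_le_mul_of_nonneg_right hτκ (by linarith)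
    have : 0 ≤ κ * E := by positivity
    linarith
  have t2 : τ * (E2 - E) ≤ κ * n := by
    have : τ * (E2 - E) ≤ κ * (E2 - E) := mul_le_mul_of_nonneg_right hτκ (by linarith)
    have : 0 ≤ κ * E := by positivity
    linarith
  have b1 : R₁ * E1 ≤ E * I1 + C1 * (E1 - E) + κ * n * (2 * C + 8) + 2 * κ * |R₁| * E1 := by linarith
  have b2 : R₂ * E2 ≤ E * I2 + C2 * (E2 - E) + κ * n * (2 * C + 8) + 2 * κ * |R₂| * E2 := by linarith
  have b3 : R₁ * E1 + R₂ * E2 ≤ E * I3 + C1 * (E1 - E) + C2 * (E2 - E) + κ * n * (2 * C + 8) +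
    2 * κ * |R₁| * E1 + 2 * κ * |R₂| * E2 := by linarith
  have d1 : (E - r₁ * E1) * (I1 - C1) ≤ 0 := mul_nonpos_of_nonneg_of_nonpos (by linarith) (by linarith)
  have d2 : (E - r₂ * E2) * (I2 - C2) ≤ 0 := mul_nonpos_of_nonneg_of_nonpos (by linarith) (by linarith)
  have d3 : (E - r₂ * E2) * (I3 - C1 - C2) ≤ 0 := mul_nonpos_of_nonneg_of_nonpos (by linarith) (by linarith)
  have n1 : n = (1 + 1 / s) * E1 := by rw [hn, hsE]; field_simp
  have n2 : n = (1 + s) * E2 := by rw [hn, hsE]; ring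
  have hsi : 0 < 1 / s := by positivity
  have a1 := abs_nonneg R₁
  have a2 := abs_nonneg R₂
  have sa1 : 0 ≤ s * |R₁| := by positivity
  have Q1 : κ * ((1 + 1 / s) * (2 * C + 8) + 2 * |R₁|) ≤ δ := by
    refine le_trans (mul_le_mul_of_nonneg_left ?_ hκ0.le) hκQ
    rw [hQ]; have : 0 ≤ (1 + s) * (2 * C + 8) := by positivity
    linarith
  have Q2 : κ * ((1 + s) * (2 * C + 8) + 2 * |R₂|) ≤ δ := by
    refine le_trans (mul_le_mul_of_nonneg_left ?_ hκ0.le) hκQ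
    rw [hQ]; have : 0 ≤ (1 + 1 / s) * (2 * C + 8) := by positivity
    linarith
  have Q3 : κ * ((1 + s) * (2 * C + 8) + 2 * (s * |R₁|) + 2 * |R₂|) ≤ δ := by
    refine le_trans (mul_le_mul_of_nonneg_left ?_ hκ0.le) hκQ
    rw [hQ]; have : 0 ≤ (1 + 1 / s) * (2 * C + 8) := by positivity
    linarith
  refine ⟨?_, ?_, ?_⟩
  · refine le_of_mul_le_mul_right ?_ hE1p
    have := mul_le_mul_of_nonneg_right Q1 hE1p.le
    rw [n1] at b1
    linarith
  · refine le_of_mul_le_mul_right ?_ hE2p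
    have := mul_le_mul_of_nonneg_right Q2 hE2p.le
    rw [n2] at b2
    linarith
  · refine le_of_mul_le_mul_right ?_ hE2p
    have := mul_le_mul_of_nonneg_right Q3 hE2p.le
    have e : s * (1 - r₁) = s - r₂ := by rw [← hsr]; ring
    rw [e]
    rw [n2, hsE] at b3
    linarith

end OB

/-- **Theorem 1 (Outer bound).** Let `0 < r₁ ≤ 1`, `0 ≤ r₂ ≤ 1`, `s = r₂/r₁`.
If `(R₁,R₂) ∈ 𝒞_{r₁,r₂}`, i.e. for every `ε > 0` there is an
`(M₁,M₂,N₁,N₂)` variable length code with rates at least `(R₁,R₂)`, error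
probability `< ε`, `E[N]/E[N₁] ≥ r₁`, `E[N]/E[N₂] ≥ r₂`, `E[N₁]/E[N₂] = s`,
and with `E[N₁], E[N₂] → ∞` as `ε → 0` (here: `E[N₁], E[N₂] ≥ 1/ε`), then
there is a joint distribution `p(q)p(x₁|q)p(x₂|q)p(y|x₁,x₂)` with `|𝒬| ≤ 2`
(modeled on `Fin 2`) such that
`R₁ ≤ r₁·I(X₁;Y|X₂,Q) + (1−r₁)C₁`, `R₂ ≤ r₂·I(X₂;Y|X₁,Q) + (1−r₂)C₂`, and
`s·R₁ + R₂ ≤ r₂·I(X₁,X₂;Y|Q) + s(1−r₁)C₁ + (1−r₂)C₂`. -/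
theorem theorem1_outer_bound
    {𝒳₁ 𝒳₂ 𝒴 : Type} [Fintype 𝒳₁] [Fintype 𝒳₂] [Fintype 𝒴]
    (ch : 𝒳₁ → 𝒳₂ → 𝒴 → ℝ)
    (hch0 : ∀ x₁ x₂ y, 0 ≤ ch x₁ x₂ y)
    (hch1 : ∀ x₁ x₂, ∑ y, ch x₁ x₂ y = 1)
    (r₁ r₂ s : ℝ) (hr₁ : 0 < r₁) (hr₁' : r₁ ≤ 1) (hr₂ : 0 ≤ r₂) (hr₂' : r₂ ≤ 1)
    (hs : s = r₂ / r₁)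
    (R₁ R₂ : ℝ)
    (hach : ∀ ε : ℝ, 0 < ε →
      ∃ (Ω : Type) (_ : MeasurableSpace Ω) (P : Measure Ω)
        (_ : IsProbabilityMeasure P)
        (M₁ M₂ : ℕ) (W₁ : Ω → Fin M₁) (W₂ : Ω → Fin M₂)
        (enc1 : ℕ → Fin M₁ → 𝒳₁) (enc2 : ℕ → Fin M₂ → 𝒳₂)
        (Y : ℕ → Ω → 𝒴) (N₁ N₂ : Ω → ℕ)
        (g₁ : (ℕ → Option 𝒴) → Fin M₁) (g₂ : (ℕ → Option 𝒴) → Fin M₂)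
        (EN₁ EN₂ EN : ℝ),
        0 < M₁ ∧ 0 < M₂ ∧
        -- independent uniform messages and memoryless channel law
        (∀ (w₁ : Fin M₁) (w₂ : Fin M₂) (n : ℕ) (y : ℕ → 𝒴),
          P {ω | W₁ ω = w₁ ∧ W₂ ω = w₂ ∧ ∀ i < n, Y i ω = y i} =
            ENNReal.ofReal ((1 / ((M₁ : ℝ) * (M₂ : ℝ))) *
              ∏ i ∈ Finset.range n, ch (enc1 i w₁) (enc2 i w₂) (y i))) ∧
        -- the decoding times are stopping times for the outputs
        (∀ (n : ℕ) (ω ω' : Ω),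
          (∀ i < n, Y i ω = Y i ω') → N₁ ω = n → N₁ ω' = n) ∧
        (∀ (n : ℕ) (ω ω' : Ω),
          (∀ i < n, Y i ω = Y i ω') → N₂ ω = n → N₂ ω' = n) ∧
        Integrable (fun ω => (N₁ ω : ℝ)) P ∧
        Integrable (fun ω => (N₂ ω : ℝ)) P ∧
        EN₁ = ∫ ω, (N₁ ω : ℝ) ∂P ∧
        EN₂ = ∫ ω, (N₂ ω : ℝ) ∂P ∧
        EN = ∫ ω, ((min (N₁ ω) (N₂ ω) : ℕ) : ℝ) ∂P ∧
        -- rates measured at the receiver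
        R₁ ≤ Real.log M₁ / EN₁ ∧
        R₂ ≤ Real.log M₂ / EN₂ ∧
        -- average probability of error below ε
        P {ω | g₁ (Yprefix Y N₁ ω) ≠ W₁ ω ∨ g₂ (Yprefix Y N₂ ω) ≠ W₂ ω} <
          ENNReal.ofReal ε ∧
        -- timing constraints of 𝒞_{r₁,r₂}
        r₁ ≤ EN / EN₁ ∧ r₂ ≤ EN / EN₂ ∧ EN₁ / EN₂ = s ∧
        -- expected decoding times tend to infinity as ε → 0
        1 / ε ≤ EN₁ ∧ 1 / ε ≤ EN₂) :
    ∃ (σq : Fin 2 → ℝ) (π₁ : Fin 2 → 𝒳₁ → ℝ) (π₂ : Fin 2 → 𝒳₂ → ℝ),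
      IsPMF σq ∧ (∀ q, IsPMF (π₁ q)) ∧ (∀ q, IsPMF (π₂ q)) ∧
      R₁ ≤ r₁ * mi1 ch σq π₁ π₂ + (1 - r₁) * Cap1 ch ∧
      R₂ ≤ r₂ * mi2 ch σq π₁ π₂ + (1 - r₂) * Cap2 ch ∧
      s * R₁ + R₂ ≤ r₂ * mi12 ch σq π₁ π₂ +
        s * (1 - r₁) * Cap1 ch + (1 - r₂) * Cap2 ch := by
  exact OB.theorem1 ch (fun a b => ⟨hch0 a b, hch1 a b⟩) r₁ r₂ s hr₁ hs R₁ R₂ hach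

end
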